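/- arXiv:0711.2666 — 3 statements merged into one kernel-verified Lean document; each statement's English description precedes it below -/
import Mathlib

section
/- Let ℙ be the law of a stationary ergodic process (X_n)_{n≥1} with marginals P_n, and let ℚ be the law of a stationary process (Y_n)_{n≥1} with marginals Q_n satisfying the mixing condition C^{−1}ℚ(A)ℚ(B) ≤ ℚ(A∩B) ≤ Cℚ(A)ℚ(B) for some 1 ≤ C < ∞, all n, all A ∈ σ(Y_1^n) and B ∈ σ(Y_{n+1}^∞). Then the limit Λ_∞(ℙ,ℚ,λ) := lim_{n→∞} (1/n) Λ_n(P_n, Q_n, nλ) exists (in the extended reals) for every λ, and R_∞(ℙ,ℚ,D) = Λ*_∞(ℙ,ℚ,D) := sup_{λ ≤ 0} [λD − Λ_∞(ℙ,ℚ,λ)] for every D. -/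
open MeasureTheory Filter Set Topology Classical
open scoped ENNReal NNReal

noncomputable section

/-- `-log t` as a value in `ℝ≥0∞` (equal to `∞` when `t = 0`); intended for `t ≤ 1`. -/
def negLog (t : ℝ≥0∞) : ℝ≥0∞ :=
  if t = 0 then ∞ else ENNReal.ofReal (-Real.log t.toReal)

/-- `log t` as a value in `ℝ≥0∞` (equal to `∞` when `t = ∞`); intended for `t ≥ 1`. -/
def posLog (t : ℝ≥0∞) : ℝ≥0∞ :=
  if t = ∞ then ∞ else ENNReal.ofReal (Real.log t.toReal)

/-- The extended-real-valued logarithm of an `ℝ≥0∞` number. -/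
def eLog (t : ℝ≥0∞) : EReal :=
  if t = 0 then ⊥ else if t = ∞ then ⊤ else ((Real.log t.toReal : ℝ) : EReal)

/-- Relative entropy `H(μ‖ν)` (in nats), valued in `ℝ≥0∞`: it equals
`∫ log (dμ/dν) dμ` when `μ ≪ ν` (and `+∞` when this integral is not defined,
which for probability measures can only mean `+∞`), and `+∞` when `¬ μ ≪ ν`. -/
def relEnt {α : Type*} [MeasurableSpace α] (μ ν : Measure α) : ℝ≥0∞ :=
  if μ ≪ ν ∧ Integrable (llr μ ν) μ then ENNReal.ofReal (∫ x, llr μ ν x ∂μ) else ∞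

/-- The set `W(P,D)` of couplings: probability measures on `S × T` with first
marginal `P` and expected distortion at most `D`. -/
def distSet {S T : Type*} [MeasurableSpace S] [MeasurableSpace T]
    (ρ : S × T → ℝ) (P : Measure S) (D : ℝ) : Set (Measure (S × T)) :=
  {W | IsProbabilityMeasure W ∧ W.map Prod.fst = P ∧
    ((∫⁻ z, ENNReal.ofReal (ρ z) ∂W : ℝ≥0∞) : EReal) ≤ ((D : ℝ) : EReal)}

/-- The rate function `R(P,Q,D) = inf_{W ∈ W(P,D)} H(W‖P×Q)` (equal to `+∞`
when `W(P,D)` is empty). -/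
def Rrate {S T : Type*} [MeasurableSpace S] [MeasurableSpace T]
    (ρ : S × T → ℝ) (P : Measure S) (Q : Measure T) (D : ℝ) : ℝ≥0∞ :=
  ⨅ W ∈ distSet ρ P D, relEnt W (P.prod Q)

/-- `Λ(P,Q,λ) = E_X[log E_Y e^{λρ(X,Y)}]`, valued in `EReal`.
For `λ ≥ 0` the integrand lies in `[0,∞]`; for `λ < 0` it lies in `[-∞,0]`. -/
def Lam {S T : Type*} [MeasurableSpace S] [MeasurableSpace T]
    (ρ : S × T → ℝ) (P : Measure S) (Q : Measure T) (l : ℝ) : EReal :=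
  if 0 ≤ l then
    ((∫⁻ x, posLog (∫⁻ y, ENNReal.ofReal (Real.exp (l * ρ (x, y))) ∂Q) ∂P : ℝ≥0∞) : EReal)
  else
    -(((∫⁻ x, negLog (∫⁻ y, ENNReal.ofReal (Real.exp (l * ρ (x, y))) ∂Q) ∂P : ℝ≥0∞) : EReal))

/-- The Fenchel–Legendre transform `Λ*(P,Q,D) = sup_{λ ≤ 0} [λD - Λ(P,Q,λ)]`. -/
def LamStar {S T : Type*} [MeasurableSpace S] [MeasurableSpace T]
    (ρ : S × T → ℝ) (P : Measure S) (Q : Measure T) (D : ℝ) : EReal :=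
  ⨆ l ∈ Iic (0 : ℝ), (((l * D : ℝ) : EReal) - Lam ρ P Q l)

/-- `ρ_Q(x) := essinf_{Y ∼ Q} ρ(x,Y)`. -/
def rhoQ {S T : Type*} [MeasurableSpace T]
    (ρ : S × T → ℝ) (Q : Measure T) (x : S) : ℝ :=
  essInf (fun y => ρ (x, y)) Q

/-- `D_min(P,Q) := inf {D : Λ*(P,Q,D) < ∞}`. -/
def DminPQ {S T : Type*} [MeasurableSpace S] [MeasurableSpace T]
    (ρ : S × T → ℝ) (P : Measure S) (Q : Measure T) : ℝ :=
  sInf {D : ℝ | LamStar ρ P Q D ≠ ⊤}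

/-- `D_ave(P,Q) := E ρ(X,Y)` for independent `X ∼ P`, `Y ∼ Q`, valued in `ℝ≥0∞`. -/
def DavePQ {S T : Type*} [MeasurableSpace S] [MeasurableSpace T]
    (ρ : S × T → ℝ) (P : Measure S) (Q : Measure T) : ℝ≥0∞ :=
  ∫⁻ z, ENNReal.ofReal (ρ z) ∂(P.prod Q)

/-- The candidate derivative `Λ'(λ)` of `Λ(P,Q,·)`. -/
def LamD {S T : Type*} [MeasurableSpace S] [MeasurableSpace T]
    (ρ : S × T → ℝ) (P : Measure S) (Q : Measure T) (l : ℝ) : ℝ :=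
  ∫ x, (∫ y, ρ (x, y) * Real.exp (l * ρ (x, y)) ∂Q) /
    (∫ y, Real.exp (l * ρ (x, y)) ∂Q) ∂P

/-- The left shift on sequences. -/
def shiftSeq {α : Type*} (x : ℕ → α) (n : ℕ) : α := x (n + 1)

/-- The single-letter distortion measure `ρ_n` on `n`-strings. -/
def rhoFin {S T : Type*} (ρ : S × T → ℝ) (n : ℕ) (x : Fin n → S) (y : Fin n → T) : ℝ :=
  (n : ℝ)⁻¹ * ∑ k, ρ (x k, y k)

/-- `L_n(x_1^n, Q^n, D) = -(1/n) log Q^n(B_n(x_1^n,D))`, valued in `ℝ≥0∞`,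
for a memoryless (product) codebook distribution `Q^n`. -/
def LnIID {S T : Type*} [MeasurableSpace T]
    (ρ : S × T → ℝ) (Q : Measure T) (D : ℝ) (n : ℕ) (x : ℕ → S) : ℝ≥0∞ :=
  (n : ℝ≥0∞)⁻¹ *
    negLog ((Measure.pi fun _ : Fin n => Q) {y | rhoFin ρ n (fun k => x k) y ≤ D})

/-- The empirical distribution `P_{x_1^n} = (1/n) ∑_{k=1}^n δ_{x_k}`. -/
def empMeas {S : Type*} [MeasurableSpace S] (n : ℕ) (x : ℕ → S) : Measure S :=
  (n : ℝ≥0∞)⁻¹ • ∑ k ∈ Finset.range n, Measure.dirac (x k)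

/-- The `n`-dimensional marginal of a measure on sequences. -/
def margN {α : Type*} [MeasurableSpace α] (μ : Measure (ℕ → α)) (n : ℕ) :
    Measure (Fin n → α) :=
  μ.map fun x (k : Fin n) => x (k : ℕ)

/-- The strong mixing condition `C⁻¹ 𝒬(A) 𝒬(B) ≤ 𝒬(A ∩ B) ≤ C 𝒬(A) 𝒬(B)` for all
`A ∈ σ(Y_1^n)`, `B ∈ σ(Y_{n+1}^∞)` and all `n`. -/
def Mixing {T : Type*} [MeasurableSpace T] (𝒬 : Measure (ℕ → T)) (C : ℝ) : Prop :=
  ∀ (n : ℕ) (A B : Set (ℕ → T)),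
    MeasurableSet[MeasurableSpace.comap (fun y (k : Fin n) => y (k : ℕ)) inferInstance] A →
    MeasurableSet[MeasurableSpace.comap (fun y (k : ℕ) => y (k + n)) inferInstance] B →
    (ENNReal.ofReal C)⁻¹ * (𝒬 A * 𝒬 B) ≤ 𝒬 (A ∩ B) ∧
      𝒬 (A ∩ B) ≤ ENNReal.ofReal C * (𝒬 A * 𝒬 B)

/-- `L_n(x_1^n, Q_n, D) = -(1/n) log Q_n(B_n(x_1^n,D))` where `Q_n` is the
`n`-dimensional marginal of the codebook process law `𝒬`. -/
def LnMem {S T : Type*} [MeasurableSpace T]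
    (ρ : S × T → ℝ) (𝒬 : Measure (ℕ → T)) (D : ℝ) (n : ℕ) (x : ℕ → S) : ℝ≥0∞ :=
  (n : ℝ≥0∞)⁻¹ * negLog (margN 𝒬 n {y | rhoFin ρ n (fun k => x k) y ≤ D})

/-- The set `W_n(P_n,D)` of couplings on `S^n × T^n`. -/
def distSetN {S T : Type*} [MeasurableSpace S] [MeasurableSpace T]
    (ρ : S × T → ℝ) (n : ℕ) (Pn : Measure (Fin n → S)) (D : ℝ) :
    Set (Measure ((Fin n → S) × (Fin n → T))) :=
  {W | IsProbabilityMeasure W ∧ W.map Prod.fst = Pn ∧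
    ((∫⁻ z, ENNReal.ofReal (rhoFin ρ n z.1 z.2) ∂W : ℝ≥0∞) : EReal) ≤ ((D : ℝ) : EReal)}

/-- `R_n(P_n,Q_n,D) = (1/n) inf_{W_n ∈ W_n(P_n,D)} H(W_n‖P_n×Q_n)`. -/
def RnMem {S T : Type*} [MeasurableSpace S] [MeasurableSpace T]
    (ρ : S × T → ℝ) (n : ℕ) (Pn : Measure (Fin n → S)) (Qn : Measure (Fin n → T))
    (D : ℝ) : ℝ≥0∞ :=
  (n : ℝ≥0∞)⁻¹ * ⨅ W ∈ distSetN ρ n Pn D, relEnt W (Pn.prod Qn)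

/-- `Λ_n(P_n,Q_n,λ) = E_{X_1^n}[log E_{Y_1^n} e^{λ ρ_n(X_1^n,Y_1^n)}]`. -/
def LamN {S T : Type*} [MeasurableSpace S] [MeasurableSpace T]
    (ρ : S × T → ℝ) (n : ℕ) (Pn : Measure (Fin n → S)) (Qn : Measure (Fin n → T))
    (l : ℝ) : EReal :=
  Lam (fun z => rhoFin ρ n z.1 z.2) Pn Qn l

/-- `Λ_n*(P_n,Q_n,D) = (1/n) sup_{λ ≤ 0} [λD - Λ_n(P_n,Q_n,λ)]`. -/
def LamStarN {S T : Type*} [MeasurableSpace S] [MeasurableSpace T]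
    (ρ : S × T → ℝ) (n : ℕ) (Pn : Measure (Fin n → S)) (Qn : Measure (Fin n → T))
    (D : ℝ) : EReal :=
  (((n : ℝ)⁻¹ : ℝ) : EReal) *
    ⨆ l ∈ Iic (0 : ℝ), (((l * D : ℝ) : EReal) - LamN ρ n Pn Qn l)

/-- One-sided Fenchel–Legendre transform `D ↦ sup_{λ ≤ 0} [λD - Λ(λ)]` of a
function `Λ : ℝ → EReal`. -/
def FLT (L : ℝ → EReal) (D : ℝ) : EReal :=
  ⨆ l ∈ Iic (0 : ℝ), (((l * D : ℝ) : EReal) - L l)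

/-! ### Single-letter duality -/

/-- Laplace transform, as a real number. -/
def ZZ {α β : Type*} [MeasurableSpace β] (ρ : α × β → ℝ) (Q : Measure β) (t : ℝ) (x : α) : ℝ :=
  ∫ y, Real.exp (-t * ρ (x, y)) ∂Q

/-- Minus log-Laplace transform. -/
def ph {α β : Type*} [MeasurableSpace β] (ρ : α × β → ℝ) (Q : Measure β) (t : ℝ) (x : α) : ℝ :=
  -Real.log (ZZ ρ Q t x)

set_option linter.unusedSectionVars false
set_option linter.style.haveILetI false

section duality

variable {α β : Type*} [MeasurableSpace α] [MeasurableSpace β] {ρ : α × β → ℝ}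
  {P : Measure α} {Q : Measure β} [IsProbabilityMeasure P] [IsProbabilityMeasure Q]

lemma exp_le_one_aux (hρ0 : ∀ z, 0 ≤ ρ z) {t : ℝ} (ht : 0 ≤ t) (z : α × β) :
    Real.exp (-t * ρ z) ≤ 1 := by
  rw [Real.exp_le_one_iff]
  nlinarith [mul_nonneg ht (hρ0 z)]

lemma integrable_exp_aux (hρm : Measurable ρ) (hρ0 : ∀ z, 0 ≤ ρ z) {t : ℝ} (ht : 0 ≤ t) (x : α) :
    Integrable (fun y => Real.exp (-t * ρ (x, y))) Q := by
  refine Integrable.of_bound (C := 1) ?_ ?_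
  · exact (by fun_prop : Measurable fun y => Real.exp (-t * ρ (x, y))).aestronglyMeasurable
  · refine Eventually.of_forall fun y => ?_
    rw [Real.norm_eq_abs, abs_of_pos (Real.exp_pos _)]
    exact exp_le_one_aux hρ0 ht _

lemma ZZ_pos (hρm : Measurable ρ) (hρ0 : ∀ z, 0 ≤ ρ z) {t : ℝ} (ht : 0 ≤ t) (x : α) :
    0 < ZZ ρ Q t x :=
  integral_exp_pos (integrable_exp_aux hρm hρ0 ht x)

lemma ZZ_le_one (hρm : Measurable ρ) (hρ0 : ∀ z, 0 ≤ ρ z) {t : ℝ} (ht : 0 ≤ t) (x : α) :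
    ZZ ρ Q t x ≤ 1 := by
  have : ZZ ρ Q t x ≤ ∫ y, (1 : ℝ) ∂Q :=
    integral_mono (integrable_exp_aux hρm hρ0 ht x) (integrable_const _)
      (fun y => exp_le_one_aux hρ0 ht _)
  simpa using this

lemma ph_nonneg (hρm : Measurable ρ) (hρ0 : ∀ z, 0 ≤ ρ z) {t : ℝ} (ht : 0 ≤ t) (x : α) :
    0 ≤ ph ρ Q t x := by
  have := Real.log_nonpos (ZZ_pos (Q := Q) hρm hρ0 ht x).le (ZZ_le_one hρm hρ0 ht x)
  unfold ph; linarith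

lemma exp_neg_ph (hρm : Measurable ρ) (hρ0 : ∀ z, 0 ≤ ρ z) {t : ℝ} (ht : 0 ≤ t) (x : α) :
    Real.exp (-ph ρ Q t x) = ZZ ρ Q t x := by
  simp [ph, Real.exp_log (ZZ_pos (Q := Q) hρm hρ0 ht x)]

lemma lint_exp (hρm : Measurable ρ) (hρ0 : ∀ z, 0 ≤ ρ z) {t : ℝ} (ht : 0 ≤ t) (x : α) :
    ∫⁻ y, ENNReal.ofReal (Real.exp (-t * ρ (x, y))) ∂Q = ENNReal.ofReal (ZZ ρ Q t x) :=
  (ofReal_integral_eq_lintegral_ofReal (integrable_exp_aux hρm hρ0 ht x)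
    (Eventually.of_forall fun _ => (Real.exp_pos _).le)).symm

lemma negLog_lint (hρm : Measurable ρ) (hρ0 : ∀ z, 0 ≤ ρ z) {t : ℝ} (ht : 0 ≤ t) (x : α) :
    negLog (∫⁻ y, ENNReal.ofReal (Real.exp (-t * ρ (x, y))) ∂Q)
      = ENNReal.ofReal (ph ρ Q t x) := by
  rw [lint_exp hρm hρ0 ht]
  have := ZZ_pos (Q := Q) hρm hρ0 ht x
  unfold negLog
  rw [if_neg (by simpa using this), ENNReal.toReal_ofReal this.le]
  rfl

lemma tilt_one (hρm : Measurable ρ) (hρ0 : ∀ z, 0 ≤ ρ z) {t : ℝ} (ht : 0 ≤ t) (x : α) :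
    ∫⁻ y, ENNReal.ofReal (Real.exp (ph ρ Q t x - t * ρ (x, y))) ∂Q = 1 := by
  have h : ∀ y, ENNReal.ofReal (Real.exp (ph ρ Q t x - t * ρ (x, y)))
      = ENNReal.ofReal (Real.exp (ph ρ Q t x)) * ENNReal.ofReal (Real.exp (-t * ρ (x, y))) := by
    intro y
    rw [← ENNReal.ofReal_mul (Real.exp_pos _).le, ← Real.exp_add]
    congr 2; ring
  simp_rw [h]
  rw [lintegral_const_mul _ (by fun_prop), lint_exp hρm hρ0 ht, ← exp_neg_ph hρm hρ0 ht,
    ← ENNReal.ofReal_mul (Real.exp_pos _).le, ← Real.exp_add]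
  simp

lemma measurable_ZZ (hρm : Measurable ρ) (t : ℝ) : Measurable (ZZ ρ Q t) := by
  have : StronglyMeasurable (fun z : α × β => Real.exp (-t * ρ z)) :=
    (by fun_prop : Measurable fun z : α × β => Real.exp (-t * ρ z)).stronglyMeasurable
  exact this.integral_prod_right.measurable

lemma measurable_ph (hρm : Measurable ρ) (t : ℝ) : Measurable (ph ρ Q t) :=
  (Real.measurable_log.comp (measurable_ZZ hρm t)).neg

lemma ph_mono (hρm : Measurable ρ) (hρ0 : ∀ z, 0 ≤ ρ z) {s t : ℝ} (hs : 0 ≤ s) (hst : s ≤ t)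
    (x : α) : ph ρ Q s x ≤ ph ρ Q t x := by
  unfold ph
  refine neg_le_neg (Real.log_le_log (ZZ_pos hρm hρ0 (hs.trans hst) x) ?_)
  refine integral_mono (integrable_exp_aux hρm hρ0 (hs.trans hst) x)
    (integrable_exp_aux hρm hρ0 hs x) fun y => ?_
  refine Real.exp_le_exp.2 ?_
  nlinarith [hρ0 (x, y)]

/-- The function `F(t) = -Λ(-t)`. -/
def FF (ρ : α × β → ℝ) (P : Measure α) (Q : Measure β) (t : ℝ) : ℝ≥0∞ :=
  ∫⁻ x, ENNReal.ofReal (ph ρ Q t x) ∂P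

/-- expected distortion under the tilted measure. -/
def dd (ρ : α × β → ℝ) (Q : Measure β) (t : ℝ) (x : α) : ℝ≥0∞ :=
  ∫⁻ y, ENNReal.ofReal (ρ (x, y) * Real.exp (ph ρ Q t x - t * ρ (x, y))) ∂Q

lemma measurable_dd (hρm : Measurable ρ) (t : ℝ) : Measurable (dd ρ Q t) := by
  have : Measurable (fun z : α × β =>
      ENNReal.ofReal (ρ z * Real.exp (ph ρ Q t z.1 - t * ρ z))) := by
    have h2 : Measurable (fun z : α × β => ph ρ Q t z.1) :=
      (measurable_ph (Q := Q) hρm t).comp measurable_fst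
    fun_prop
  exact this.lintegral_prod_right'

lemma dd_le (hρm : Measurable ρ) (hρ0 : ∀ z, 0 ≤ ρ z) {t : ℝ} (ht : 0 ≤ t) (x : α) :
    ENNReal.ofReal t * dd ρ Q t x ≤ ENNReal.ofReal (ph ρ Q t x) := by
  have key : ENNReal.ofReal t * dd ρ Q t x + 1 ≤ ENNReal.ofReal (ph ρ Q t x) + 1 := by
    have h1 : ENNReal.ofReal t * dd ρ Q t x + 1 =
        ∫⁻ y, (ENNReal.ofReal t * ENNReal.ofReal (ρ (x, y) * Real.exp (ph ρ Q t x - t * ρ (x, y)))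
          + ENNReal.ofReal (Real.exp (ph ρ Q t x - t * ρ (x, y)))) ∂Q := by
      rw [lintegral_add_left (by fun_prop), tilt_one hρm hρ0 ht, lintegral_const_mul _ (by fun_prop)]
      rfl
    have h2 : ENNReal.ofReal (ph ρ Q t x) + 1 =
        ∫⁻ y, (ENNReal.ofReal (ph ρ Q t x) * ENNReal.ofReal (Real.exp (ph ρ Q t x - t * ρ (x, y)))
          + 1) ∂Q := by
      rw [lintegral_add_left (by fun_prop), lintegral_const_mul _ (by fun_prop),
        tilt_one hρm hρ0 ht]
      simp
    rw [h1, h2]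
    refine lintegral_mono fun y => ?_
    have hp := ph_nonneg (Q := Q) hρm hρ0 ht x
    have hr := hρ0 (x, y)
    simp only
    rw [← ENNReal.ofReal_mul ht, ← ENNReal.ofReal_mul hp, ← ENNReal.ofReal_one,
      ← ENNReal.ofReal_add (by positivity) (by positivity),
      ← ENNReal.ofReal_add (by positivity) (by positivity)]
    refine ENNReal.ofReal_le_ofReal ?_
    set w := ph ρ Q t x - t * ρ (x, y) with hw
    have h3 : -w + 1 ≤ Real.exp (-w) := Real.add_one_le_exp _
    have h4 : Real.exp w * Real.exp (-w) = 1 := by rw [← Real.exp_add]; simp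
    have h5 : Real.exp w * (-w + 1) ≤ 1 := by
      exact (mul_le_mul_of_nonneg_left h3 (Real.exp_pos _).le).trans_eq h4
    have : t * (ρ (x, y) * Real.exp w) = (ph ρ Q t x - w) * Real.exp w := by rw [hw]; ring
    rw [this]; nlinarith
  exact (ENNReal.add_le_add_iff_right (by simp)).1 key

/-- An upper bound of the relative entropy for an explicit density. -/
lemma relEnt_le {γ : Type*} [MeasurableSpace γ] {μ : Measure γ} [IsProbabilityMeasure μ]
    {f : γ → ℝ} (hf : Measurable f) (hf0 : ∀ z, 0 ≤ f z)
    (hi : Integrable (fun z => Real.log (f z)) (μ.withDensity fun z => ENNReal.ofReal (f z))) :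
    relEnt (μ.withDensity fun z => ENNReal.ofReal (f z)) μ ≤
      ENNReal.ofReal (∫ z, Real.log (f z) ∂(μ.withDensity fun z => ENNReal.ofReal (f z))) := by
  set W := μ.withDensity fun z => ENNReal.ofReal (f z) with hW
  have hac : W ≪ μ := withDensity_absolutelyContinuous _ _
  have hll : llr W μ =ᵐ[W] fun z => Real.log (f z) := by
    have h := Measure.rnDeriv_withDensity μ (f := fun z => ENNReal.ofReal (f z)) (by fun_prop)
    filter_upwards [hac.ae_le h] with z hz
    simp only [llr]
    rw [hW, hz, ENNReal.toReal_ofReal (hf0 z)]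
  unfold relEnt
  rw [if_pos ⟨hac, hi.congr hll.symm⟩, integral_congr_ae hll]

/-- Marginal of a density measure. -/
lemma map_fst_withDensity {g : α × β → ℝ≥0∞} (hg : Measurable g)
    (h : ∀ᵐ x ∂P, ∫⁻ y, g (x, y) ∂Q = 1) :
    ((P.prod Q).withDensity g).map Prod.fst = P := by
  ext A hA
  rw [Measure.map_apply measurable_fst hA, withDensity_apply _ (measurable_fst hA),
    ← lintegral_indicator (measurable_fst hA),
    lintegral_prod _ (by exact (hg.indicator (measurable_fst hA)).aemeasurable),
    ← lintegral_indicator_one hA]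
  refine lintegral_congr_ae ?_
  filter_upwards [h] with x hx
  by_cases hxA : x ∈ A
  · simp [indicator, hxA, hx]
  · simp [indicator, hxA]

lemma isProb_of_map_fst {W : Measure (α × β)} (h : W.map Prod.fst = P) :
    IsProbabilityMeasure W := by
  constructor
  have : W.map Prod.fst univ = 1 := by rw [h]; simp
  rwa [Measure.map_apply measurable_fst MeasurableSet.univ] at this

lemma mem_distSet {W : Measure (α × β)} {D : ℝ} (hD : 0 ≤ D) (h : W.map Prod.fst = P)
    (h2 : ∫⁻ z, ENNReal.ofReal (ρ z) ∂W ≤ ENNReal.ofReal D) : W ∈ distSet ρ P D := by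
  refine ⟨isProb_of_map_fst h, h, ?_⟩
  have := EReal.coe_ennreal_le_coe_ennreal_iff.2 h2
  rwa [EReal.coe_ennreal_ofReal, max_eq_left hD] at this

lemma Rrate_le {W : Measure (α × β)} {D : ℝ} (h : W ∈ distSet ρ P D) :
    Rrate ρ P Q D ≤ relEnt W (P.prod Q) := iInf₂_le W h

/-- The tilted measure. -/
def tilt (ρ : α × β → ℝ) (P : Measure α) (Q : Measure β) (t : ℝ) : Measure (α × β) :=
  (P.prod Q).withDensity fun z => ENNReal.ofReal (Real.exp (ph ρ Q t z.1 - t * ρ z))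

lemma measurable_phfst (hρm : Measurable ρ) (t : ℝ) :
    Measurable (fun z : α × β => ph ρ Q t z.1) :=
  (measurable_ph hρm t).comp measurable_fst

lemma tilt_map (hρm : Measurable ρ) (hρ0 : ∀ z, 0 ≤ ρ z) {t : ℝ} (ht : 0 ≤ t) :
    (tilt ρ P Q t).map Prod.fst = P := by
  have := measurable_phfst (Q := Q) hρm t
  exact map_fst_withDensity (by fun_prop) (Eventually.of_forall fun x => tilt_one hρm hρ0 ht x)

lemma tilt_dist (hρm : Measurable ρ) (hρ0 : ∀ z, 0 ≤ ρ z) {t : ℝ} :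
    ∫⁻ z, ENNReal.ofReal (ρ z) ∂(tilt ρ P Q t) = ∫⁻ x, dd ρ Q t x ∂P := by
  have := measurable_phfst (Q := Q) hρm t
  unfold tilt
  rw [lintegral_withDensity_eq_lintegral_mul _ (by fun_prop) (by fun_prop),
    lintegral_prod _ (by fun_prop)]
  refine lintegral_congr fun x => lintegral_congr fun y => ?_
  simp only [Pi.mul_apply]
  rw [mul_comm, ← ENNReal.ofReal_mul (hρ0 _)]

lemma tilt_relEnt (hρm : Measurable ρ) (hρ0 : ∀ z, 0 ≤ ρ z) {t : ℝ} (ht : 0 ≤ t)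
    (hF : FF ρ P Q t ≠ ∞) (hd : ∫⁻ x, dd ρ Q t x ∂P ≠ ∞) :
    relEnt (tilt ρ P Q t) (P.prod Q) + ENNReal.ofReal t * ∫⁻ x, dd ρ Q t x ∂P
      ≤ FF ρ P Q t := by
  have hm := measurable_phfst (Q := Q) hρm t
  have hmap := tilt_map (P := P) (Q := Q) hρm hρ0 ht
  haveI := isProb_of_map_fst hmap
  have hFe : ∫⁻ z, ENNReal.ofReal (ph ρ Q t z.1) ∂(tilt ρ P Q t) = FF ρ P Q t := by
    unfold FF
    conv_rhs => rw [← hmap]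
    rw [lintegral_map ((measurable_ph hρm t).ennreal_ofReal) measurable_fst]
  have hpi : Integrable (fun z : α × β => ph ρ Q t z.1) (tilt ρ P Q t) := by
    refine ⟨hm.aestronglyMeasurable, ?_⟩
    rw [hasFiniteIntegral_iff_ofReal (Eventually.of_forall fun z => ph_nonneg hρm hρ0 ht _), hFe]
    exact hF.lt_top
  have hri : Integrable ρ (tilt ρ P Q t) := by
    refine ⟨hρm.aestronglyMeasurable, ?_⟩
    rw [hasFiniteIntegral_iff_ofReal (Eventually.of_forall fun z => hρ0 _), tilt_dist hρm hρ0]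
    exact hd.lt_top
  have hle : relEnt (tilt ρ P Q t) (P.prod Q) ≤
      ENNReal.ofReal (∫ z, (ph ρ Q t z.1 - t * ρ z) ∂(tilt ρ P Q t)) := by
    have := relEnt_le (μ := P.prod Q) (f := fun z => Real.exp (ph ρ Q t z.1 - t * ρ z))
      (by fun_prop) (fun z => (Real.exp_pos _).le)
      (by simp only [Real.log_exp]; exact hpi.sub (hri.const_mul t))
    simp only [Real.log_exp] at this
    exact this
  have hdr : ENNReal.ofReal (t * ∫ z, ρ z ∂(tilt ρ P Q t))
      = ENNReal.ofReal t * ∫⁻ x, dd ρ Q t x ∂P := by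
    rw [ENNReal.ofReal_mul ht, ofReal_integral_eq_lintegral_ofReal hri
      (Eventually.of_forall hρ0), tilt_dist hρm hρ0]
  have hFr : ENNReal.ofReal (∫ z, ph ρ Q t z.1 ∂(tilt ρ P Q t)) = FF ρ P Q t := by
    rw [ofReal_integral_eq_lintegral_ofReal hpi
      (Eventually.of_forall fun z => ph_nonneg hρm hρ0 ht _), hFe]
  rw [integral_sub hpi (hri.const_mul t), integral_const_mul] at hle
  have h0 : 0 ≤ t * ∫ z, ρ z ∂(tilt ρ P Q t) := mul_nonneg ht (integral_nonneg hρ0)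
  have hle2 : t * ∫ z, ρ z ∂(tilt ρ P Q t) ≤ ∫ z, ph ρ Q t z.1 ∂(tilt ρ P Q t) := by
    have : ENNReal.ofReal t * ∫⁻ x, dd ρ Q t x ∂P ≤ FF ρ P Q t := by
      rw [← lintegral_const_mul _ (measurable_dd hρm t)]
      exact lintegral_mono fun x => dd_le hρm hρ0 ht x
    rw [← hdr, ← hFr] at this
    exact (ENNReal.ofReal_le_ofReal_iff
      (integral_nonneg fun z => ph_nonneg hρm hρ0 ht _)).1 this
  calc _ ≤ ENNReal.ofReal (∫ z, ph ρ Q t z.1 ∂(tilt ρ P Q t) - t * ∫ z, ρ z ∂(tilt ρ P Q t))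
        + ENNReal.ofReal (t * ∫ z, ρ z ∂(tilt ρ P Q t)) := by rw [hdr]; gcongr
    _ = FF ρ P Q t := by
      rw [← ENNReal.ofReal_add (by linarith) h0, sub_add_cancel, hFr]

/-- Weak duality. -/
lemma weak_duality (hρm : Measurable ρ) (hρ0 : ∀ z, 0 ≤ ρ z) {t : ℝ} (ht : 0 ≤ t) {D : ℝ}
    (hD : 0 ≤ D) {W : Measure (α × β)} (hW : W ∈ distSet ρ P D) :
    FF ρ P Q t ≤ relEnt W (P.prod Q) + ENNReal.ofReal (t * D) := by
  obtain ⟨hWp, hmap, hdist⟩ := hW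
  have hdist' : ∫⁻ z, ENNReal.ofReal (ρ z) ∂W ≤ ENNReal.ofReal D := by
    refine EReal.coe_ennreal_le_coe_ennreal_iff.1 ?_
    rwa [EReal.coe_ennreal_ofReal, max_eq_left hD]
  unfold relEnt
  split_ifs with h
  swap
  · simp
  obtain ⟨hac, hi⟩ := h
  have hm := measurable_phfst (Q := Q) hρm t
  have hri : Integrable ρ W := by
    refine ⟨hρm.aestronglyMeasurable, ?_⟩
    rw [hasFiniteIntegral_iff_ofReal (Eventually.of_forall fun z => hρ0 _)]
    exact hdist'.trans_lt ENNReal.ofReal_lt_top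
  have hrD : ∫ z, ρ z ∂W ≤ D := by
    rw [integral_eq_lintegral_of_nonneg_ae (Eventually.of_forall hρ0) hρm.aestronglyMeasurable]
    exact ENNReal.toReal_le_of_le_ofReal hD hdist'
  set g := W.rnDeriv (P.prod Q) with hg
  have hgm : Measurable g := Measure.measurable_rnDeriv _ _
  set f : α × β → ℝ := fun z => ph ρ Q t z.1 - t * ρ z with hf
  have hfm : Measurable f := by fun_prop
  -- the ratio
  have hprod1 : ∫⁻ z, ENNReal.ofReal (Real.exp (f z)) ∂(P.prod Q) = 1 := by
    rw [lintegral_prod _ (by fun_prop)]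
    have : ∀ x, ∫⁻ y, ENNReal.ofReal (Real.exp (f (x, y))) ∂Q = 1 := fun x => tilt_one hρm hρ0 ht x
    simp [this]
  have hratio : ∫⁻ z, ENNReal.ofReal (Real.exp (f z) / (g z).toReal) ∂W ≤ 1 := by
    rw [← hprod1]
    conv_lhs => rw [← Measure.withDensity_rnDeriv_eq _ _ hac]
    rw [lintegral_withDensity_eq_lintegral_mul _ hgm (by fun_prop)]
    refine lintegral_mono_ae ?_
    filter_upwards [Measure.rnDeriv_lt_top W (P.prod Q)] with z hz
    simp only [Pi.mul_apply]
    rw [← hg] at hz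
    rcases eq_or_ne (g z) 0 with h0 | h0
    · simp [h0]
    · have hp : 0 < (g z).toReal := ENNReal.toReal_pos h0 hz.ne
      conv_lhs => rw [← ENNReal.ofReal_toReal hz.ne]
      rw [ENNReal.toReal_ofReal hp.le, ← ENNReal.ofReal_mul hp.le, mul_div_cancel₀ _ hp.ne']
  have hratI : Integrable (fun z => Real.exp (f z) / (g z).toReal) W := by
    refine ⟨by exact (by fun_prop : Measurable fun z => Real.exp (f z) / (g z).toReal).aestronglyMeasurable, ?_⟩
    rw [hasFiniteIntegral_iff_ofReal (Eventually.of_forall fun z => by positivity)]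
    exact hratio.trans_lt ENNReal.one_lt_top
  have hratle : ∫ z, Real.exp (f z) / (g z).toReal ∂W ≤ 1 := by
    rw [integral_eq_lintegral_of_nonneg_ae (Eventually.of_forall fun z => by positivity)
      hratI.1]
    exact ENNReal.toReal_le_of_le_ofReal zero_le_one (by simpa using hratio)
  have hpt : ∀ᵐ z ∂W, ph ρ Q t z.1 ≤
      llr W (P.prod Q) z + t * ρ z + Real.exp (f z) / (g z).toReal - 1 := by
    filter_upwards [Measure.rnDeriv_pos hac, hac.ae_le (Measure.rnDeriv_lt_top W (P.prod Q))]
      with z h1 h2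
    have hp : 0 < (g z).toReal := ENNReal.toReal_pos h1.ne' h2.ne
    have hx := Real.add_one_le_exp (f z - Real.log (g z).toReal)
    rw [Real.exp_sub, Real.exp_log hp] at hx
    have : llr W (P.prod Q) z = Real.log (g z).toReal := rfl
    rw [this]
    simp only [hf] at hx ⊢
    linarith
  have hbI : Integrable (fun z => llr W (P.prod Q) z + t * ρ z
      + Real.exp (f z) / (g z).toReal - 1) W :=
    ((hi.add (hri.const_mul t)).add hratI).sub (integrable_const _)
  have hint : ∫ z, (llr W (P.prod Q) z + t * ρ z + Real.exp (f z) / (g z).toReal - 1) ∂W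
      ≤ ∫ z, llr W (P.prod Q) z ∂W + t * D := by
    have i1 : Integrable (fun z => llr W (P.prod Q) z + t * ρ z) W := hi.add (hri.const_mul t)
    have i2 : Integrable (fun z => llr W (P.prod Q) z + t * ρ z
      + Real.exp (f z) / (g z).toReal) W := i1.add hratI
    rw [integral_sub i2 (integrable_const _),
      integral_add i1 hratI, integral_add hi (hri.const_mul t),
      integral_const_mul]
    have := mul_le_mul_of_nonneg_left hrD ht
    simp only [integral_const, probReal_univ, smul_eq_mul, mul_one]
    linarith
  have hFe : FF ρ P Q t = ∫⁻ z, ENNReal.ofReal (ph ρ Q t z.1) ∂W := by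
    unfold FF
    conv_lhs => rw [← hmap]
    rw [lintegral_map ((measurable_ph hρm t).ennreal_ofReal) measurable_fst]
  rw [hFe]
  calc ∫⁻ z, ENNReal.ofReal (ph ρ Q t z.1) ∂W
      ≤ ∫⁻ z, ENNReal.ofReal (llr W (P.prod Q) z + t * ρ z
      + Real.exp (f z) / (g z).toReal - 1) ∂W := by
        refine lintegral_mono_ae ?_
        filter_upwards [hpt] with z hz using ENNReal.ofReal_le_ofReal hz
    _ = ENNReal.ofReal (∫ z, (llr W (P.prod Q) z + t * ρ z
      + Real.exp (f z) / (g z).toReal - 1) ∂W) := by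
        rw [ofReal_integral_eq_lintegral_ofReal hbI]
        filter_upwards [hpt] with z hz
        exact (ph_nonneg hρm hρ0 ht _).trans hz
    _ ≤ ENNReal.ofReal (∫ z, llr W (P.prod Q) z ∂W + t * D) := ENNReal.ofReal_le_ofReal hint
    _ ≤ _ := ENNReal.ofReal_add_le

lemma continuousAt_ZZ (hρm : Measurable ρ) (hρ0 : ∀ z, 0 ≤ ρ z) {t : ℝ} (ht : 0 < t) (x : α) :
    ContinuousAt (fun s => ZZ ρ Q s x) t := by
  refine continuousAt_of_dominated (bound := fun _ => 1) ?_ ?_ (integrable_const _) ?_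
  · exact Eventually.of_forall fun s =>
      (by fun_prop : Measurable fun y => Real.exp (-s * ρ (x, y))).aestronglyMeasurable
  · filter_upwards [lt_mem_nhds ht] with s hs
    refine Eventually.of_forall fun y => ?_
    rw [Real.norm_eq_abs, abs_of_pos (Real.exp_pos _)]
    exact exp_le_one_aux hρ0 hs.le _
  · exact Eventually.of_forall fun y => by fun_prop

lemma continuousAt_ph (hρm : Measurable ρ) (hρ0 : ∀ z, 0 ≤ ρ z) {t : ℝ} (ht : 0 < t) (x : α) :
    ContinuousAt (fun s => ph ρ Q s x) t :=
  ((continuousAt_ZZ hρm hρ0 ht x).log (ZZ_pos hρm hρ0 ht.le x).ne').neg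

lemma dd_le' (hρm : Measurable ρ) (hρ0 : ∀ z, 0 ≤ ρ z) {t : ℝ} (ht : 0 < t) (x : α) :
    dd ρ Q t x ≤ ENNReal.ofReal (ph ρ Q t x / t) := by
  rw [ENNReal.ofReal_div_of_pos ht, ENNReal.le_div_iff_mul_le (by simp [ht]) (by simp), mul_comm]
  exact dd_le hρm hρ0 ht.le x

lemma dd_eq (hρm : Measurable ρ) (hρ0 : ∀ z, 0 ≤ ρ z) (t : ℝ) (x : α) :
    dd ρ Q t x = ENNReal.ofReal (Real.exp (ph ρ Q t x)) *
      ∫⁻ y, ENNReal.ofReal (ρ (x, y) * Real.exp (-t * ρ (x, y))) ∂Q := by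
  unfold dd
  rw [← lintegral_const_mul _ (by fun_prop)]
  refine lintegral_congr fun y => ?_
  rw [← ENNReal.ofReal_mul (Real.exp_pos _).le, sub_eq_add_neg, Real.exp_add, neg_mul]
  congr 1; ring

lemma continuousAt_dd (hρm : Measurable ρ) (hρ0 : ∀ z, 0 ≤ ρ z) {t : ℝ} (ht : 0 < t) (x : α) :
    ContinuousAt (fun s => dd ρ Q s x) t := by
  simp_rw [dd_eq hρm hρ0]
  have h1 : Tendsto (fun s => ∫⁻ y, ENNReal.ofReal (ρ (x, y) * Real.exp (-s * ρ (x, y))) ∂Q)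
      (𝓝 t) (𝓝 (∫⁻ y, ENNReal.ofReal (ρ (x, y) * Real.exp (-t * ρ (x, y))) ∂Q)) := by
    refine tendsto_lintegral_filter_of_dominated_convergence
      (fun _ => ENNReal.ofReal (2 / t)) ?_ ?_ ?_ ?_
    · exact Eventually.of_forall fun s => by fun_prop
    · filter_upwards [lt_mem_nhds (half_lt_self ht)] with s hs
      refine Eventually.of_forall fun y => ENNReal.ofReal_le_ofReal ?_
      have hs0 : 0 < s := lt_trans (by positivity) hs
      have hr := hρ0 (x, y)
      have h1 : s * ρ (x, y) ≤ Real.exp (s * ρ (x, y)) := by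
        linarith [Real.add_one_le_exp (s * ρ (x, y))]
      rw [neg_mul, Real.exp_neg, ← div_eq_mul_inv, div_le_div_iff₀ (Real.exp_pos _) ht]
      nlinarith [mul_nonneg hr (sub_nonneg.2 hs.le)]
    · simp
    · refine Eventually.of_forall fun y => ?_
      have : Continuous fun s => ENNReal.ofReal (ρ (x, y) * Real.exp (-s * ρ (x, y))) :=
        ENNReal.continuous_ofReal.comp (by fun_prop)
      exact this.tendsto t
  have h2 : Tendsto (fun s => ENNReal.ofReal (Real.exp (ph ρ Q s x))) (𝓝 t)
      (𝓝 (ENNReal.ofReal (Real.exp (ph ρ Q t x)))) :=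
    (ENNReal.continuous_ofReal.tendsto _).comp
      ((Real.continuous_exp.tendsto _).comp (continuousAt_ph hρm hρ0 ht x))
  refine ENNReal.Tendsto.mul h2 (Or.inl (by simp [Real.exp_pos])) h1 (Or.inr ENNReal.ofReal_ne_top)

lemma continuousAt_lint_dd (hρm : Measurable ρ) (hρ0 : ∀ z, 0 ≤ ρ z) {t : ℝ} (ht : 0 < t)
    (hF : FF ρ P Q (2 * t) ≠ ∞) :
    ContinuousAt (fun s => ∫⁻ x, dd ρ Q s x ∂P) t := by
  refine tendsto_lintegral_filter_of_dominated_convergence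
    (fun x => ENNReal.ofReal (2 / t) * ENNReal.ofReal (ph ρ Q (2 * t) x)) ?_ ?_ ?_ ?_
  · exact Eventually.of_forall fun s => measurable_dd hρm s
  · filter_upwards [lt_mem_nhds (half_lt_self ht),
      gt_mem_nhds (show t < 2 * t by linarith)] with s hs hs2
    have hs0 : 0 < s := lt_trans (by positivity) hs
    refine Eventually.of_forall fun x => (dd_le' hρm hρ0 hs0 x).trans ?_
    rw [← ENNReal.ofReal_mul (by positivity)]
    refine ENNReal.ofReal_le_ofReal ?_
    have h1 := ph_mono (Q := Q) hρm hρ0 hs0.le hs2.le x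
    have h2 := ph_nonneg (Q := Q) hρm hρ0 hs0.le x
    have h3 : 1 / s ≤ 2 / t := by
      rw [div_le_div_iff₀ hs0 ht]; linarith
    calc ph ρ Q s x / s = (1 / s) * ph ρ Q s x := by ring
      _ ≤ (2 / t) * ph ρ Q (2 * t) x := by gcongr
  · rw [lintegral_const_mul _ (measurable_ph hρm _).ennreal_ofReal]
    exact ENNReal.mul_ne_top ENNReal.ofReal_ne_top hF
  · exact Eventually.of_forall fun x => continuousAt_dd hρm hρ0 ht x

lemma relEnt_self {γ : Type*} [MeasurableSpace γ] (μ : Measure γ) [IsProbabilityMeasure μ] :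
    relEnt μ μ = 0 := by
  unfold relEnt
  have h := llr_self μ
  rw [if_pos ⟨Measure.AbsolutelyContinuous.rfl, (integrable_zero _ _ _).congr h.symm⟩,
    integral_congr_ae h]
  simp

lemma ph_two_mul (hρm : Measurable ρ) (hρ0 : ∀ z, 0 ≤ ρ z) {t : ℝ} (ht : 0 ≤ t) (x : α) :
    ph ρ Q (2 * t) x ≤ 2 * ph ρ Q t x := by
  have hp := ZZ_pos (Q := Q) hρm hρ0 ht x
  have hsq : ZZ ρ Q t x ^ 2 ≤ ZZ ρ Q (2 * t) x := by
    set c := ZZ ρ Q t x with hc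
    have hi := integrable_exp_aux (Q := Q) hρm hρ0 ht x
    have h1 : ∫ y, (2 * c * Real.exp (-t * ρ (x, y)) - c ^ 2) ∂Q ≤ ZZ ρ Q (2 * t) x := by
      refine integral_mono ((hi.const_mul _).sub (integrable_const _))
        (integrable_exp_aux hρm hρ0 (by positivity) x) fun y => ?_
      have : Real.exp (-(2 * t) * ρ (x, y)) = Real.exp (-t * ρ (x, y)) ^ 2 := by
        rw [← Real.exp_nat_mul]; congr 1; push_cast; ring
      simp only [this]
      nlinarith [sq_nonneg (Real.exp (-t * ρ (x, y)) - c)]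
    rw [integral_sub (hi.const_mul _) (integrable_const _), integral_const_mul] at h1
    have h2 : ∫ y, Real.exp (-t * ρ (x, y)) ∂Q = c := rfl
    rw [h2] at h1
    simp at h1
    nlinarith
  have := Real.log_le_log (by positivity) hsq
  rw [Real.log_pow] at this
  unfold ph
  push_cast at this
  linarith

lemma tendsto_negLog {q : ℝ≥0∞} (hq : q ≠ ∞) : Tendsto negLog (𝓝 q) (𝓝 (negLog q)) := by
  rcases eq_or_ne q 0 with rfl | h0
  · have : negLog 0 = ∞ := by simp [negLog]
    rw [this]
    refine ENNReal.tendsto_nhds_top_iff_nnreal.2 fun M => ?_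
    have hpos : (0 : ℝ≥0∞) < ENNReal.ofReal (Real.exp (-(M + 1))) := by simp [Real.exp_pos]
    filter_upwards [gt_mem_nhds hpos] with s hs
    unfold negLog
    split_ifs with hs0
    · simp
    · have hst : s ≠ ∞ := hs.ne_top
      have hsp : 0 < s.toReal := ENNReal.toReal_pos hs0 hst
      have h1 : s.toReal ≤ Real.exp (-(M + 1)) :=
        ENNReal.toReal_le_of_le_ofReal (Real.exp_pos _).le hs.le
      have h2 := Real.log_le_log hsp h1
      rw [Real.log_exp] at h2
      rw [← ENNReal.ofReal_coe_nnreal]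
      refine (ENNReal.ofReal_lt_ofReal_iff_of_nonneg M.coe_nonneg).2 ?_
      linarith
  · have hqp : 0 < q.toReal := ENNReal.toReal_pos h0 hq
    have h1 : Tendsto (fun s : ℝ≥0∞ => ENNReal.ofReal (-Real.log s.toReal)) (𝓝 q)
        (𝓝 (ENNReal.ofReal (-Real.log q.toReal))) :=
      (ENNReal.continuous_ofReal.tendsto _).comp
        (((ENNReal.tendsto_toReal hq).log hqp.ne').neg)
    have h2 : negLog q = ENNReal.ofReal (-Real.log q.toReal) := by simp [negLog, h0]
    rw [h2]
    refine h1.congr' ?_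
    filter_upwards [isOpen_ne.mem_nhds h0] with s hs
    simp only [negLog]
    rw [if_neg hs]

lemma strong_boundary (hρm : Measurable ρ) (hρ0 : ∀ z, 0 ≤ ρ z) {D : ℝ} (hD : 0 ≤ D) {K : ℝ≥0∞}
    (hK : K ≠ ∞) (h : ∀ t, 0 ≤ t → FF ρ P Q t ≤ K + ENNReal.ofReal (t * D))
    (hd : ∀ t, 0 < t → ENNReal.ofReal D < ∫⁻ x, dd ρ Q t x ∂P) :
    Rrate ρ P Q D ≤ K := by
  have hFfin : ∀ t, 0 ≤ t → FF ρ P Q t ≠ ∞ := fun t ht =>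
    ((h t ht).trans_lt (ENNReal.add_lt_top.2 ⟨hK.lt_top, ENNReal.ofReal_lt_top⟩)).ne
  have h2k : ∀ k : ℕ, (0 : ℝ) < 2 ^ k := fun k => by positivity
  set u : ℕ → α → ℝ := fun k x => ph ρ Q (2 ^ k) x / 2 ^ k with hu
  have hu0 : ∀ k x, 0 ≤ u k x := fun k x => div_nonneg (ph_nonneg hρm hρ0 (h2k k).le x) (h2k k).le
  have hum : ∀ k, Measurable (u k) := fun k => (measurable_ph hρm _).div_const _
  have hanti : ∀ x, Antitone fun k => u k x := by
    intro x
    refine antitone_nat_of_succ_le fun k => ?_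
    simp only [hu]
    rw [div_le_div_iff₀ (h2k _) (h2k _)]
    have := ph_two_mul (Q := Q) hρm hρ0 (h2k k).le x
    rw [pow_succ, mul_comm (2 ^ k : ℝ) 2]
    nlinarith [h2k k]
  set m : α → ℝ := fun x => ⨅ k, u k x with hm
  have hbdd : ∀ x, BddBelow (range fun k => u k x) := fun x =>
    ⟨0, by rintro _ ⟨k, rfl⟩; exact hu0 k x⟩
  have hut : ∀ x, Tendsto (fun k => u k x) atTop (𝓝 (m x)) := fun x =>
    tendsto_atTop_ciInf (hanti x) (hbdd x)
  have hmm : Measurable m := measurable_of_tendsto_metrizable hum (tendsto_pi_nhds.2 hut)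
  have hm0 : ∀ x, 0 ≤ m x := fun x => le_ciInf fun k => hu0 k x
  have hmu : ∀ k x, m x ≤ u k x := fun k x => ciInf_le (hbdd x) k
  have hmph : ∀ k x, 2 ^ k * m x ≤ ph ρ Q (2 ^ k) x := fun k x => by
    have := hmu k x
    simp only [hu] at this
    rwa [le_div_iff₀ (h2k k), mul_comm] at this
  set a := ∫⁻ x, ENNReal.ofReal (m x) ∂P with ha
  have hFu : ∀ k : ℕ, ∫⁻ x, ENNReal.ofReal (u k x) ∂P = FF ρ P Q (2 ^ k) / ENNReal.ofReal (2 ^ k) := by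
    intro k
    unfold FF
    rw [div_eq_mul_inv, ← lintegral_mul_const _ (measurable_ph hρm _).ennreal_ofReal]
    refine lintegral_congr fun x => ?_
    simp only [hu]
    rw [ENNReal.ofReal_div_of_pos (h2k k), div_eq_mul_inv]
  have hsplit : ∀ k : ℕ, ∫⁻ x, ENNReal.ofReal (ph ρ Q (2 ^ k) x - 2 ^ k * m x) ∂P
      + ENNReal.ofReal (2 ^ k) * a = FF ρ P Q (2 ^ k) := by
    intro k
    rw [ha, ← lintegral_const_mul _ hmm.ennreal_ofReal, ← lintegral_add_right _ (by fun_prop)]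
    refine lintegral_congr fun x => ?_
    rw [← ENNReal.ofReal_mul (h2k k).le,
      ← ENNReal.ofReal_add (sub_nonneg.2 (hmph k x)) (mul_nonneg (h2k k).le (hm0 x)),
      sub_add_cancel]
  -- `a ≤ D`
  have haD : a ≤ ENNReal.ofReal D := by
    have h1 : ∀ k : ℕ, a ≤ K / ENNReal.ofReal (2 ^ k) + ENNReal.ofReal D := by
      intro k
      have hp : ENNReal.ofReal (2 ^ k) ≠ 0 := by simp
      have h2 : ENNReal.ofReal (2 ^ k) * a ≤ K + ENNReal.ofReal (2 ^ k) * ENNReal.ofReal D := by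
        rw [← ENNReal.ofReal_mul (h2k k).le]
        refine le_trans ?_ (h (2 ^ k) (h2k k).le)
        rw [← hsplit k]; exact le_add_self
      have h3 : a ≤ (K + ENNReal.ofReal (2 ^ k) * ENNReal.ofReal D) / ENNReal.ofReal (2 ^ k) := by
        rw [ENNReal.le_div_iff_mul_le (Or.inl hp) (Or.inl ENNReal.ofReal_ne_top), mul_comm]
        exact h2
      rwa [ENNReal.add_div, mul_comm, ENNReal.mul_div_cancel_right hp ENNReal.ofReal_ne_top] at h3
    have h4 : Tendsto (fun k : ℕ => K / ENNReal.ofReal (2 ^ k) + ENNReal.ofReal D) atTop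
        (𝓝 (0 + ENNReal.ofReal D)) := by
      refine Tendsto.add ?_ tendsto_const_nhds
      have : Tendsto (fun k : ℕ => ENNReal.ofReal (2 ^ k)) atTop (𝓝 ∞) :=
        ENNReal.tendsto_ofReal_atTop.comp (tendsto_pow_atTop_atTop_of_one_lt one_lt_two)
      have h5 := ENNReal.Tendsto.const_div (a := K) this (Or.inr hK)
      simpa using h5
    rw [zero_add] at h4
    exact ge_of_tendsto' h4 h1
  have hDa : ENNReal.ofReal D ≤ a := by
    have ht : Tendsto (fun k => ∫⁻ x, ENNReal.ofReal (u k x) ∂P) atTop (𝓝 a) := by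
      refine tendsto_lintegral_of_dominated_convergence (fun x => ENNReal.ofReal (u 0 x))
        (fun k => (hum k).ennreal_ofReal) (fun k => Eventually.of_forall fun x =>
          ENNReal.ofReal_le_ofReal (hanti x (Nat.zero_le k))) ?_
        (Eventually.of_forall fun x => (ENNReal.continuous_ofReal.tendsto _).comp (hut x))
      rw [hFu 0]
      simpa using hFfin 1 zero_le_one
    refine ge_of_tendsto' ht fun k => (hd (2 ^ k) (h2k k)).le.trans ?_
    exact lintegral_mono fun x => dd_le' hρm hρ0 (h2k k) x
  have hpsi : ∀ k : ℕ, ∫⁻ x, ENNReal.ofReal (ph ρ Q (2 ^ k) x - 2 ^ k * m x) ∂P ≤ K := by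
    intro k
    have h1 := h (2 ^ k) (h2k k).le
    rw [← hsplit k, ENNReal.ofReal_mul (h2k k).le] at h1
    have h2 : ENNReal.ofReal (2 ^ k) * a ≠ ∞ :=
      ENNReal.mul_ne_top ENNReal.ofReal_ne_top (haD.trans_lt ENNReal.ofReal_lt_top).ne
    have h3 : ENNReal.ofReal (2 ^ k) * ENNReal.ofReal D ≤ ENNReal.ofReal (2 ^ k) * a := by gcongr
    exact (ENNReal.add_le_add_iff_right h2).1 (h1.trans (by gcongr))
  -- pointwise limits
  have hJ : ∀ (k : ℕ) x, ∫⁻ y, ENNReal.ofReal (Real.exp (2 ^ k * (m x - ρ (x, y)))) ∂Q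
      = ENNReal.ofReal (Real.exp (-(ph ρ Q (2 ^ k) x - 2 ^ k * m x))) := by
    intro k x
    have h1 : ∀ y, ENNReal.ofReal (Real.exp (2 ^ k * (m x - ρ (x, y)))) =
        ENNReal.ofReal (Real.exp (2 ^ k * m x)) *
          ENNReal.ofReal (Real.exp (-(2 ^ k) * ρ (x, y))) := by
      intro y
      rw [← ENNReal.ofReal_mul (Real.exp_pos _).le, ← Real.exp_add]
      congr 2; ring
    simp_rw [h1]
    rw [lintegral_const_mul _ (by fun_prop), lint_exp hρm hρ0 (h2k k).le,
      ← exp_neg_ph hρm hρ0 (h2k k).le, ← ENNReal.ofReal_mul (Real.exp_pos _).le, ← Real.exp_add]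
    congr 2; ring
  have hJ1 : ∀ (k : ℕ) x, ∫⁻ y, ENNReal.ofReal (Real.exp (2 ^ k * (m x - ρ (x, y)))) ∂Q ≤ 1 := by
    intro k x
    rw [hJ, ← ENNReal.ofReal_one]
    refine ENNReal.ofReal_le_ofReal ?_
    rw [Real.exp_le_one_iff]
    linarith [hmph k x]
  have h2top : Tendsto (fun k : ℕ => (2 : ℝ) ^ k) atTop atTop :=
    tendsto_pow_atTop_atTop_of_one_lt one_lt_two
  have hge : ∀ x, ∀ᵐ y ∂Q, m x ≤ ρ (x, y) := by
    intro x
    have hfat : ∫⁻ y, liminf (fun k : ℕ => ENNReal.ofReal (Real.exp (2 ^ k * (m x - ρ (x, y)))))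
        atTop ∂Q ≤ 1 := by
      refine (lintegral_liminf_le fun k => by fun_prop).trans ?_
      refine liminf_le_of_le (by isBoundedDefault) fun b hb => ?_
      obtain ⟨k, hk⟩ := hb.exists
      exact hk.trans (hJ1 k x)
    have hlt := ae_lt_top (Measurable.liminf fun k => by fun_prop)
      (hfat.trans_lt ENNReal.one_lt_top).ne
    filter_upwards [hlt] with y hy
    by_contra hcon
    push Not at hcon
    have : Tendsto (fun k : ℕ => ENNReal.ofReal (Real.exp (2 ^ k * (m x - ρ (x, y))))) atTop
        (𝓝 ∞) :=
      ENNReal.tendsto_ofReal_atTop.comp (Real.tendsto_exp_atTop.comp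
        (h2top.atTop_mul_const (sub_pos.2 hcon)))
    rw [this.liminf_eq] at hy
    exact lt_irrefl _ hy
  have hset : MeasurableSet {z : α × β | ρ z ≤ m z.1} :=
    measurableSet_le hρm (hmm.comp measurable_fst)
  set q : α → ℝ≥0∞ := fun x => Q {y | ρ (x, y) ≤ m x} with hq
  have hqm : Measurable q := measurable_measure_prodMk_left hset
  have hsetx : ∀ x, MeasurableSet {y | ρ (x, y) ≤ m x} := fun x =>
    measurableSet_le (by fun_prop) measurable_const
  have hJt : ∀ x, Tendsto (fun k : ℕ => ENNReal.ofReal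
      (Real.exp (-(ph ρ Q (2 ^ k) x - 2 ^ k * m x)))) atTop (𝓝 (q x)) := by
    intro x
    simp_rw [← hJ]
    have hq' : q x = ∫⁻ y, {y | ρ (x, y) ≤ m x}.indicator 1 y ∂Q :=
      (lintegral_indicator_one (hsetx x)).symm
    rw [hq']
    refine tendsto_lintegral_of_dominated_convergence (fun _ => 1) (fun k => by fun_prop) ?_
      (by simp) ?_
    · intro k
      filter_upwards [hge x] with y hy
      rw [← ENNReal.ofReal_one]
      refine ENNReal.ofReal_le_ofReal ?_
      rw [Real.exp_le_one_iff]
      exact mul_nonpos_of_nonneg_of_nonpos (h2k k).le (by linarith)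
    · filter_upwards [hge x] with y hy
      rcases hy.eq_or_lt with he | hl
      · have : y ∈ {y | ρ (x, y) ≤ m x} := he.ge
        rw [indicator_of_mem this]
        simp [he]
      · have : y ∉ {y | ρ (x, y) ≤ m x} := by simpa using hl
        rw [indicator_of_notMem this]
        rw [← ENNReal.ofReal_zero]
        refine (ENNReal.continuous_ofReal.tendsto _).comp (Real.tendsto_exp_atBot.comp ?_)
        exact h2top.atTop_mul_const_of_neg (by linarith)
  have hqtop : ∀ x, q x ≠ ∞ := fun x => measure_ne_top _ _
  have hnl : ∀ x, Tendsto (fun k : ℕ => ENNReal.ofReal (ph ρ Q (2 ^ k) x - 2 ^ k * m x)) atTop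
      (𝓝 (negLog (q x))) := by
    intro x
    refine ((tendsto_negLog (hqtop x)).comp (hJt x)).congr fun k => ?_
    simp only [Function.comp, negLog]
    rw [if_neg (by simp [Real.exp_pos]), ENNReal.toReal_ofReal (Real.exp_pos _).le, Real.log_exp,
      neg_neg]
  have hnlK : ∫⁻ x, negLog (q x) ∂P ≤ K := by
    have : ∀ x, negLog (q x) = liminf (fun k : ℕ =>
      ENNReal.ofReal (ph ρ Q (2 ^ k) x - 2 ^ k * m x)) atTop := fun x => (hnl x).liminf_eq.symm
    simp_rw [this]
    refine (lintegral_liminf_le fun k => ?_).trans ?_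
    · have := measurable_ph (Q := Q) hρm (2 ^ k)
      fun_prop
    · refine liminf_le_of_le (by isBoundedDefault) fun b hb => ?_
      obtain ⟨k, hk⟩ := hb.exists
      exact hk.trans (hpsi k)
  have hnlm : Measurable fun x => negLog (q x) :=
    measurable_of_tendsto_metrizable
      (f := fun (k : ℕ) x => ENNReal.ofReal (ph ρ Q (2 ^ k) x - 2 ^ k * m x))
      (fun k => by
        have := measurable_ph (Q := Q) hρm (2 ^ k)
        fun_prop) (tendsto_pi_nhds.2 hnl)
  have hqpos : ∀ᵐ x ∂P, q x ≠ 0 := by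
    filter_upwards [ae_lt_top hnlm (hnlK.trans_lt hK.lt_top).ne] with x hx h0
    simp [negLog, h0] at hx
  -- the limiting measure
  set f : α × β → ℝ := fun z => {z : α × β | ρ z ≤ m z.1}.indicator (fun z => (q z.1).toReal⁻¹) z
    with hf
  have hqm' : Measurable fun z : α × β => (q z.1).toReal⁻¹ :=
    (hqm.comp measurable_fst).ennreal_toReal.inv
  have hfm : Measurable f := hqm'.indicator hset
  have hf0 : ∀ z, 0 ≤ f z := fun z => indicator_nonneg (fun z _ => by positivity) z
  set W := (P.prod Q).withDensity fun z => ENNReal.ofReal (f z) with hW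
  have hWmap : W.map Prod.fst = P := by
    refine map_fst_withDensity (by fun_prop) ?_
    filter_upwards [hqpos] with x hx
    have : ∀ y, ENNReal.ofReal (f (x, y)) =
        {y | ρ (x, y) ≤ m x}.indicator (fun _ => (q x)⁻¹) y := by
      intro y
      by_cases hy : ρ (x, y) ≤ m x
      · simp only [hf, indicator, mem_ofPred_eq, hy, if_true]
        rw [ENNReal.ofReal_inv_of_pos (ENNReal.toReal_pos hx (hqtop x)),
          ENNReal.ofReal_toReal (hqtop x)]
      · simp [hf, indicator, hy]
    simp_rw [this]
    rw [lintegral_indicator_const (hsetx x)]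
    exact ENNReal.inv_mul_cancel hx (hqtop x)
  have hWp := isProb_of_map_fst hWmap
  have hWae : ∀ᵐ z ∂W, ρ z ≤ m z.1 := by
    rw [hW, ae_withDensity_iff (by fun_prop)]
    refine Eventually.of_forall fun z hz => ?_
    by_contra hc
    exact hz (by simp [hf, indicator, hc])
  have hWq : ∀ᵐ z ∂W, q z.1 ≠ 0 := by
    rw [← hWmap] at hqpos
    exact ae_of_ae_map measurable_fst.aemeasurable hqpos
  have hmem : W ∈ distSet ρ P D := by
    refine mem_distSet hD hWmap (le_trans ?_ haD)
    calc ∫⁻ z, ENNReal.ofReal (ρ z) ∂W ≤ ∫⁻ z, ENNReal.ofReal (m z.1) ∂W := by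
          refine lintegral_mono_ae ?_
          filter_upwards [hWae] with z hz using ENNReal.ofReal_le_ofReal hz
      _ = a := by
          rw [ha]
          conv_rhs => rw [← hWmap]
          rw [lintegral_map hmm.ennreal_ofReal measurable_fst]
  refine (Rrate_le hmem).trans ?_
  have hlog : ∀ᵐ z ∂W, 0 ≤ Real.log (f z) ∧ ENNReal.ofReal (Real.log (f z)) = negLog (q z.1) := by
    filter_upwards [hWae, hWq] with z hz hz2
    have : f z = (q z.1).toReal⁻¹ := by simp [hf, indicator, hz]
    rw [this, Real.log_inv]
    refine ⟨?_, by simp [negLog, hz2]⟩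
    have := Real.log_nonpos (ENNReal.toReal_nonneg (a := q z.1))
      (ENNReal.toReal_le_of_le_ofReal zero_le_one (by simpa using prob_le_one))
    linarith
  have hint : ∫⁻ z, ENNReal.ofReal (Real.log (f z)) ∂W ≤ K := by
    refine le_trans (le_of_eq ?_) hnlK
    conv_rhs => rw [← hWmap]
    rw [lintegral_map hnlm measurable_fst]
    refine lintegral_congr_ae ?_
    filter_upwards [hlog] with z hz using hz.2
  have hI : Integrable (fun z => Real.log (f z)) W := by
    refine ⟨(Real.measurable_log.comp hfm).aestronglyMeasurable, ?_⟩
    rw [hasFiniteIntegral_iff_ofReal (hlog.mono fun z hz => hz.1)]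
    exact hint.trans_lt hK.lt_top
  refine (relEnt_le hfm hf0 hI).trans ?_
  rw [ofReal_integral_eq_lintegral_ofReal hI (hlog.mono fun z hz => hz.1)]
  exact hint

lemma strong_duality (hρm : Measurable ρ) (hρ0 : ∀ z, 0 ≤ ρ z) {D : ℝ} (hD : 0 ≤ D) {K : ℝ≥0∞}
    (h : ∀ t, 0 ≤ t → FF ρ P Q t ≤ K + ENNReal.ofReal (t * D)) :
    Rrate ρ P Q D ≤ K := by
  rcases eq_or_ne K ∞ with rfl | hK
  · exact le_top
  have hFfin : ∀ t, 0 ≤ t → FF ρ P Q t ≠ ∞ := fun t ht =>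
    ((h t ht).trans_lt (ENNReal.add_lt_top.2 ⟨hK.lt_top, ENNReal.ofReal_lt_top⟩)).ne
  by_cases hb : ∀ t, 0 < t → ENNReal.ofReal D < ∫⁻ x, dd ρ Q t x ∂P
  · exact strong_boundary hρm hρ0 hD hK h hb
  push Not at hb
  obtain ⟨t1, ht1, hd1⟩ := hb
  by_cases hs : ∀ t, 0 < t → ∫⁻ x, dd ρ Q t x ∂P ≤ ENNReal.ofReal D
  · -- product measure
    have hmem : P.prod Q ∈ distSet ρ P D := by
      refine mem_distSet hD (by simp) ?_
      have hlim : ∀ z, Tendsto (fun n : ℕ => ENNReal.ofReal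
          (ρ z * Real.exp (-(1 / ((n : ℝ) + 1)) * ρ z))) atTop (𝓝 (ENNReal.ofReal (ρ z))) := by
        intro z
        refine (ENNReal.continuous_ofReal.tendsto _).comp ?_
        have h1 : Tendsto (fun s : ℝ => ρ z * Real.exp (-s * ρ z)) (𝓝 0)
            (𝓝 (ρ z * Real.exp (-0 * ρ z))) :=
          (by fun_prop : Continuous fun s : ℝ => ρ z * Real.exp (-s * ρ z)).tendsto 0
        have h2 := h1.comp (tendsto_one_div_add_atTop_nhds_zero_nat (𝕜 := ℝ))
        simpa [Function.comp_def] using h2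
      have h3 : ∀ z, ENNReal.ofReal (ρ z) = liminf (fun n : ℕ => ENNReal.ofReal
          (ρ z * Real.exp (-(1 / ((n : ℝ) + 1)) * ρ z))) atTop := fun z => (hlim z).liminf_eq.symm
      simp_rw [h3]
      refine (lintegral_liminf_le fun k => by fun_prop).trans ?_
      refine liminf_le_of_le (by isBoundedDefault) fun b hb => ?_
      obtain ⟨k, hk⟩ := hb.exists
      refine hk.trans ?_
      have hkp : (0 : ℝ) < 1 / ((k : ℝ) + 1) := by positivity
      refine le_trans ?_ (hs (1 / ((k : ℝ) + 1)) hkp)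
      rw [lintegral_prod _ (by fun_prop)]
      refine lintegral_mono fun x => lintegral_mono fun y => ENNReal.ofReal_le_ofReal ?_
      refine mul_le_mul_of_nonneg_left (Real.exp_le_exp.2 ?_) (hρ0 _)
      have := ph_nonneg (Q := Q) hρm hρ0 hkp.le x
      linarith
    refine (Rrate_le hmem).trans ?_
    rw [relEnt_self]; exact zero_le
  push Not at hs
  obtain ⟨t2, ht2, hd2⟩ := hs
  have hcont : ContinuousOn (fun s => ∫⁻ x, dd ρ Q s x ∂P) (Ioi 0) := fun t ht =>
    (continuousAt_lint_dd hρm hρ0 ht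
      (hFfin _ (mul_nonneg zero_le_two (le_of_lt ht)))).continuousWithinAt
  obtain ⟨t, ht, hdt⟩ := isPreconnected_Ioi.intermediate_value (mem_Ioi.2 ht1) (mem_Ioi.2 ht2)
    hcont ⟨hd1, hd2.le⟩
  simp only [mem_Ioi] at ht hdt
  have hmem : tilt ρ P Q t ∈ distSet ρ P D := by
    refine mem_distSet hD (tilt_map hρm hρ0 ht.le) ?_
    rw [tilt_dist hρm hρ0, hdt]
  refine (Rrate_le hmem).trans ?_
  have h1 := tilt_relEnt hρm hρ0 ht.le (hFfin t ht.le) (by rw [hdt]; exact ENNReal.ofReal_ne_top)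
  rw [hdt, ← ENNReal.ofReal_mul ht.le] at h1
  exact (ENNReal.add_le_add_iff_right ENNReal.ofReal_ne_top).1 (h1.trans (h t ht.le))

lemma duality (hρm : Measurable ρ) (hρ0 : ∀ z, 0 ≤ ρ z) {D : ℝ} (hD : 0 ≤ D) :
    Rrate ρ P Q D = ⨆ t ∈ Ici (0 : ℝ), (FF ρ P Q t - ENNReal.ofReal (t * D)) := by
  refine le_antisymm ?_ ?_
  · refine strong_duality hρm hρ0 hD fun t ht => ?_
    rw [← tsub_le_iff_right]
    exact le_iSup₂_of_le t ht le_rfl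
  · refine iSup₂_le fun t ht => le_iInf₂ fun W hW => ?_
    rw [tsub_le_iff_right]
    exact weak_duality hρm hρ0 ht hD hW

lemma Rrate_neg {D : ℝ} (hD : D < 0) : Rrate ρ P Q D = ∞ := by
  refine iInf₂_eq_top.2 fun W hW => ?_
  have h1 := hW.2.2
  have h2 : (0 : EReal) ≤ ((∫⁻ z, ENNReal.ofReal (ρ z) ∂W : ℝ≥0∞) : EReal) :=
    EReal.coe_ennreal_nonneg _
  exact absurd (EReal.coe_nonneg.1 (h2.trans h1)) (not_le.2 hD)

end duality

/-! ### Almost additivity -/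

lemma posLog_mono : Monotone posLog := by
  intro a b hab
  unfold posLog
  rcases eq_or_ne b ∞ with rfl | hb
  · simp
  have ha : a ≠ ∞ := ne_top_of_le_ne_top hb hab
  rw [if_neg ha, if_neg hb]
  rcases eq_or_ne a 0 with rfl | h0
  · simp
  exact ENNReal.ofReal_le_ofReal (Real.log_le_log (ENNReal.toReal_pos h0 ha)
    (ENNReal.toReal_mono hb hab))

lemma posLog_mul {a b : ℝ≥0∞} (ha : 1 ≤ a) (hb : 1 ≤ b) :
    posLog (a * b) = posLog a + posLog b := by
  have ha0 : a ≠ 0 := (zero_lt_one.trans_le ha).ne'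
  have hb0 : b ≠ 0 := (zero_lt_one.trans_le hb).ne'
  rcases eq_or_ne a ∞ with rfl | hat
  · simp [posLog, ENNReal.top_mul hb0]
  rcases eq_or_ne b ∞ with rfl | hbt
  · simp [posLog, ENNReal.mul_top ha0]
  unfold posLog
  have h1 : 1 ≤ a.toReal := by simpa using ENNReal.toReal_mono hat ha
  have h2 : 1 ≤ b.toReal := by simpa using ENNReal.toReal_mono hbt hb
  rw [if_neg (ENNReal.mul_ne_top hat hbt), if_neg hat, if_neg hbt, ENNReal.toReal_mul,
    Real.log_mul (by positivity) (by positivity),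
    ENNReal.ofReal_add (Real.log_nonneg h1) (Real.log_nonneg h2)]

lemma posLog_ofReal {C : ℝ} (hC : 1 ≤ C) : posLog (ENNReal.ofReal C) = ENNReal.ofReal (Real.log C) := by
  simp [posLog, ENNReal.toReal_ofReal (zero_le_one.trans hC)]

lemma negLog_eq (t : ℝ≥0∞) : negLog t = posLog t⁻¹ := by
  unfold negLog posLog
  rcases eq_or_ne t 0 with rfl | h
  · simp
  · simp [h, ENNReal.toReal_inv, Real.log_inv]

lemma measurable_posLog : Measurable posLog :=
  Measurable.ite (measurableSet_singleton _) measurable_const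
    (Real.measurable_log.comp ENNReal.measurable_toReal).ennreal_ofReal

section mix

variable {Ω X Y : Type*} [MeasurableSpace Ω] [MeasurableSpace X] [MeasurableSpace Y]

lemma mix_upper {𝒬 : Measure Ω} {p : Ω → X} {s : Ω → Y} (hp : Measurable p) (hs : Measurable s)
    {c : ℝ≥0∞}
    (h : ∀ A B, MeasurableSet A → MeasurableSet B →
      𝒬 (p ⁻¹' A ∩ s ⁻¹' B) ≤ c * (𝒬 (p ⁻¹' A) * 𝒬 (s ⁻¹' B)))
    {f : X → ℝ≥0∞} {g : Y → ℝ≥0∞} (hf : Measurable f) (hg : Measurable g) :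
    ∫⁻ y, f (p y) * g (s y) ∂𝒬 ≤ c * ((∫⁻ y, f (p y) ∂𝒬) * ∫⁻ y, g (s y) ∂𝒬) := by
  have step1 : ∀ B, MeasurableSet B →
      ∫⁻ y in s ⁻¹' B, f (p y) ∂𝒬 ≤ (c * 𝒬 (s ⁻¹' B)) * ∫⁻ y, f (p y) ∂𝒬 := by
    intro B hB
    have hle : (𝒬.restrict (s ⁻¹' B)).map p ≤ (c * 𝒬 (s ⁻¹' B)) • 𝒬.map p := by
      refine Measure.le_iff.2 fun A hA => ?_
      rw [Measure.map_apply hp hA, Measure.restrict_apply (hp hA), Measure.smul_apply,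
        Measure.map_apply hp hA, smul_eq_mul]
      refine (h A B hA hB).trans_eq ?_
      ring
    have := lintegral_mono' hle (le_refl f)
    rwa [lintegral_map hf hp, lintegral_smul_measure, lintegral_map hf hp, smul_eq_mul] at this
  have hle : (𝒬.withDensity fun y => f (p y)).map s ≤ (c * ∫⁻ y, f (p y) ∂𝒬) • 𝒬.map s := by
    refine Measure.le_iff.2 fun B hB => ?_
    rw [Measure.map_apply hs hB, withDensity_apply _ (hs hB), Measure.smul_apply,
      Measure.map_apply hs hB, smul_eq_mul]
    refine (step1 B hB).trans_eq ?_
    ring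
  have hfp : Measurable fun y => f (p y) := hf.comp hp
  have hgs : Measurable fun y => g (s y) := hg.comp hs
  have := lintegral_mono' hle (le_refl g)
  rw [lintegral_map hg hs, lintegral_smul_measure, lintegral_map hg hs, smul_eq_mul,
    lintegral_withDensity_eq_lintegral_mul _ hfp hgs] at this
  rw [← mul_assoc]
  exact this

lemma mix_lower {𝒬 : Measure Ω} {p : Ω → X} {s : Ω → Y} (hp : Measurable p) (hs : Measurable s)
    {c : ℝ≥0∞}
    (h : ∀ A B, MeasurableSet A → MeasurableSet B →
      c * (𝒬 (p ⁻¹' A) * 𝒬 (s ⁻¹' B)) ≤ 𝒬 (p ⁻¹' A ∩ s ⁻¹' B))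
    {f : X → ℝ≥0∞} {g : Y → ℝ≥0∞} (hf : Measurable f) (hg : Measurable g) :
    c * ((∫⁻ y, f (p y) ∂𝒬) * ∫⁻ y, g (s y) ∂𝒬) ≤ ∫⁻ y, f (p y) * g (s y) ∂𝒬 := by
  have step1 : ∀ B, MeasurableSet B →
      (c * 𝒬 (s ⁻¹' B)) * ∫⁻ y, f (p y) ∂𝒬 ≤ ∫⁻ y in s ⁻¹' B, f (p y) ∂𝒬 := by
    intro B hB
    have hle : (c * 𝒬 (s ⁻¹' B)) • 𝒬.map p ≤ (𝒬.restrict (s ⁻¹' B)).map p := by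
      refine Measure.le_iff.2 fun A hA => ?_
      rw [Measure.map_apply hp hA, Measure.restrict_apply (hp hA), Measure.smul_apply,
        Measure.map_apply hp hA, smul_eq_mul]
      refine le_trans (le_of_eq ?_) (h A B hA hB)
      ring
    have := lintegral_mono' hle (le_refl f)
    rwa [lintegral_smul_measure, lintegral_map hf hp, lintegral_map hf hp, smul_eq_mul] at this
  have hle : (c * ∫⁻ y, f (p y) ∂𝒬) • 𝒬.map s ≤ (𝒬.withDensity fun y => f (p y)).map s := by
    refine Measure.le_iff.2 fun B hB => ?_
    rw [Measure.map_apply hs hB, withDensity_apply _ (hs hB), Measure.smul_apply,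
      Measure.map_apply hs hB, smul_eq_mul]
    refine le_trans (le_of_eq ?_) (step1 B hB)
    ring
  have hfp : Measurable fun y => f (p y) := hf.comp hp
  have hgs : Measurable fun y => g (s y) := hg.comp hs
  have := lintegral_mono' hle (le_refl g)
  rw [lintegral_smul_measure, lintegral_map hg hs, smul_eq_mul, lintegral_map hg hs,
    lintegral_withDensity_eq_lintegral_mul _ hfp hgs] at this
  rw [← mul_assoc]
  exact this

end mix

lemma shift_iterate {α : Type*} (n : ℕ) (x : ℕ → α) (k : ℕ) : shiftSeq^[n] x k = x (k + n) := by
  induction n generalizing x with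
  | zero => rfl
  | succ n ih => rw [Function.iterate_succ_apply, ih]; simp only [shiftSeq]; rw [add_assoc]

section proc

variable {S T : Type*} [MeasurableSpace S] [MeasurableSpace T]

/-- Laplace transform along the process. -/
def Zp (ρ : S × T → ℝ) (𝒬 : Measure (ℕ → T)) (l : ℝ) (n : ℕ) (x : ℕ → S) : ℝ≥0∞ :=
  ∫⁻ y, ENNReal.ofReal (Real.exp (l * ∑ k ∈ Finset.range n, ρ (x k, y k))) ∂𝒬

lemma measurable_Zp {ρ : S × T → ℝ} (hρm : Measurable ρ) (𝒬 : Measure (ℕ → T))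
    [IsProbabilityMeasure 𝒬] (l : ℝ) (n : ℕ) : Measurable (Zp ρ 𝒬 l n) := by
  have : Measurable (fun z : (ℕ → S) × (ℕ → T) =>
      ENNReal.ofReal (Real.exp (l * ∑ k ∈ Finset.range n, ρ (z.1 k, z.2 k)))) := by
    have : ∀ k : ℕ, Measurable fun z : (ℕ → S) × (ℕ → T) => ρ (z.1 k, z.2 k) := fun k =>
      hρm.comp (((measurable_pi_apply k).comp measurable_fst).prodMk
        ((measurable_pi_apply k).comp measurable_snd))
    fun_prop
  exact this.lintegral_prod_right'

lemma Zp_add {ρ : S × T → ℝ} (hρm : Measurable ρ) {𝒬 : Measure (ℕ → T)}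
    [IsProbabilityMeasure 𝒬] (hQstat : MeasurePreserving shiftSeq 𝒬 𝒬) {C : ℝ}
    (hmix : Mixing 𝒬 C) (l : ℝ) (n m : ℕ) (x : ℕ → S) :
    (ENNReal.ofReal C)⁻¹ * (Zp ρ 𝒬 l n x * Zp ρ 𝒬 l m (shiftSeq^[n] x)) ≤ Zp ρ 𝒬 l (n + m) x ∧
    Zp ρ 𝒬 l (n + m) x ≤ ENNReal.ofReal C * (Zp ρ 𝒬 l n x * Zp ρ 𝒬 l m (shiftSeq^[n] x)) := by
  set p : (ℕ → T) → (Fin n → T) := fun y k => y (k : ℕ) with hp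
  set s : (ℕ → T) → (ℕ → T) := fun y k => y (k + n) with hs
  have hpm : Measurable p := by fun_prop
  have hsm : Measurable s := by fun_prop
  set f : (Fin n → T) → ℝ≥0∞ := fun y => ENNReal.ofReal (Real.exp (l * ∑ k : Fin n, ρ (x k, y k)))
    with hf
  set g : (ℕ → T) → ℝ≥0∞ := fun y =>
    ENNReal.ofReal (Real.exp (l * ∑ k ∈ Finset.range m, ρ (x (k + n), y k))) with hg
  have hfm : Measurable f := by fun_prop
  have hgm : Measurable g := by fun_prop
  have hsi : s = shiftSeq^[n] := by
    funext y k; rw [shift_iterate]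
  have e1 : ∫⁻ y, f (p y) ∂𝒬 = Zp ρ 𝒬 l n x := by
    refine lintegral_congr fun y => ?_
    simp only [hf, hp]
    rw [Finset.sum_range]
  have e2 : ∫⁻ y, g (s y) ∂𝒬 = Zp ρ 𝒬 l m (shiftSeq^[n] x) := by
    have hmp : MeasurePreserving s 𝒬 𝒬 := by rw [hsi]; exact hQstat.iterate n
    rw [hmp.lintegral_comp hgm]
    refine lintegral_congr fun y => ?_
    simp only [hg, shift_iterate]
  have e3 : ∫⁻ y, f (p y) * g (s y) ∂𝒬 = Zp ρ 𝒬 l (n + m) x := by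
    refine lintegral_congr fun y => ?_
    simp only [hf, hg, hp, hs]
    rw [← ENNReal.ofReal_mul (Real.exp_pos _).le, ← Real.exp_add, ← mul_add,
      Finset.sum_range_add, ← Finset.sum_range (fun k => ρ (x k, y k))]
    simp only [add_comm]
  rw [← e1, ← e2, ← e3]
  constructor
  · exact mix_lower hpm hsm (fun A B hA hB =>
      (hmix n (p ⁻¹' A) (s ⁻¹' B) ⟨A, hA, rfl⟩ ⟨B, hB, rfl⟩).1) hfm hgm
  · exact mix_upper hpm hsm (fun A B hA hB =>
      (hmix n (p ⁻¹' A) (s ⁻¹' B) ⟨A, hA, rfl⟩ ⟨B, hB, rfl⟩).2) hfm hgm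

/-- The Laplace transform or its inverse, always `≥ 1`. -/
def Vp (ρ : S × T → ℝ) (𝒬 : Measure (ℕ → T)) (l : ℝ) (n : ℕ) (x : ℕ → S) : ℝ≥0∞ :=
  if 0 ≤ l then Zp ρ 𝒬 l n x else (Zp ρ 𝒬 l n x)⁻¹

/-- `|Λ_n(nλ)|`. -/
def AA (ρ : S × T → ℝ) (Psrc : Measure (ℕ → S)) (𝒬 : Measure (ℕ → T)) (l : ℝ) (n : ℕ) : ℝ≥0∞ :=
  ∫⁻ x, posLog (Vp ρ 𝒬 l n x) ∂Psrc

lemma measurable_Vp {ρ : S × T → ℝ} (hρm : Measurable ρ) (𝒬 : Measure (ℕ → T))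
    [IsProbabilityMeasure 𝒬] (l : ℝ) (n : ℕ) : Measurable (Vp ρ 𝒬 l n) := by
  unfold Vp
  split_ifs
  · exact measurable_Zp hρm 𝒬 l n
  · exact (measurable_Zp hρm 𝒬 l n).inv

lemma Zp_le_one {ρ : S × T → ℝ} (hρ0 : ∀ z, 0 ≤ ρ z) {𝒬 : Measure (ℕ → T)}
    [IsProbabilityMeasure 𝒬] {l : ℝ} (hl : l ≤ 0) (n : ℕ) (x : ℕ → S) : Zp ρ 𝒬 l n x ≤ 1 := by
  have : ∫⁻ _ : ℕ → T, (1 : ℝ≥0∞) ∂𝒬 = 1 := by simp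
  rw [← this]
  refine lintegral_mono fun y => ?_
  rw [← ENNReal.ofReal_one]
  refine ENNReal.ofReal_le_ofReal (Real.exp_le_one_iff.2 ?_)
  exact mul_nonpos_of_nonpos_of_nonneg hl (Finset.sum_nonneg fun _ _ => hρ0 _)

lemma one_le_Vp {ρ : S × T → ℝ} (hρ0 : ∀ z, 0 ≤ ρ z) {𝒬 : Measure (ℕ → T)}
    [IsProbabilityMeasure 𝒬] (l : ℝ) (n : ℕ) (x : ℕ → S) : 1 ≤ Vp ρ 𝒬 l n x := by
  unfold Vp
  split_ifs with h
  · have : ∫⁻ _ : ℕ → T, (1 : ℝ≥0∞) ∂𝒬 = 1 := by simp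
    rw [← this]
    refine lintegral_mono fun y => ?_
    rw [← ENNReal.ofReal_one]
    refine ENNReal.ofReal_le_ofReal (Real.one_le_exp ?_)
    exact mul_nonneg h (Finset.sum_nonneg fun _ _ => hρ0 _)
  · exact ENNReal.one_le_inv.2 (Zp_le_one hρ0 (not_le.1 h).le n x)

lemma Vp_add {ρ : S × T → ℝ} (hρm : Measurable ρ) (hρ0 : ∀ z, 0 ≤ ρ z) {𝒬 : Measure (ℕ → T)}
    [IsProbabilityMeasure 𝒬] (hQstat : MeasurePreserving shiftSeq 𝒬 𝒬) {C : ℝ} (hC : 1 ≤ C)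
    (hmix : Mixing 𝒬 C) (l : ℝ) (n m : ℕ) (x : ℕ → S) :
    Vp ρ 𝒬 l n x * Vp ρ 𝒬 l m (shiftSeq^[n] x) ≤ ENNReal.ofReal C * Vp ρ 𝒬 l (n + m) x ∧
    Vp ρ 𝒬 l (n + m) x ≤ ENNReal.ofReal C * (Vp ρ 𝒬 l n x * Vp ρ 𝒬 l m (shiftSeq^[n] x)) := by
  obtain ⟨h1, h2⟩ := Zp_add hρm hQstat hmix l n m x
  have hc0 : ENNReal.ofReal C ≠ 0 := by
    have : 0 < C := by linarith
    simpa using this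
  have hct : ENNReal.ofReal C ≠ ∞ := ENNReal.ofReal_ne_top
  unfold Vp
  split_ifs with h
  · refine ⟨?_, h2⟩
    rwa [← ENNReal.div_eq_inv_mul, ENNReal.div_le_iff_le_mul (Or.inl hc0) (Or.inl hct), mul_comm (Zp _ _ _ (n + m) _)] at h1
  · have hl := (not_le.1 h).le
    have ht : ∀ k x, Zp ρ 𝒬 l k x ≠ ∞ := fun k x =>
      ((Zp_le_one hρ0 hl k x).trans_lt ENNReal.one_lt_top).ne
    have hi : (Zp ρ 𝒬 l n x)⁻¹ * (Zp ρ 𝒬 l m (shiftSeq^[n] x))⁻¹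
        = (Zp ρ 𝒬 l n x * Zp ρ 𝒬 l m (shiftSeq^[n] x))⁻¹ :=
      (ENNReal.mul_inv (Or.inr (ht _ _)) (Or.inl (ht _ _))).symm
    rw [hi]
    constructor
    · have := ENNReal.inv_le_inv.2 h2
      rw [ENNReal.mul_inv (Or.inl hc0) (Or.inl hct), ← ENNReal.div_eq_inv_mul,
        ENNReal.div_le_iff_le_mul (Or.inl hc0) (Or.inl hct)] at this
      rwa [mul_comm (ENNReal.ofReal C)]
    · have := ENNReal.inv_le_inv.2 h1
      rwa [ENNReal.mul_inv (Or.inl (by simp)) (Or.inl (by simpa using hc0)), inv_inv] at this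

lemma AA_add {ρ : S × T → ℝ} (hρm : Measurable ρ) (hρ0 : ∀ z, 0 ≤ ρ z)
    {Psrc : Measure (ℕ → S)} (hP : MeasurePreserving shiftSeq Psrc Psrc)
    [IsProbabilityMeasure Psrc] {𝒬 : Measure (ℕ → T)}
    [IsProbabilityMeasure 𝒬] (hQstat : MeasurePreserving shiftSeq 𝒬 𝒬) {C : ℝ} (hC : 1 ≤ C)
    (hmix : Mixing 𝒬 C) (l : ℝ) (n m : ℕ) :
    AA ρ Psrc 𝒬 l n + AA ρ Psrc 𝒬 l m ≤ AA ρ Psrc 𝒬 l (n + m) + ENNReal.ofReal (Real.log C) ∧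
    AA ρ Psrc 𝒬 l (n + m) ≤ AA ρ Psrc 𝒬 l n + AA ρ Psrc 𝒬 l m + ENNReal.ofReal (Real.log C) := by
  have hm : ∀ k, Measurable fun x => posLog (Vp ρ 𝒬 l k x) := fun k =>
    measurable_posLog.comp (measurable_Vp hρm 𝒬 l k)
  have hit : Measurable (shiftSeq^[n] : (ℕ → S) → (ℕ → S)) := (hP.iterate n).measurable
  have e : AA ρ Psrc 𝒬 l n + AA ρ Psrc 𝒬 l m =
      ∫⁻ x, posLog (Vp ρ 𝒬 l n x * Vp ρ 𝒬 l m (shiftSeq^[n] x)) ∂Psrc := by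
    have h1 : AA ρ Psrc 𝒬 l m = ∫⁻ x, posLog (Vp ρ 𝒬 l m (shiftSeq^[n] x)) ∂Psrc :=
      ((hP.iterate n).lintegral_comp (hm m)).symm
    rw [h1]
    unfold AA
    rw [← lintegral_add_left (hm n)]
    refine lintegral_congr fun x => ?_
    rw [posLog_mul (one_le_Vp hρ0 _ _ _) (one_le_Vp hρ0 _ _ _)]
  have hc : ENNReal.ofReal (Real.log C) = ∫⁻ _ : ℕ → S, ENNReal.ofReal (Real.log C) ∂Psrc := by simp
  have hC1 : 1 ≤ ENNReal.ofReal C := by simpa using hC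
  rw [e, hc]
  unfold AA
  rw [← lintegral_add_right _ measurable_const, ← lintegral_add_right _ measurable_const]
  constructor
  · refine lintegral_mono fun x => ?_
    refine (posLog_mono (Vp_add hρm hρ0 hQstat hC hmix l n m x).1).trans_eq ?_
    rw [posLog_mul hC1 (one_le_Vp hρ0 _ _ _), posLog_ofReal hC, add_comm]
  · refine lintegral_mono fun x => ?_
    refine (posLog_mono (Vp_add hρm hρ0 hQstat hC hmix l n m x).2).trans_eq ?_
    rw [posLog_mul hC1 (one_le_mul (one_le_Vp hρ0 _ _ _) (one_le_Vp hρ0 _ _ _)),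
      posLog_ofReal hC, add_comm]

end proc

lemma fekete {a : ℕ → ℝ≥0∞} {c : ℝ} (hc : 0 ≤ c)
    (h1 : ∀ n m, a n + a m ≤ a (n + m) + ENNReal.ofReal c)
    (h2 : ∀ n m, a (n + m) ≤ a n + a m + ENNReal.ofReal c) :
    ∃ L : ℝ≥0∞, ∀ n : ℕ, 1 ≤ n →
      a n ≤ n * L + ENNReal.ofReal c ∧ n * L ≤ a n + ENNReal.ofReal c := by
  by_cases ht : a 1 = ∞
  · refine ⟨∞, fun n hn => ?_⟩
    have h3 : a n = ∞ := by
      obtain ⟨m, rfl⟩ : ∃ m, n = 1 + m := ⟨n - 1, by omega⟩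
      have := h1 1 m
      rw [ht, top_add, top_le_iff] at this
      by_contra hne
      exact ENNReal.add_ne_top.2 ⟨hne, ENNReal.ofReal_ne_top⟩ this
    have hn0 : (n : ℝ≥0∞) ≠ 0 := by simp; omega
    simp [h3, ENNReal.mul_top hn0]
  · have hfin : ∀ n, a (n + 1) ≠ ∞ := by
      intro n
      induction n with
      | zero => simpa using ht
      | succ n ih =>
        exact ((h2 (n + 1) 1).trans_lt (by
          simp only [ENNReal.add_lt_top]
          exact ⟨⟨ih.lt_top, Ne.lt_top ht⟩, ENNReal.ofReal_lt_top⟩)).ne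
    have hfin0 : a 0 ≠ ∞ := by
      intro h0
      have := h1 0 1
      rw [h0, top_add, top_le_iff] at this
      exact ENNReal.add_ne_top.2 ⟨hfin 0, ENNReal.ofReal_ne_top⟩ this
    have hf : ∀ n, a n ≠ ∞ := fun n => by
      cases n with
      | zero => exact hfin0
      | succ n => exact hfin n
    set b : ℕ → ℝ := fun n => (a n).toReal with hb
    have hb0 : ∀ n, 0 ≤ b n := fun n => ENNReal.toReal_nonneg
    have hab : ∀ n, a n = ENNReal.ofReal (b n) := fun n => (ENNReal.ofReal_toReal (hf n)).symm
    have b1 : ∀ n m, b n + b m ≤ b (n + m) + c := by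
      intro n m
      have := h1 n m
      rw [hab, hab, hab, ← ENNReal.ofReal_add (hb0 _) (hb0 _), ← ENNReal.ofReal_add (hb0 _) hc] at this
      exact (ENNReal.ofReal_le_ofReal_iff (add_nonneg (hb0 _) hc)).1 this
    have b2 : ∀ n m, b (n + m) ≤ b n + b m + c := by
      intro n m
      have := h2 n m
      rw [hab (n + m), hab n, hab m, ← ENNReal.ofReal_add (hb0 _) (hb0 _),
        ← ENNReal.ofReal_add (add_nonneg (hb0 _) (hb0 _)) hc] at this
      exact (ENNReal.ofReal_le_ofReal_iff (add_nonneg (add_nonneg (hb0 _) (hb0 _)) hc)).1 this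
    have s1 : Subadditive fun n => b n + c := fun n m => by linarith [b2 n m]
    have s2 : Subadditive fun n => -b n + c := fun n m => by linarith [b1 n m]
    have bd1 : BddBelow (range fun n : ℕ => (b n + c) / n) :=
      ⟨0, by rintro _ ⟨n, rfl⟩; exact div_nonneg (add_nonneg (hb0 _) hc) (Nat.cast_nonneg _)⟩
    have hlin : ∀ n : ℕ, b (n + 1) ≤ (n + 1) * (b 1 + c) := by
      intro n
      induction n with
      | zero => simp; exact hc
      | succ n ih =>
        have := b2 (n + 1) 1
        push_cast
        linarith
    have bd2 : BddBelow (range fun n : ℕ => (-b n + c) / n) := by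
      refine ⟨-(b 1 + c), ?_⟩
      rintro _ ⟨n, rfl⟩
      cases n with
      | zero => simp; linarith [hb0 1]
      | succ n =>
        have hp : (0 : ℝ) < ((n + 1 : ℕ) : ℝ) := by positivity
        rw [le_div_iff₀ hp]
        have := hlin n
        push_cast
        linarith
    have t1 := s1.tendsto_lim bd1
    have t2 := s2.tendsto_lim bd2
    have hc0 : Tendsto (fun n : ℕ => 2 * c / n) atTop (𝓝 0) :=
      tendsto_const_div_atTop_nhds_zero_nat _
    have hsum : s1.lim + s2.lim = 0 := by
      refine tendsto_nhds_unique (t1.add t2) (hc0.congr fun n => ?_)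
      rw [← add_div]; ring
    have hL0 : 0 ≤ s1.lim :=
      ge_of_tendsto' t1 fun n => div_nonneg (add_nonneg (hb0 _) hc) (Nat.cast_nonneg _)
    refine ⟨ENNReal.ofReal s1.lim, fun n hn => ?_⟩
    have hp : (0 : ℝ) < (n : ℝ) := by exact_mod_cast hn
    have l1 := s1.lim_le_div bd1 (show n ≠ 0 by omega)
    have l2 := s2.lim_le_div bd2 (show n ≠ 0 by omega)
    rw [le_div_iff₀ hp] at l1 l2
    have hs2 : s2.lim = -s1.lim := by linarith
    rw [hs2] at l2
    have hnc : (n : ℝ≥0∞) = ENNReal.ofReal n := by simp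
    rw [hab, hnc, ← ENNReal.ofReal_mul hp.le, ← ENNReal.ofReal_add (mul_nonneg hp.le hL0) hc,
      ← ENNReal.ofReal_add (hb0 _) hc]
    exact ⟨ENNReal.ofReal_le_ofReal (by linarith), ENNReal.ofReal_le_ofReal (by linarith)⟩

lemma tendsto_of_close {x : ℕ → ℝ≥0∞} {L c : ℝ≥0∞} (hc : c ≠ ∞)
    (h : ∀ n : ℕ, 1 ≤ n → n * x n ≤ n * L + c ∧ n * L ≤ n * x n + c) :
    Tendsto x atTop (𝓝 L) := by
  have hc0 : Tendsto (fun n : ℕ => c / n) atTop (𝓝 0) := by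
    have := ENNReal.Tendsto.const_div (a := c) ENNReal.tendsto_nat_nhds_top (Or.inr hc)
    simpa using this
  have aux : ∀ n : ℕ, 1 ≤ n → ∀ u v : ℝ≥0∞, n * u ≤ n * v + c → u ≤ v + c / n := by
    intro n hn u v huv
    have hn0 : (n : ℝ≥0∞) ≠ 0 := by simp; omega
    have hnt : (n : ℝ≥0∞) ≠ ∞ := ENNReal.natCast_ne_top n
    refine (ENNReal.mul_le_mul_iff_right hn0 hnt).1 ?_
    rwa [mul_add, ENNReal.mul_div_cancel hn0 hnt]
  have up : Tendsto (fun n : ℕ => L + c / n) atTop (𝓝 L) := by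
    simpa using tendsto_const_nhds.add hc0
  have lo : Tendsto (fun n : ℕ => L - c / n) atTop (𝓝 L) := by
    simpa using ENNReal.Tendsto.sub (tendsto_const_nhds (x := L)) hc0 (Or.inr ENNReal.zero_ne_top)
  refine tendsto_of_tendsto_of_tendsto_of_le_of_le' lo up ?_ ?_
  · filter_upwards [eventually_ge_atTop 1] with n hn
    rw [tsub_le_iff_right]
    exact aux n hn _ _ (h n hn).2
  · filter_upwards [eventually_ge_atTop 1] with n hn
    exact aux n hn _ _ (h n hn).1

/-! ### Final assembly -/

lemma ereal_aux (g R : ℝ≥0∞) {s : ℝ} (hs : 0 ≤ s) :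
    (((-s : ℝ) : EReal) - -(g : EReal) ≤ (R : EReal)) ↔ g ≤ R + ENNReal.ofReal s := by
  have e : ((ENNReal.ofReal s : ℝ≥0∞) : EReal) = (s : EReal) := by
    rw [EReal.coe_ennreal_ofReal, max_eq_left hs]
  rw [← EReal.coe_ennreal_le_coe_ennreal_iff, EReal.coe_ennreal_add, e, sub_eq_add_neg, neg_neg,
    EReal.coe_neg, add_comm, ← sub_eq_add_neg]
  exact EReal.sub_le_iff_le_add (Or.inl (EReal.coe_ne_bot _)) (Or.inl (EReal.coe_ne_top _))

lemma flt_eq {G : ℝ → ℝ≥0∞} {D : ℝ} (hD : 0 ≤ D) :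
    ((⨆ t ∈ Ici (0 : ℝ), (G t - ENNReal.ofReal (t * D)) : ℝ≥0∞) : EReal)
      = ⨆ l ∈ Iic (0 : ℝ), (((l * D : ℝ) : EReal) - -(G (-l) : EReal)) := by
  apply le_antisymm
  · set X : EReal := ⨆ l ∈ Iic (0 : ℝ), (((l * D : ℝ) : EReal) - -(G (-l) : EReal)) with hX
    have h0 : 0 ≤ X := by
      refine le_trans ?_ (le_iSup₂_of_le (0 : ℝ) (by simp) le_rfl)
      simp [EReal.coe_ennreal_nonneg]
    rw [← EReal.coe_toENNReal h0, EReal.coe_ennreal_le_coe_ennreal_iff]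
    refine iSup₂_le fun t ht => ?_
    rw [tsub_le_iff_right, ← ereal_aux _ _ (mul_nonneg ht hD), EReal.coe_toENNReal h0]
    refine le_trans ?_ (le_iSup₂_of_le (-t) (by simpa using ht) le_rfl)
    simp
  · refine iSup₂_le fun l hl => ?_
    have hl' : 0 ≤ -l := by simpa using hl
    have := (ereal_aux (G (-l)) (⨆ t ∈ Ici (0 : ℝ), (G t - ENNReal.ofReal (t * D)))
      (mul_nonneg hl' hD)).2 (by
        rw [← tsub_le_iff_right]
        exact le_iSup₂_of_le (-l) hl' le_rfl)
    simpa using this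

lemma flt_top {G : ℝ → ℝ≥0∞} {D : ℝ} (hD : D < 0) :
    ((∞ : ℝ≥0∞) : EReal)
      = ⨆ l ∈ Iic (0 : ℝ), (((l * D : ℝ) : EReal) - -(G (-l) : EReal)) := by
  symm
  rw [EReal.coe_ennreal_top, EReal.eq_top_iff_forall_lt]
  intro y
  have hl : (|y| + 1) / D ≤ 0 := div_nonpos_of_nonneg_of_nonpos (by positivity) hD.le
  refine lt_of_lt_of_le ?_ (le_iSup₂_of_le ((|y| + 1) / D) hl le_rfl)
  rw [div_mul_cancel₀ _ hD.ne, sub_eq_add_neg, neg_neg]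
  refine lt_of_lt_of_le (b := ((|y| + 1 : ℝ) : EReal)) ?_ ?_
  · exact_mod_cast (lt_add_one _).trans_le' (le_abs_self y)
  · exact le_add_of_nonneg_right (EReal.coe_ennreal_nonneg _)

lemma coe_inv_mul {n : ℕ} (hn : 1 ≤ n) (a : ℝ≥0∞) :
    (((n : ℝ)⁻¹ : ℝ) : EReal) * (a : EReal) = (((n : ℝ≥0∞)⁻¹ * a : ℝ≥0∞) : EReal) := by
  have hp : (0 : ℝ) < n := by exact_mod_cast hn
  rw [EReal.coe_ennreal_mul]
  congr 1
  have : (n : ℝ≥0∞)⁻¹ = ENNReal.ofReal ((n : ℝ)⁻¹) := by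
    rw [ENNReal.ofReal_inv_of_pos hp, ENNReal.ofReal_natCast]
  rw [this, EReal.coe_ennreal_ofReal, max_eq_left (by positivity)]

section assembly

variable {S T : Type*} [MeasurableSpace S] [MeasurableSpace T]

lemma measurable_rhoFin {ρ : S × T → ℝ} (hρm : Measurable ρ) (n : ℕ) :
    Measurable fun z : (Fin n → S) × (Fin n → T) => rhoFin ρ n z.1 z.2 := by
  have : ∀ k : Fin n, Measurable fun z : (Fin n → S) × (Fin n → T) => ρ (z.1 k, z.2 k) := fun k =>
    hρm.comp (((measurable_pi_apply k).comp measurable_fst).prodMk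
      ((measurable_pi_apply k).comp measurable_snd))
  unfold rhoFin
  fun_prop

lemma rhoFin_nonneg {ρ : S × T → ℝ} (hρ0 : ∀ z, 0 ≤ ρ z) (n : ℕ)
    (z : (Fin n → S) × (Fin n → T)) : 0 ≤ rhoFin ρ n z.1 z.2 :=
  mul_nonneg (by positivity) (Finset.sum_nonneg fun _ _ => hρ0 _)

lemma measurable_restr {α : Type*} [MeasurableSpace α] (n : ℕ) :
    Measurable fun (x : ℕ → α) (k : Fin n) => x (k : ℕ) := by fun_prop

lemma prob_margN {α : Type*} [MeasurableSpace α] (μ : Measure (ℕ → α)) [IsProbabilityMeasure μ]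
    (n : ℕ) : IsProbabilityMeasure (margN μ n) :=
  Measure.isProbabilityMeasure_map (measurable_restr n).aemeasurable

lemma lint_marg {ρ : S × T → ℝ} (hρm : Measurable ρ) (𝒬 : Measure (ℕ → T)) (l : ℝ) {n : ℕ}
    (hn : 1 ≤ n) (x : ℕ → S) :
    ∫⁻ y, ENNReal.ofReal (Real.exp ((n : ℝ) * l * rhoFin ρ n (fun k => x k) y)) ∂(margN 𝒬 n)
      = Zp ρ 𝒬 l n x := by
  unfold margN Zp
  have hm : Measurable fun y : Fin n → T => rhoFin ρ n (fun k => x k) y :=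
    (measurable_rhoFin hρm n).comp (measurable_const.prodMk measurable_id)
  rw [lintegral_map (by fun_prop) (measurable_restr n)]
  refine lintegral_congr fun y => ?_
  have hp : (n : ℝ) ≠ 0 := by
    have : (0 : ℝ) < n := by exact_mod_cast hn
    exact this.ne'
  congr 2
  unfold rhoFin
  rw [Finset.sum_range, mul_comm (n : ℝ) l, mul_assoc, mul_inv_cancel_left₀ hp]

lemma measurable_lint_marg {ρ : S × T → ℝ} (hρm : Measurable ρ) (𝒬 : Measure (ℕ → T))
    [IsProbabilityMeasure 𝒬] (l : ℝ) (n : ℕ) :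
    Measurable fun x : Fin n → S =>
      ∫⁻ y, ENNReal.ofReal (Real.exp (l * rhoFin ρ n x y)) ∂(margN 𝒬 n) := by
  haveI := prob_margN 𝒬 n
  have h := measurable_rhoFin hρm n
  have : Measurable fun z : (Fin n → S) × (Fin n → T) =>
      ENNReal.ofReal (Real.exp (l * rhoFin ρ n z.1 z.2)) := by fun_prop
  exact this.lintegral_prod_right'

lemma posLog_one : posLog 1 = 0 := by simp [posLog]

lemma AA_zero (ρ : S × T → ℝ) (Psrc : Measure (ℕ → S)) (𝒬 : Measure (ℕ → T))
    [IsProbabilityMeasure 𝒬] (n : ℕ) : AA ρ Psrc 𝒬 0 n = 0 := by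
  simp [AA, Vp, Zp, posLog_one]

lemma lint_posLog {ρ : S × T → ℝ} (hρm : Measurable ρ) (Psrc : Measure (ℕ → S))
    (𝒬 : Measure (ℕ → T)) [IsProbabilityMeasure 𝒬] (l : ℝ) {n : ℕ} (hn : 1 ≤ n)
    {φ : ℝ≥0∞ → ℝ≥0∞} (hφ : Measurable φ) :
    ∫⁻ x, φ (∫⁻ y, ENNReal.ofReal (Real.exp ((n : ℝ) * l * rhoFin ρ n x y)) ∂(margN 𝒬 n))
      ∂(margN Psrc n) = ∫⁻ x, φ (Zp ρ 𝒬 l n x) ∂Psrc := by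
  have hm := measurable_lint_marg hρm 𝒬 ((n : ℝ) * l) n
  refine (lintegral_map (hφ.comp hm) (measurable_restr n)).trans ?_
  refine lintegral_congr fun x => ?_
  rw [Function.comp_apply, lint_marg hρm 𝒬 l hn x]

lemma LamN_eq {ρ : S × T → ℝ} (hρm : Measurable ρ) (Psrc : Measure (ℕ → S))
    (𝒬 : Measure (ℕ → T)) [IsProbabilityMeasure 𝒬] (l : ℝ) {n : ℕ} (hn : 1 ≤ n) :
    LamN ρ n (margN Psrc n) (margN 𝒬 n) ((n : ℝ) * l) =
      if 0 ≤ l then (AA ρ Psrc 𝒬 l n : EReal) else -(AA ρ Psrc 𝒬 l n : EReal) := by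
  have hp : (0 : ℝ) < n := by exact_mod_cast hn
  have hiff : 0 ≤ (n : ℝ) * l ↔ 0 ≤ l := mul_nonneg_iff_of_pos_left hp
  unfold LamN Lam AA Vp
  by_cases h : 0 ≤ l
  · rw [if_pos (hiff.2 h), if_pos h]
    simp only [h, if_true]
    rw [lint_posLog hρm Psrc 𝒬 l hn measurable_posLog]
  · rw [if_neg (fun h' => h (hiff.1 h')), if_neg h]
    simp only [h, if_false, negLog_eq]
    rw [lint_posLog hρm Psrc 𝒬 l hn (φ := fun t => posLog t⁻¹)
      (measurable_posLog.comp measurable_inv)]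

lemma FF_eq {ρ : S × T → ℝ} (hρm : Measurable ρ) (hρ0 : ∀ z, 0 ≤ ρ z) (Psrc : Measure (ℕ → S))
    (𝒬 : Measure (ℕ → T)) [IsProbabilityMeasure Psrc] [IsProbabilityMeasure 𝒬] {t : ℝ}
    (ht : 0 ≤ t) {n : ℕ} (hn : 1 ≤ n) :
    FF (fun z : (Fin n → S) × (Fin n → T) => rhoFin ρ n z.1 z.2) (margN Psrc n) (margN 𝒬 n)
      ((n : ℝ) * t) = AA ρ Psrc 𝒬 (-t) n := by
  haveI := prob_margN 𝒬 n
  haveI := prob_margN Psrc n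
  have hp : (0 : ℝ) ≤ (n : ℝ) * t := by positivity
  have e : FF (fun z : (Fin n → S) × (Fin n → T) => rhoFin ρ n z.1 z.2) (margN Psrc n)
      (margN 𝒬 n) ((n : ℝ) * t) = ∫⁻ x, posLog (Zp ρ 𝒬 (-t) n x)⁻¹ ∂Psrc := by
    unfold FF
    simp only [← negLog_lint (Q := margN 𝒬 n) (measurable_rhoFin hρm n) (rhoFin_nonneg hρ0 n) hp,
      negLog_eq, ← mul_neg]
    rw [lint_posLog hρm Psrc 𝒬 (-t) hn (φ := fun t => posLog t⁻¹)
      (measurable_posLog.comp measurable_inv)]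
  rw [e]
  rcases ht.eq_or_lt with rfl | ht
  · rw [neg_zero, AA_zero]
    simp [Zp, posLog_one]
  · have h : ¬ (0 ≤ -t) := by linarith
    unfold AA Vp
    simp only [h, if_false]

lemma mul_Rn (ρ : S × T → ℝ) {n : ℕ} (hn : 1 ≤ n) (Pn : Measure (Fin n → S))
    (Qn : Measure (Fin n → T)) (D : ℝ) :
    (n : ℝ≥0∞) * RnMem ρ n Pn Qn D = Rrate (fun z => rhoFin ρ n z.1 z.2) Pn Qn D := by
  have hn0 : (n : ℝ≥0∞) ≠ 0 := by simp; omega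
  exact ENNReal.mul_inv_cancel_left hn0 (ENNReal.natCast_ne_top n)

end assembly

/-- under the mixing condition, the limit
`Λ_∞(ℙ,𝒬,λ) = lim_n (1/n) Λ_n(P_n,Q_n,nλ)` exists (in the extended reals) for
every `λ`, and `R_∞(ℙ,𝒬,D) = Λ*_∞(ℙ,𝒬,D) = sup_{λ ≤ 0}[λD - Λ_∞(ℙ,𝒬,λ)]` for
every `D`. -/
theorem stmt13 {S T : Type*} [MeasurableSpace S] [StandardBorelSpace S]
    [MeasurableSpace T] [StandardBorelSpace T]
    (ρ : S × T → ℝ) (hρm : Measurable ρ) (hρ0 : ∀ z, 0 ≤ ρ z)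
    (Psrc : Measure (ℕ → S)) [IsProbabilityMeasure Psrc] (hErg : Ergodic shiftSeq Psrc)
    (𝒬 : Measure (ℕ → T)) [IsProbabilityMeasure 𝒬]
    (hQstat : MeasurePreserving shiftSeq 𝒬 𝒬)
    (C : ℝ) (hC : 1 ≤ C) (hmix : Mixing 𝒬 C) :
    ∃ Linf : ℝ → EReal,
      (∀ l : ℝ, Tendsto
        (fun n : ℕ => (((n : ℝ)⁻¹ : ℝ) : EReal) *
          LamN ρ n (margN Psrc n) (margN 𝒬 n) ((n : ℝ) * l)) atTop (𝓝 (Linf l))) ∧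
      ∀ D : ℝ, ∃ r : ℝ≥0∞,
        Tendsto (fun n => RnMem ρ n (margN Psrc n) (margN 𝒬 n) D) atTop (𝓝 r) ∧
        (r : EReal) = ⨆ l ∈ Iic (0 : ℝ), (((l * D : ℝ) : EReal) - Linf l) := by
  have hc : 0 ≤ Real.log C := Real.log_nonneg hC
  have hP := hErg.toMeasurePreserving
  have hfek : ∀ l, ∃ L : ℝ≥0∞, ∀ n : ℕ, 1 ≤ n →
      AA ρ Psrc 𝒬 l n ≤ n * L + ENNReal.ofReal (Real.log C) ∧
      n * L ≤ AA ρ Psrc 𝒬 l n + ENNReal.ofReal (Real.log C) := fun l =>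
    fekete hc (fun n m => (AA_add hρm hρ0 hP hQstat hC hmix l n m).1)
      (fun n m => (AA_add hρm hρ0 hP hQstat hC hmix l n m).2)
  choose L hL using hfek
  have hn0 : ∀ n : ℕ, 1 ≤ n → (n : ℝ≥0∞) ≠ 0 := fun n hn => by simp; omega
  have hAt : ∀ l, Tendsto (fun n : ℕ => (n : ℝ≥0∞)⁻¹ * AA ρ Psrc 𝒬 l n) atTop (𝓝 (L l)) := by
    intro l
    refine tendsto_of_close (c := ENNReal.ofReal (Real.log C)) ENNReal.ofReal_ne_top
      fun n hn => ?_
    rw [ENNReal.mul_inv_cancel_left (hn0 n hn) (ENNReal.natCast_ne_top n)]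
    exact hL l n hn
  have hL0 : L 0 = 0 := by
    refine tendsto_nhds_unique (hAt 0) ?_
    simp [AA_zero]
  set Linf : ℝ → EReal := fun l => if 0 ≤ l then (L l : EReal) else -(L l : EReal) with hLinf
  have hLneg : ∀ l ∈ Iic (0 : ℝ), Linf l = -(L (- -l) : EReal) := by
    intro l hl
    rw [neg_neg, hLinf]
    rcases (show l ≤ 0 from hl).eq_or_lt with rfl | hl
    · simp [hL0]
    · simp [not_le.2 hl]
  refine ⟨Linf, fun l => ?_, fun D => ?_⟩
  · have hco := (continuous_coe_ennreal_ereal.tendsto (L l)).comp (hAt l)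
    by_cases h : 0 ≤ l
    · rw [hLinf]
      simp only [h, if_true]
      refine hco.congr' ?_
      filter_upwards [eventually_ge_atTop 1] with n hn
      rw [LamN_eq hρm Psrc 𝒬 l hn, if_pos h, coe_inv_mul hn]
      rfl
    · rw [hLinf]
      simp only [h, if_false]
      refine hco.neg.congr' ?_
      filter_upwards [eventually_ge_atTop 1] with n hn
      rw [LamN_eq hρm Psrc 𝒬 l hn, if_neg h, mul_neg, coe_inv_mul hn]
      rfl
  have hsup : ⨆ l ∈ Iic (0 : ℝ), (((l * D : ℝ) : EReal) - Linf l)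
      = ⨆ l ∈ Iic (0 : ℝ), (((l * D : ℝ) : EReal) - -((fun t => L (-t)) (-l) : EReal)) :=
    iSup_congr fun l => iSup_congr fun hl => by rw [hLneg l hl]
  rw [hsup]
  rcases lt_or_ge D 0 with hD | hD
  · refine ⟨∞, ?_, flt_top (G := fun t => L (-t)) hD⟩
    refine tendsto_const_nhds.congr' ?_
    filter_upwards [eventually_ge_atTop 1] with n hn
    haveI := prob_margN 𝒬 n
    haveI := prob_margN Psrc n
    have := mul_Rn ρ hn (margN Psrc n) (margN 𝒬 n) D
    rw [Rrate_neg hD] at this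
    by_contra hne
    exact ENNReal.mul_ne_top (ENNReal.natCast_ne_top n) (Ne.symm hne) this
  · refine ⟨_, ?_, flt_eq (G := fun t => L (-t)) hD⟩
    set r : ℝ≥0∞ := ⨆ t ∈ Ici (0 : ℝ), (L (-t) - ENNReal.ofReal (t * D)) with hr
    refine tendsto_of_close (c := ENNReal.ofReal (Real.log C)) ENNReal.ofReal_ne_top
      fun n hn => ?_
    haveI := prob_margN 𝒬 n
    haveI := prob_margN Psrc n
    have hp : (0 : ℝ) < n := by exact_mod_cast hn
    have hnt := ENNReal.natCast_ne_top n
    have hnc : (n : ℝ≥0∞) = ENNReal.ofReal n := by simp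
    rw [mul_Rn ρ hn, duality (measurable_rhoFin hρm n) (rhoFin_nonneg hρ0 n) hD]
    constructor
    · refine iSup₂_le fun s hs => ?_
      obtain ⟨t, rfl⟩ : ∃ t, s = (n : ℝ) * t := ⟨s / n, by field_simp⟩
      have ht : 0 ≤ t := (mul_nonneg_iff_of_pos_left hp).1 hs
      rw [FF_eq hρm hρ0 Psrc 𝒬 ht hn, tsub_le_iff_right]
      have h1 : L (-t) ≤ r + ENNReal.ofReal (t * D) := by
        rw [← tsub_le_iff_right]
        exact le_iSup₂_of_le (f := fun (t : ℝ) (_ : t ∈ Ici (0 : ℝ)) =>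
          L (-t) - ENNReal.ofReal (t * D)) t ht le_rfl
      calc AA ρ Psrc 𝒬 (-t) n ≤ n * L (-t) + ENNReal.ofReal (Real.log C) := (hL (-t) n hn).1
        _ ≤ n * (r + ENNReal.ofReal (t * D)) + ENNReal.ofReal (Real.log C) := by gcongr
        _ = n * r + ENNReal.ofReal (Real.log C) + ENNReal.ofReal (n * t * D) := by
          rw [mul_assoc (n : ℝ), ENNReal.ofReal_mul hp.le, ← hnc]
          ring
    · rw [hr, ENNReal.mul_iSup]
      refine iSup_le fun t => ?_
      rw [ENNReal.mul_iSup]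
      refine iSup_le fun ht => ?_
      have ht : 0 ≤ t := ht
      rw [ENNReal.mul_sub (fun _ _ => hnt), tsub_le_iff_right]
      have h2 : AA ρ Psrc 𝒬 (-t) n ≤ (⨆ t ∈ Ici (0 : ℝ),
          (FF (fun z : (Fin n → S) × (Fin n → T) => rhoFin ρ n z.1 z.2) (margN Psrc n)
            (margN 𝒬 n) t - ENNReal.ofReal (t * D))) + ENNReal.ofReal (n * t * D) := by
        rw [← tsub_le_iff_right, ← FF_eq hρm hρ0 Psrc 𝒬 ht hn]
        exact le_iSup₂_of_le (f := fun (t : ℝ) (_ : t ∈ Ici (0 : ℝ)) =>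
          FF (fun z : (Fin n → S) × (Fin n → T) => rhoFin ρ n z.1 z.2) (margN Psrc n)
            (margN 𝒬 n) t - ENNReal.ofReal (t * D)) ((n : ℝ) * t) (by
              show (0 : ℝ) ≤ n * t
              positivity) le_rfl
      refine (hL (-t) n hn).2.trans ?_
      refine (add_le_add_left h2 _).trans_eq ?_
      rw [mul_assoc (n : ℝ), ENNReal.ofReal_mul hp.le, ← hnc]
      ring

end
end

section
/- Let ℙ be the law of a stationary ergodic process (X_n)_{n≥1} with X_1 ~ P and marginals P_n, and let ℚ be the law of a stationary process (Y_n)_{n≥1} with Y_1 ~ Q and marginals Q_n satisfying the mixing condition C^{−1}ℚ(A)ℚ(B) ≤ ℚ(A∩B) ≤ Cℚ(A)ℚ(B) for some 1 ≤ C < ∞, all n, all A ∈ σ(Y_1^n) and B ∈ σ(Y_{n+1}^∞). Then for every n and every D, Λ*(P,Q,D) − log C ≤ Λ_n*(P_n, Q_n, D) ≤ Λ*(P,Q,D) + log C; consequently D_min(P,Q) = D_min(ℙ,ℚ). -/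
open MeasureTheory Filter Set Topology Classical
open scoped ENNReal NNReal

noncomputable section

namespace Aux15

def fS {S T : Type*} (ρ : S × T → ℝ) (l : ℝ) (n : ℕ) (x : ℕ → S) (y : ℕ → T) : ℝ≥0∞ :=
  ENNReal.ofReal (Real.exp (l * ∑ k ∈ Finset.range n, ρ (x k, y k)))

def FF {S T : Type*} [MeasurableSpace T] (ρ : S × T → ℝ) (𝒬 : Measure (ℕ → T)) (l : ℝ) (n : ℕ)
    (x : ℕ → S) : ℝ≥0∞ := ∫⁻ y, fS ρ l n x y ∂𝒬

def AA {S T : Type*} [MeasurableSpace S] [MeasurableSpace T] (ρ : S × T → ℝ)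
    (Psrc : Measure (ℕ → S)) (𝒬 : Measure (ℕ → T)) (l : ℝ) (n : ℕ) : ℝ≥0∞ :=
  ∫⁻ x, negLog (FF ρ 𝒬 l n x) ∂Psrc

def GG {S T : Type*} [MeasurableSpace S] [MeasurableSpace T] (ρ : S × T → ℝ)
    (Psrc : Measure (ℕ → S)) (𝒬 : Measure (ℕ → T)) (D : ℝ) (n : ℕ) : EReal :=
  ⨆ l ∈ Iic (0 : ℝ), (((n * l * D : ℝ) : EReal) + (AA ρ Psrc 𝒬 l n : EReal))

lemma negLog_measurable : Measurable negLog := by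
  unfold negLog
  refine Measurable.ite (measurableSet_singleton 0) measurable_const ?_
  fun_prop

lemma negLog_one : negLog 1 = 0 := by simp [negLog]

lemma negLog_lower {t a b : ℝ≥0∞} {C : ℝ} (hC : 1 ≤ C) (ha : a ≤ 1) (hb : b ≤ 1)
    (h : t ≤ ENNReal.ofReal C * (a * b)) :
    negLog a + negLog b ≤ negLog t + ENNReal.ofReal (Real.log C) := by
  by_cases ht : t = 0
  · simp [negLog, ht]
  have ha0 : a ≠ 0 := by rintro rfl; simp at h; exact ht h
  have hb0 : b ≠ 0 := by rintro rfl; simp at h; exact ht h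
  have haT : a ≠ ∞ := ne_top_of_le_ne_top (by simp) ha
  have hbT : b ≠ ∞ := ne_top_of_le_ne_top (by simp) hb
  have htop : ENNReal.ofReal C * (a * b) ≠ ∞ := by finiteness
  have htT : t ≠ ∞ := ne_top_of_le_ne_top htop h
  have h' := ENNReal.toReal_mono htop h
  rw [ENNReal.toReal_mul, ENNReal.toReal_mul, ENNReal.toReal_ofReal (by linarith)] at h'
  have pa := ENNReal.toReal_pos ha0 haT
  have pb := ENNReal.toReal_pos hb0 hbT
  have pt := ENNReal.toReal_pos ht htT
  have la : Real.log a.toReal ≤ 0 := Real.log_nonpos pa.le (by simpa using ENNReal.toReal_mono (by simp) ha)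
  have lb : Real.log b.toReal ≤ 0 := Real.log_nonpos pb.le (by simpa using ENNReal.toReal_mono (by simp) hb)
  have hl := Real.log_le_log pt h'
  rw [Real.log_mul (by linarith) (by positivity), Real.log_mul pa.ne' pb.ne'] at hl
  simp only [negLog, ha0, hb0, ht, if_false]
  rw [← ENNReal.ofReal_add (by linarith) (by linarith)]
  refine le_trans (ENNReal.ofReal_le_ofReal ?_) ENNReal.ofReal_add_le
  linarith

lemma negLog_upper {t a b : ℝ≥0∞} {C : ℝ} (hC : 1 ≤ C) (ha : a ≤ 1) (hb : b ≤ 1) (ht1 : t ≤ 1)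
    (h : (ENNReal.ofReal C)⁻¹ * (a * b) ≤ t) :
    negLog t ≤ negLog a + negLog b + ENNReal.ofReal (Real.log C) := by
  by_cases ha0 : a = 0
  · simp [negLog, ha0]
  by_cases hb0 : b = 0
  · simp [negLog, hb0]
  have haT : a ≠ ∞ := ne_top_of_le_ne_top (by simp) ha
  have hbT : b ≠ ∞ := ne_top_of_le_ne_top (by simp) hb
  have htT : t ≠ ∞ := ne_top_of_le_ne_top (by simp) ht1
  have h' := ENNReal.toReal_mono htT h
  rw [ENNReal.toReal_mul, ENNReal.toReal_mul, ENNReal.toReal_inv, ENNReal.toReal_ofReal (by linarith)] at h'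
  have pa := ENNReal.toReal_pos ha0 haT
  have pb := ENNReal.toReal_pos hb0 hbT
  have pC : 0 < C := by linarith
  have ht : t ≠ 0 := by
    rintro rfl
    have : 0 < C⁻¹ * (a.toReal * b.toReal) := by positivity
    simp only [ENNReal.toReal_zero] at h'
    linarith
  have hl := Real.log_le_log (by positivity) h'
  rw [Real.log_mul (by positivity) (by positivity), Real.log_mul pa.ne' pb.ne', Real.log_inv] at hl
  have la : Real.log a.toReal ≤ 0 := Real.log_nonpos pa.le (by simpa using ENNReal.toReal_mono (by simp) ha)
  have lb : Real.log b.toReal ≤ 0 := Real.log_nonpos pb.le (by simpa using ENNReal.toReal_mono (by simp) hb)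
  have lC := Real.log_nonneg hC
  simp only [negLog, ha0, hb0, ht, if_false]
  rw [← ENNReal.ofReal_add (by linarith) (by linarith), ← ENNReal.ofReal_add (by linarith) (by linarith)]
  exact ENNReal.ofReal_le_ofReal (by linarith)

section mix
variable {T : Type*} [MeasurableSpace T]

lemma mix_fun (𝒬 : Measure (ℕ → T)) [IsProbabilityMeasure 𝒬] {C : ℝ} (hC : 1 ≤ C)
    (hmix : Mixing 𝒬 C) (n : ℕ) (f : (Fin n → T) → ℝ≥0∞) (g : (ℕ → T) → ℝ≥0∞)
    (hf : Measurable f) (hg : Measurable g) :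
    (ENNReal.ofReal C)⁻¹ * ((∫⁻ y, f (fun k => y k) ∂𝒬) * ∫⁻ y, g (fun k => y (k + n)) ∂𝒬) ≤
      ∫⁻ y, f (fun k => y k) * g (fun k => y (k + n)) ∂𝒬 ∧
    ∫⁻ y, f (fun k => y k) * g (fun k => y (k + n)) ∂𝒬 ≤
      ENNReal.ofReal C * ((∫⁻ y, f (fun k => y k) ∂𝒬) * ∫⁻ y, g (fun k => y (k + n)) ∂𝒬) := by
  set p1 : (ℕ → T) → (Fin n → T) := fun y k => y k with hp1
  set p2 : (ℕ → T) → (ℕ → T) := fun y k => y (k + n) with hp2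
  have m1 : Measurable p1 := by fun_prop
  have m2 : Measurable p2 := by fun_prop
  have mfp : Measurable fun y => f (p1 y) := hf.comp m1
  have mgp : Measurable fun y => g (p2 y) := hg.comp m2
  -- step 1
  have s1 : ∀ B : Set (ℕ → T), MeasurableSet B →
      (ENNReal.ofReal C)⁻¹ * 𝒬 (p2 ⁻¹' B) * ∫⁻ y, f (p1 y) ∂𝒬 ≤ ∫⁻ y in p2 ⁻¹' B, f (p1 y) ∂𝒬 ∧
      ∫⁻ y in p2 ⁻¹' B, f (p1 y) ∂𝒬 ≤ ENNReal.ofReal C * 𝒬 (p2 ⁻¹' B) * ∫⁻ y, f (p1 y) ∂𝒬 := by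
    intro B hB
    have key : ∀ A : Set (Fin n → T), MeasurableSet A → _ := fun A hA =>
      hmix n (p1 ⁻¹' A) (p2 ⁻¹' B) ⟨A, hA, rfl⟩ ⟨B, hB, rfl⟩
    have e1 : ∫⁻ y in p2 ⁻¹' B, f (p1 y) ∂𝒬 = ∫⁻ z, f z ∂((𝒬.restrict (p2 ⁻¹' B)).map p1) :=
      (lintegral_map hf m1).symm
    have e2 : ∫⁻ y, f (p1 y) ∂𝒬 = ∫⁻ z, f z ∂(𝒬.map p1) := (lintegral_map hf m1).symm
    rw [e1, e2, ← smul_eq_mul (_ * _), ← smul_eq_mul (_ * _), ← lintegral_smul_measure,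
      ← lintegral_smul_measure]
    constructor
    · refine lintegral_mono' ?_ le_rfl
      refine Measure.le_iff.2 fun A hA => ?_
      rw [Measure.smul_apply, Measure.map_apply m1 hA, Measure.map_apply m1 hA,
        Measure.restrict_apply (m1 hA), smul_eq_mul]
      refine le_trans (le_of_eq ?_) (key A hA).1
      ring
    · refine lintegral_mono' ?_ le_rfl
      refine Measure.le_iff.2 fun A hA => ?_
      rw [Measure.smul_apply, Measure.map_apply m1 hA, Measure.map_apply m1 hA,
        Measure.restrict_apply (m1 hA), smul_eq_mul]
      refine le_trans (key A hA).2 (le_of_eq ?_)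
      ring
  have e3 : ∫⁻ y, f (p1 y) * g (p2 y) ∂𝒬 =
      ∫⁻ z, g z ∂((𝒬.withDensity fun y => f (p1 y)).map p2) := by
    rw [lintegral_map hg m2, lintegral_withDensity_eq_lintegral_mul _ mfp mgp]
    rfl
  have e4 : ∫⁻ y, g (p2 y) ∂𝒬 = ∫⁻ z, g z ∂(𝒬.map p2) := (lintegral_map hg m2).symm
  rw [e3, e4, ← mul_assoc, ← mul_assoc, ← smul_eq_mul (_ * _), ← smul_eq_mul (_ * _),
    ← lintegral_smul_measure, ← lintegral_smul_measure]
  constructor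
  · refine lintegral_mono' ?_ le_rfl
    refine Measure.le_iff.2 fun B hB => ?_
    rw [Measure.smul_apply, Measure.map_apply m2 hB, Measure.map_apply m2 hB,
      withDensity_apply _ (m2 hB), smul_eq_mul]
    refine le_trans (le_of_eq ?_) (s1 B hB).1
    ring
  · refine lintegral_mono' ?_ le_rfl
    refine Measure.le_iff.2 fun B hB => ?_
    rw [Measure.smul_apply, Measure.map_apply m2 hB, Measure.map_apply m2 hB,
      withDensity_apply _ (m2 hB), smul_eq_mul]
    refine le_trans (s1 B hB).2 (le_of_eq ?_)
    ring

end mix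

lemma shift_iter {α : Type*} (x : ℕ → α) (m : ℕ) : shiftSeq^[m] x = fun k => x (k + m) := by
  induction m generalizing x with
  | zero => rfl
  | succ m ih => rw [Function.iterate_succ_apply, ih]; funext k; simp [shiftSeq]; congr 1

section main
variable {S T : Type*} [MeasurableSpace S] [MeasurableSpace T]
  {ρ : S × T → ℝ}

lemma fS_meas (hρm : Measurable ρ) (l : ℝ) (n : ℕ) :
    Measurable fun z : (ℕ → S) × (ℕ → T) => fS ρ l n z.1 z.2 := by
  unfold fS
  fun_prop

lemma fS_le_one (hρ0 : ∀ z, 0 ≤ ρ z) {l : ℝ} (hl : l ≤ 0) (n : ℕ) (x : ℕ → S) (y : ℕ → T) :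
    fS ρ l n x y ≤ 1 := by
  unfold fS
  rw [ENNReal.ofReal_le_one, Real.exp_le_one_iff]
  exact mul_nonpos_of_nonpos_of_nonneg hl (Finset.sum_nonneg fun k _ => hρ0 _)

lemma FF_le_one (hρ0 : ∀ z, 0 ≤ ρ z) (𝒬 : Measure (ℕ → T)) [IsProbabilityMeasure 𝒬]
    {l : ℝ} (hl : l ≤ 0) (n : ℕ) (x : ℕ → S) : FF ρ 𝒬 l n x ≤ 1 := by
  unfold FF
  calc _ ≤ ∫⁻ _, 1 ∂𝒬 := lintegral_mono fun y => fS_le_one hρ0 hl n x y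
    _ = 1 := by simp

lemma FF_meas (hρm : Measurable ρ) (𝒬 : Measure (ℕ → T)) [IsProbabilityMeasure 𝒬]
    (l : ℝ) (n : ℕ) : Measurable (FF (S := S) ρ 𝒬 l n) :=
  (fS_meas hρm l n).lintegral_prod_right'

lemma FF_mix (hρm : Measurable ρ) (𝒬 : Measure (ℕ → T)) [IsProbabilityMeasure 𝒬]
    (hQstat : MeasurePreserving shiftSeq 𝒬 𝒬)
    {C : ℝ} (hC : 1 ≤ C) (hmix : Mixing 𝒬 C) (l : ℝ) (m n : ℕ) (x : ℕ → S) :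
    (ENNReal.ofReal C)⁻¹ * (FF ρ 𝒬 l m x * FF ρ 𝒬 l n (shiftSeq^[m] x)) ≤ FF ρ 𝒬 l (m + n) x ∧
    FF ρ 𝒬 l (m + n) x ≤ ENNReal.ofReal C * (FF ρ 𝒬 l m x * FF ρ 𝒬 l n (shiftSeq^[m] x)) := by
  set f : (Fin m → T) → ℝ≥0∞ := fun y => ENNReal.ofReal (Real.exp (l * ∑ k : Fin m, ρ (x k, y k)))
  set g : (ℕ → T) → ℝ≥0∞ := fun y => fS ρ l n (shiftSeq^[m] x) y
  have hf : Measurable f := by fun_prop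
  have hg : Measurable g := (fS_meas hρm l n).comp measurable_prodMk_left
  have h := mix_fun 𝒬 hC hmix m f g hf hg
  have e1 : ∫⁻ y, f (fun k => y k) ∂𝒬 = FF ρ 𝒬 l m x := by
    refine lintegral_congr fun y => ?_
    simp only [f, fS]
    rw [Fin.sum_univ_eq_sum_range (fun k => ρ (x k, y k))]
  have e2 : ∫⁻ y, g (fun k => y (k + m)) ∂𝒬 = FF ρ 𝒬 l n (shiftSeq^[m] x) := by
    have := (hQstat.iterate m).lintegral_comp hg
    rw [show (FF ρ 𝒬 l n (shiftSeq^[m] x)) = ∫⁻ y, g y ∂𝒬 from rfl, ← this]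
    simp only [shift_iter]
  have e3 : ∫⁻ y, f (fun k => y k) * g (fun k => y (k + m)) ∂𝒬 = FF ρ 𝒬 l (m + n) x := by
    refine lintegral_congr fun y => ?_
    simp only [f, g, fS]
    rw [← ENNReal.ofReal_mul (Real.exp_pos _).le, ← Real.exp_add, ← mul_add,
      Finset.sum_range_add, Fin.sum_univ_eq_sum_range (fun k => ρ (x k, y k)), shift_iter]
    simp only [add_comm m]
  rwa [e1, e2, e3] at h

lemma AA_zero (Psrc : Measure (ℕ → S)) [IsProbabilityMeasure Psrc]
    (𝒬 : Measure (ℕ → T)) [IsProbabilityMeasure 𝒬] (l : ℝ) : AA ρ Psrc 𝒬 l 0 = 0 := by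
  simp [AA, FF, fS, negLog_one]

lemma AA_lzero (Psrc : Measure (ℕ → S)) [IsProbabilityMeasure Psrc]
    (𝒬 : Measure (ℕ → T)) [IsProbabilityMeasure 𝒬] (n : ℕ) : AA ρ Psrc 𝒬 0 n = 0 := by
  simp [AA, FF, fS, negLog_one]

lemma AA_add (hρm : Measurable ρ) (hρ0 : ∀ z, 0 ≤ ρ z)
    (Psrc : Measure (ℕ → S)) [IsProbabilityMeasure Psrc] (hP : MeasurePreserving shiftSeq Psrc Psrc)
    (𝒬 : Measure (ℕ → T)) [IsProbabilityMeasure 𝒬]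
    (hQstat : MeasurePreserving shiftSeq 𝒬 𝒬)
    {C : ℝ} (hC : 1 ≤ C) (hmix : Mixing 𝒬 C) {l : ℝ} (hl : l ≤ 0) (m n : ℕ) :
    AA ρ Psrc 𝒬 l m + AA ρ Psrc 𝒬 l n ≤ AA ρ Psrc 𝒬 l (m + n) + ENNReal.ofReal (Real.log C) ∧
    AA ρ Psrc 𝒬 l (m + n) ≤ AA ρ Psrc 𝒬 l m + AA ρ Psrc 𝒬 l n + ENNReal.ofReal (Real.log C) := by
  have mm : ∀ n, Measurable fun x : ℕ → S => negLog (FF ρ 𝒬 l n x) := fun n =>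
    negLog_measurable.comp (FF_meas hρm 𝒬 l n)
  have e1 : AA ρ Psrc 𝒬 l m + AA ρ Psrc 𝒬 l n =
      ∫⁻ x, (negLog (FF ρ 𝒬 l m x) + negLog (FF ρ 𝒬 l n (shiftSeq^[m] x))) ∂Psrc := by
    rw [lintegral_add_left (mm m), (hP.iterate m).lintegral_comp (mm n)]
    rfl
  have e2 : ∀ h : (ℕ → S) → ℝ≥0∞, ∫⁻ x, h x ∂Psrc + ENNReal.ofReal (Real.log C) =
      ∫⁻ x, (h x + ENNReal.ofReal (Real.log C)) ∂Psrc := by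
    intro h
    rw [lintegral_add_right _ measurable_const]; simp
  rw [e1, e2]
  constructor
  · rw [AA, e2]
    refine lintegral_mono fun x => ?_
    exact negLog_lower hC (FF_le_one hρ0 𝒬 hl _ _) (FF_le_one hρ0 𝒬 hl _ _)
      (FF_mix hρm 𝒬 hQstat hC hmix l m n x).2
  · refine lintegral_mono fun x => ?_
    exact negLog_upper hC (FF_le_one hρ0 𝒬 hl _ _) (FF_le_one hρ0 𝒬 hl _ _)
      (FF_le_one hρ0 𝒬 hl _ _) (FF_mix hρm 𝒬 hQstat hC hmix l m n x).1

lemma AA_lin (hρm : Measurable ρ) (hρ0 : ∀ z, 0 ≤ ρ z)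
    (Psrc : Measure (ℕ → S)) [IsProbabilityMeasure Psrc] (hP : MeasurePreserving shiftSeq Psrc Psrc)
    (𝒬 : Measure (ℕ → T)) [IsProbabilityMeasure 𝒬]
    (hQstat : MeasurePreserving shiftSeq 𝒬 𝒬)
    {C : ℝ} (hC : 1 ≤ C) (hmix : Mixing 𝒬 C) {l : ℝ} (hl : l ≤ 0) (n : ℕ) :
    n * AA ρ Psrc 𝒬 l 1 ≤ AA ρ Psrc 𝒬 l n + n * ENNReal.ofReal (Real.log C) ∧
    AA ρ Psrc 𝒬 l n ≤ n * AA ρ Psrc 𝒬 l 1 + n * ENNReal.ofReal (Real.log C) := by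
  induction n with
  | zero => simp [AA_zero]
  | succ n ih =>
    have h := AA_add hρm hρ0 Psrc hP 𝒬 hQstat hC hmix hl n 1
    push_cast
    constructor
    · calc _ = n * AA ρ Psrc 𝒬 l 1 + AA ρ Psrc 𝒬 l 1 := by ring
        _ ≤ AA ρ Psrc 𝒬 l n + n * ENNReal.ofReal (Real.log C) + AA ρ Psrc 𝒬 l 1 := by
          gcongr; exact ih.1
        _ = (AA ρ Psrc 𝒬 l n + AA ρ Psrc 𝒬 l 1) + n * ENNReal.ofReal (Real.log C) := by ring
        _ ≤ (AA ρ Psrc 𝒬 l (n + 1) + ENNReal.ofReal (Real.log C))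
            + n * ENNReal.ofReal (Real.log C) := add_le_add_left h.1 _
        _ = _ := by ring
    · calc _ ≤ _ := h.2
        _ ≤ (n * AA ρ Psrc 𝒬 l 1 + n * ENNReal.ofReal (Real.log C)) + AA ρ Psrc 𝒬 l 1
          + ENNReal.ofReal (Real.log C) := by gcongr; exact ih.2
        _ = _ := by ring

lemma Lam_eq (ρ : S × T → ℝ) (P : Measure S) [IsProbabilityMeasure P] (Q : Measure T)
    [IsProbabilityMeasure Q] {l : ℝ} (hl : l ≤ 0) :
    Lam ρ P Q l =
      -((∫⁻ x, negLog (∫⁻ y, ENNReal.ofReal (Real.exp (l * ρ (x, y))) ∂Q) ∂P : ℝ≥0∞) : EReal) := by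
  unfold Lam
  split_ifs with h
  · have : l = 0 := le_antisymm hl h
    subst this
    simp [posLog, negLog]
  · rfl

lemma LamN_eq (hρm : Measurable ρ)
    (Psrc : Measure (ℕ → S)) [IsProbabilityMeasure Psrc]
    (𝒬 : Measure (ℕ → T)) [IsProbabilityMeasure 𝒬] {l : ℝ} (hl : l ≤ 0) {n : ℕ} (hn : 0 < n) :
    LamN ρ n (margN Psrc n) (margN 𝒬 n) (n * l) = -(AA ρ Psrc 𝒬 l n : EReal) := by
  have mS : Measurable fun (x : ℕ → S) (k : Fin n) => x (k : ℕ) := by fun_prop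
  have mT : Measurable fun (x : ℕ → T) (k : Fin n) => x (k : ℕ) := by fun_prop
  have : IsProbabilityMeasure (margN Psrc n) := Measure.isProbabilityMeasure_map mS.aemeasurable
  have : IsProbabilityMeasure (margN 𝒬 n) := Measure.isProbabilityMeasure_map mT.aemeasurable
  have mf : Measurable fun z : (Fin n → S) × (Fin n → T) =>
      ENNReal.ofReal (Real.exp (n * l * rhoFin ρ n z.1 z.2)) := by
    unfold rhoFin; fun_prop
  rw [LamN, Lam_eq _ _ _ (mul_nonpos_of_nonneg_of_nonpos (Nat.cast_nonneg n) hl)]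
  refine congrArg (fun t : ℝ≥0∞ => -(t : EReal)) ?_
  change ∫⁻ x, negLog (∫⁻ y, ENNReal.ofReal (Real.exp (n * l * rhoFin ρ n x y)) ∂(margN 𝒬 n))
    ∂(margN Psrc n) = ∫⁻ x, negLog (FF ρ 𝒬 l n x) ∂Psrc
  rw [show margN Psrc n = Psrc.map _ from rfl, lintegral_map (f := fun x => negLog (∫⁻ y, ENNReal.ofReal
    (Real.exp (n * l * rhoFin ρ n x y)) ∂(margN 𝒬 n)))
    (negLog_measurable.comp mf.lintegral_prod_right') mS]
  refine lintegral_congr fun x => ?_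
  refine congrArg negLog ?_
  have mg : Measurable fun y : Fin n → T => ENNReal.ofReal
      (Real.exp (n * l * rhoFin ρ n (fun k : Fin n => x k) y)) := by
    unfold rhoFin; fun_prop
  rw [show margN 𝒬 n = 𝒬.map _ from rfl, lintegral_map mg mT]
  unfold FF
  refine lintegral_congr fun y => ?_
  have hn' : (n : ℝ) ≠ 0 := by positivity
  unfold rhoFin fS
  rw [Fin.sum_univ_eq_sum_range (fun k => ρ (x k, y k))]
  rw [mul_comm (n : ℝ) l, mul_assoc l, mul_inv_cancel_left₀ hn']

lemma LamStarN_eq (hρm : Measurable ρ)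
    (Psrc : Measure (ℕ → S)) [IsProbabilityMeasure Psrc]
    (𝒬 : Measure (ℕ → T)) [IsProbabilityMeasure 𝒬] (D : ℝ) {n : ℕ} (hn : 0 < n) :
    LamStarN ρ n (margN Psrc n) (margN 𝒬 n) D = (((n : ℝ)⁻¹ : ℝ) : EReal) * GG ρ Psrc 𝒬 D n := by
  unfold LamStarN GG
  congr 1
  have hn' : (0 : ℝ) < n := by positivity
  apply le_antisymm
  · refine iSup₂_le fun l hl => ?_
    have hl' : l / n ≤ 0 := div_nonpos_of_nonpos_of_nonneg hl hn'.le
    have e : (n : ℝ) * (l / n) = l := by field_simp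
    refine le_trans (le_of_eq ?_) (le_iSup₂ (l / n) hl')
    have := LamN_eq hρm Psrc 𝒬 hl' hn
    rw [e] at this
    rw [e, this, sub_eq_add_neg, neg_neg]
  · refine iSup₂_le fun l hl => ?_
    have hl' : n * l ≤ 0 := mul_nonpos_of_nonneg_of_nonpos hn'.le hl
    refine le_trans (le_of_eq ?_) (le_iSup₂ (n * l) hl')
    rw [LamN_eq hρm Psrc 𝒬 hl hn, sub_eq_add_neg, neg_neg]

lemma LamStar_eq (hρm : Measurable ρ)
    (Psrc : Measure (ℕ → S)) [IsProbabilityMeasure Psrc]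
    (𝒬 : Measure (ℕ → T)) [IsProbabilityMeasure 𝒬]
    (P : Measure S) [IsProbabilityMeasure P] (hP1 : Psrc.map (fun x => x 0) = P)
    (Q : Measure T) [IsProbabilityMeasure Q] (hQ1 : 𝒬.map (fun y => y 0) = Q) (D : ℝ) :
    LamStar ρ P Q D = GG ρ Psrc 𝒬 D 1 := by
  unfold LamStar GG
  refine iSup_congr fun l => iSup_congr fun hl => ?_
  have mf : Measurable fun z : S × T => ENNReal.ofReal (Real.exp (l * ρ (z.1, z.2))) := by
    fun_prop
  rw [Lam_eq _ _ _ hl, sub_eq_add_neg, neg_neg, Nat.cast_one, one_mul]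
  congr 2
  subst hP1
  rw [lintegral_map (f := fun x => negLog (∫⁻ y, ENNReal.ofReal
    (Real.exp (l * ρ (x, y))) ∂Q))
    (negLog_measurable.comp mf.lintegral_prod_right') (by fun_prop)]
  refine lintegral_congr fun x => ?_
  congr 1
  subst hQ1
  rw [lintegral_map (f := fun y => ENNReal.ofReal
    (Real.exp (l * ρ (x 0, y)))) (mf.comp measurable_prodMk_left) (by fun_prop)]
  refine lintegral_congr fun y => ?_
  simp [fS]

lemma GG_nonneg (Psrc : Measure (ℕ → S)) [IsProbabilityMeasure Psrc]
    (𝒬 : Measure (ℕ → T)) [IsProbabilityMeasure 𝒬] (D : ℝ) (n : ℕ) : 0 ≤ GG ρ Psrc 𝒬 D n := by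
  refine le_trans (le_of_eq ?_) (le_iSup₂ (0:ℝ) (mem_Iic.2 le_rfl))
  simp [AA_lzero]

lemma le_GG (ρ : S × T → ℝ) (Psrc : Measure (ℕ → S))
    (𝒬 : Measure (ℕ → T)) (D : ℝ) (n : ℕ) {l : ℝ} (hl : l ≤ 0) :
    ((n * l * D : ℝ) : EReal) + (AA ρ Psrc 𝒬 l n : EReal) ≤ GG ρ Psrc 𝒬 D n :=
  le_iSup₂ (f := fun l (_ : l ∈ Iic (0:ℝ)) =>
    ((n * l * D : ℝ) : EReal) + (AA ρ Psrc 𝒬 l n : EReal)) l hl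

lemma coe_eq {a : ℝ≥0∞} (h : a ≠ ∞) : (a : EReal) = ((a.toReal : ℝ) : EReal) := by
  rw [← EReal.toReal_coe_ennreal, EReal.coe_toReal] <;> simp [h]

lemma GG_lower (hρm : Measurable ρ) (hρ0 : ∀ z, 0 ≤ ρ z)
    (Psrc : Measure (ℕ → S)) [IsProbabilityMeasure Psrc] (hP : MeasurePreserving shiftSeq Psrc Psrc)
    (𝒬 : Measure (ℕ → T)) [IsProbabilityMeasure 𝒬]
    (hQstat : MeasurePreserving shiftSeq 𝒬 𝒬)
    {C : ℝ} (hC : 1 ≤ C) (hmix : Mixing 𝒬 C) (D : ℝ) {n : ℕ} (hn : 0 < n) :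
    GG ρ Psrc 𝒬 D 1 ≤ (((n : ℝ)⁻¹ : ℝ) : EReal) * GG ρ Psrc 𝒬 D n + ((Real.log C : ℝ) : EReal) := by
  have hn' : (0 : ℝ) < n := by positivity
  have lC := Real.log_nonneg hC
  by_cases hT : GG ρ Psrc 𝒬 D n = ⊤
  · rw [hT, EReal.coe_mul_top_of_pos (by positivity)]
    simp
  have hB : GG ρ Psrc 𝒬 D n ≠ ⊥ := ne_bot_of_le_ne_bot (by simp) (GG_nonneg Psrc 𝒬 D n)
  have hle := fun l => le_GG ρ Psrc 𝒬 D n (l := l)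
  lift GG ρ Psrc 𝒬 D n to ℝ using ⟨hT, hB⟩ with g
  refine iSup₂_le fun l hl => ?_
  have h1 := hle l hl
  have hAn : AA ρ Psrc 𝒬 l n ≠ ∞ := by
    intro h; rw [h, EReal.coe_ennreal_top, EReal.coe_add_top] at h1; simp at h1
  have h2 := (AA_lin hρm hρ0 Psrc hP 𝒬 hQstat hC hmix hl n).1
  have htop : AA ρ Psrc 𝒬 l n + n * ENNReal.ofReal (Real.log C) ≠ ∞ := by finiteness
  have hA1 : AA ρ Psrc 𝒬 l 1 ≠ ∞ := by
    intro h; rw [h, ENNReal.mul_top (by simpa using hn.ne')] at h2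
    exact htop (top_le_iff.1 h2)
  have h3 := ENNReal.toReal_mono htop h2
  rw [ENNReal.toReal_add hAn (by finiteness), ENNReal.toReal_mul, ENNReal.toReal_mul,
    ENNReal.toReal_ofReal lC, ENNReal.toReal_natCast] at h3
  rw [coe_eq hAn] at h1
  rw [coe_eq hA1]
  norm_cast at h1 ⊢
  rw [one_mul]
  have : (n:ℝ) * (l * D + (AA ρ Psrc 𝒬 l 1).toReal) ≤ g + n * Real.log C := by
    push_cast at h1
    nlinarith
  have h4 : l * D + (AA ρ Psrc 𝒬 l 1).toReal ≤ (g + n * Real.log C) / n := by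
    rw [le_div_iff₀ hn']; linarith
  refine h4.trans (le_of_eq ?_)
  field_simp

lemma GG_upper (hρm : Measurable ρ) (hρ0 : ∀ z, 0 ≤ ρ z)
    (Psrc : Measure (ℕ → S)) [IsProbabilityMeasure Psrc] (hP : MeasurePreserving shiftSeq Psrc Psrc)
    (𝒬 : Measure (ℕ → T)) [IsProbabilityMeasure 𝒬]
    (hQstat : MeasurePreserving shiftSeq 𝒬 𝒬)
    {C : ℝ} (hC : 1 ≤ C) (hmix : Mixing 𝒬 C) (D : ℝ) (n : ℕ) {g : ℝ}
    (hg : GG ρ Psrc 𝒬 D 1 = g) :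
    GG ρ Psrc 𝒬 D n ≤ ((n * (g + Real.log C) : ℝ) : EReal) := by
  have lC := Real.log_nonneg hC
  refine iSup₂_le fun l hl => ?_
  have h1 := le_GG ρ Psrc 𝒬 D 1 (l := l) hl
  rw [hg] at h1
  have hA1 : AA ρ Psrc 𝒬 l 1 ≠ ∞ := by
    intro h; rw [h, EReal.coe_ennreal_top, EReal.coe_add_top] at h1; simp at h1
  have h2 := (AA_lin hρm hρ0 Psrc hP 𝒬 hQstat hC hmix hl n).2
  have htop : n * AA ρ Psrc 𝒬 l 1 + n * ENNReal.ofReal (Real.log C) ≠ ∞ := by finiteness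
  have hAn := ne_top_of_le_ne_top htop h2
  have h3 := ENNReal.toReal_mono htop h2
  rw [ENNReal.toReal_add (by finiteness) (by finiteness), ENNReal.toReal_mul, ENNReal.toReal_mul,
    ENNReal.toReal_ofReal lC, ENNReal.toReal_natCast] at h3
  rw [coe_eq hA1, Nat.cast_one, one_mul] at h1
  rw [coe_eq hAn]
  norm_cast at h1 ⊢
  have hn' : (0 : ℝ) ≤ n := by positivity
  nlinarith

lemma GG_add (hρm : Measurable ρ) (hρ0 : ∀ z, 0 ≤ ρ z)
    (Psrc : Measure (ℕ → S)) [IsProbabilityMeasure Psrc] (hP : MeasurePreserving shiftSeq Psrc Psrc)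
    (𝒬 : Measure (ℕ → T)) [IsProbabilityMeasure 𝒬]
    (hQstat : MeasurePreserving shiftSeq 𝒬 𝒬)
    {C : ℝ} (hC : 1 ≤ C) (hmix : Mixing 𝒬 C) (D : ℝ) (m n : ℕ) {a b : ℝ}
    (ha : GG ρ Psrc 𝒬 D m = a) (hb : GG ρ Psrc 𝒬 D n = b) :
    GG ρ Psrc 𝒬 D (m + n) ≤ ((a + b + Real.log C : ℝ) : EReal) := by
  have lC := Real.log_nonneg hC
  refine iSup₂_le fun l hl => ?_
  have h1 := le_GG ρ Psrc 𝒬 D m (l := l) hl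
  have h1' := le_GG ρ Psrc 𝒬 D n (l := l) hl
  rw [ha] at h1
  rw [hb] at h1'
  have hAm : AA ρ Psrc 𝒬 l m ≠ ∞ := by
    intro h; rw [h, EReal.coe_ennreal_top, EReal.coe_add_top] at h1; simp at h1
  have hAn : AA ρ Psrc 𝒬 l n ≠ ∞ := by
    intro h; rw [h, EReal.coe_ennreal_top, EReal.coe_add_top] at h1'; simp at h1'
  have h2 := (AA_add hρm hρ0 Psrc hP 𝒬 hQstat hC hmix hl m n).2
  have htop : AA ρ Psrc 𝒬 l m + AA ρ Psrc 𝒬 l n + ENNReal.ofReal (Real.log C) ≠ ∞ := by finiteness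
  have hA := ne_top_of_le_ne_top htop h2
  have h3 := ENNReal.toReal_mono htop h2
  rw [ENNReal.toReal_add (by finiteness) (by finiteness), ENNReal.toReal_add hAm hAn,
    ENNReal.toReal_ofReal lC] at h3
  rw [coe_eq hAm] at h1
  rw [coe_eq hAn] at h1'
  rw [coe_eq hA]
  norm_cast at h1 h1' ⊢
  push_cast
  nlinarith

lemma GG_lim (hρm : Measurable ρ) (hρ0 : ∀ z, 0 ≤ ρ z)
    (Psrc : Measure (ℕ → S)) [IsProbabilityMeasure Psrc] (hP : MeasurePreserving shiftSeq Psrc Psrc)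
    (𝒬 : Measure (ℕ → T)) [IsProbabilityMeasure 𝒬]
    (hQstat : MeasurePreserving shiftSeq 𝒬 𝒬)
    {C : ℝ} (hC : 1 ≤ C) (hmix : Mixing 𝒬 C) (D : ℝ) :
    ∃ r : EReal, Tendsto (fun n : ℕ => (((n : ℝ)⁻¹ : ℝ) : EReal) * GG ρ Psrc 𝒬 D n) atTop (𝓝 r) ∧
      (r = ⊤ ↔ GG ρ Psrc 𝒬 D 1 = ⊤) := by
  have hB : ∀ n, GG ρ Psrc 𝒬 D n ≠ ⊥ := fun n =>
    ne_bot_of_le_ne_bot (by simp) (GG_nonneg Psrc 𝒬 D n)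
  by_cases hT : GG ρ Psrc 𝒬 D 1 = ⊤
  · refine ⟨⊤, ?_, by simp [hT]⟩
    refine tendsto_const_nhds.congr' ?_
    filter_upwards [eventually_gt_atTop 0] with n hn
    have h := GG_lower hρm hρ0 Psrc hP 𝒬 hQstat hC hmix D hn
    rw [hT, top_le_iff] at h
    by_contra hne
    exact EReal.add_ne_top (Ne.symm hne) (EReal.coe_ne_top _) h
  · have hfin : ∀ n, ∃ g : ℝ, GG ρ Psrc 𝒬 D n = g := by
      intro n
      have h := GG_upper hρm hρ0 Psrc hP 𝒬 hQstat hC hmix D n (EReal.coe_toReal hT (hB 1)).symm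
      exact ⟨_, (EReal.coe_toReal (ne_top_of_le_ne_top (EReal.coe_ne_top _) h) (hB n)).symm⟩
    choose g hg using hfin
    have g0 : ∀ n, 0 ≤ g n := fun n => by
      have := GG_nonneg (ρ := ρ) Psrc 𝒬 D n
      rw [hg n] at this
      exact_mod_cast this
    have lC := Real.log_nonneg hC
    have hsub : Subadditive fun n => g n + Real.log C := by
      intro m n
      have := GG_add hρm hρ0 Psrc hP 𝒬 hQstat hC hmix D m n (hg m) (hg n)
      rw [hg] at this
      have := EReal.coe_le_coe_iff.1 this
      linarith
    have hbdd : BddBelow (range fun n : ℕ => (g n + Real.log C) / n) := by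
      refine ⟨0, ?_⟩
      rintro _ ⟨n, rfl⟩
      have := g0 n
      positivity
    have ht := hsub.tendsto_lim hbdd
    have ht2 : Tendsto (fun n : ℕ => (g n + Real.log C) / n - Real.log C / n) atTop
        (𝓝 (hsub.lim - 0)) :=
      ht.sub (tendsto_const_div_atTop_nhds_zero_nat _)
    refine ⟨((hsub.lim - 0 : ℝ) : EReal), ?_, by simp [hT, EReal.coe_ne_top]⟩
    refine (continuous_coe_real_ereal.continuousAt.tendsto.comp ht2).congr fun n => ?_
    rw [hg, ← EReal.coe_mul]
    simp only [Function.comp]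
    congr 1
    ring

end main
end Aux15

/-- under the mixing condition, for every `n ≥ 1` and every `D`,
`Λ*(P,Q,D) - log C ≤ Λ_n*(P_n,Q_n,D) ≤ Λ*(P,Q,D) + log C`; consequently the limit
`R_∞(ℙ,𝒬,D) = lim_n Λ_n*(P_n,Q_n,D)` exists and `D_min(P,Q) = D_min(ℙ,𝒬)`. -/
theorem stmt15 {S T : Type*} [MeasurableSpace S] [StandardBorelSpace S]
    [MeasurableSpace T] [StandardBorelSpace T]
    (ρ : S × T → ℝ) (hρm : Measurable ρ) (hρ0 : ∀ z, 0 ≤ ρ z)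
    (Psrc : Measure (ℕ → S)) [IsProbabilityMeasure Psrc] (hErg : Ergodic shiftSeq Psrc)
    (𝒬 : Measure (ℕ → T)) [IsProbabilityMeasure 𝒬]
    (hQstat : MeasurePreserving shiftSeq 𝒬 𝒬)
    (P : Measure S) [IsProbabilityMeasure P] (hP1 : Psrc.map (fun x => x 0) = P)
    (Q : Measure T) [IsProbabilityMeasure Q] (hQ1 : 𝒬.map (fun y => y 0) = Q)
    (C : ℝ) (hC : 1 ≤ C) (hmix : Mixing 𝒬 C) :
    (∀ n : ℕ, 0 < n → ∀ D : ℝ,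
      LamStar ρ P Q D - ((Real.log C : ℝ) : EReal) ≤
        LamStarN ρ n (margN Psrc n) (margN 𝒬 n) D ∧
      LamStarN ρ n (margN Psrc n) (margN 𝒬 n) D ≤
        LamStar ρ P Q D + ((Real.log C : ℝ) : EReal)) ∧
    ∃ Rinf : ℝ → EReal,
      (∀ D : ℝ, Tendsto (fun n => LamStarN ρ n (margN Psrc n) (margN 𝒬 n) D) atTop
        (𝓝 (Rinf D))) ∧
      sInf {D : ℝ | LamStar ρ P Q D ≠ ⊤} = sInf {D : ℝ | Rinf D ≠ ⊤} := by
  have hP := hErg.toMeasurePreserving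
  have eS := fun D => Aux15.LamStar_eq hρm Psrc 𝒬 P hP1 Q hQ1 D
  refine ⟨fun n hn D => ?_, ?_⟩
  · rw [Aux15.LamStarN_eq hρm Psrc 𝒬 D hn, eS]
    constructor
    · rw [EReal.sub_le_iff_le_add (by simp) (by simp)]
      exact Aux15.GG_lower hρm hρ0 Psrc hP 𝒬 hQstat hC hmix D hn
    · by_cases hT : Aux15.GG ρ Psrc 𝒬 D 1 = ⊤
      · simp [hT]
      have hB : ∀ n, Aux15.GG ρ Psrc 𝒬 D n ≠ ⊥ := fun n =>
        ne_bot_of_le_ne_bot (by simp) (Aux15.GG_nonneg Psrc 𝒬 D n)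
      have hg := (EReal.coe_toReal hT (hB 1)).symm
      have h := Aux15.GG_upper hρm hρ0 Psrc hP 𝒬 hQstat hC hmix D n hg
      have hg' := (EReal.coe_toReal (ne_top_of_le_ne_top (EReal.coe_ne_top _) h) (hB n)).symm
      rw [hg'] at h ⊢
      rw [hg]
      rw [← EReal.coe_mul, ← EReal.coe_add, EReal.coe_le_coe_iff]
      rw [EReal.coe_le_coe_iff] at h
      rw [inv_mul_le_iff₀ (by positivity)]
      exact h
  · choose R hR hR2 using fun D => Aux15.GG_lim hρm hρ0 Psrc hP 𝒬 hQstat hC hmix D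
    refine ⟨R, fun D => (hR D).congr' ?_, ?_⟩
    · filter_upwards [eventually_gt_atTop 0] with n hn
      rw [Aux15.LamStarN_eq hρm Psrc 𝒬 D hn]
    · congr 1
      ext D
      simp only [mem_setOf_eq, ne_eq, hR2, eS]

end
end

section
/- Let (Z_n)_{n≥1} be nonnegative real-valued random variables such that Λ(λ) := lim_{n→∞} (1/n) log E e^{nλZ_n} exists in the extended reals for every λ ∈ ℝ, and set Λ*(D) := sup_{λ ≤ 0}[λD − Λ(λ)]. Then for every D, limsup_{n→∞} (1/n) log Prob{Z_n ≤ D} ≤ −Λ*(D). Furthermore, if Λ* is strictly convex on an open interval (a,b), then lim_{n→∞} (1/n) log Prob{Z_n ≤ D} = −Λ*(D) for every D ∈ (a, b]. -/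
open MeasureTheory Filter Set Topology Classical
open scoped ENNReal NNReal

noncomputable section

open ProbabilityTheory in
lemma int_exp {Ω : Type*} [MeasurableSpace Ω] (μ : Measure Ω) [IsProbabilityMeasure μ]
    (X : Ω → ℝ) (hX : Measurable X) (h0 : ∀ ω, 0 ≤ X ω) (s : ℝ) (hs : s ≤ 0) :
    Integrable (fun ω => Real.exp (s * X ω)) μ := by
  refine Integrable.of_bound (C := 1) (by fun_prop) ?_
  filter_upwards with ω
  rw [Real.norm_eq_abs, abs_of_pos (Real.exp_pos _), Real.exp_le_one_iff]
  exact mul_nonpos_of_nonpos_of_nonneg hs (h0 ω)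

open ProbabilityTheory in
lemma cgf_convex {Ω : Type*} [MeasurableSpace Ω] (μ : Measure Ω) [IsProbabilityMeasure μ]
    (X : Ω → ℝ) (hX : Measurable X) (h0 : ∀ ω, 0 ≤ X ω) :
    ConvexOn ℝ (Iic 0) (cgf X μ) := by
  refine ⟨convex_Iic 0, ?_⟩
  intro l hl m hm t s ht hs hts
  simp only [smul_eq_mul, mem_Iic] at *
  have hlm : t * l + s * m ≤ 0 := by nlinarith
  have il := int_exp μ X hX h0 l hl
  have im := int_exp μ X hX h0 m hm
  have ilm := int_exp μ X hX h0 _ hlm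
  have e1 := exp_cgf il
  have e2 := exp_cgf im
  have e3 := exp_cgf ilm
  have key : ∀ ω, Real.exp ((t * l + s * m) * X ω) * Real.exp (-(t * cgf X μ l + s * cgf X μ m))
      ≤ t * (Real.exp (l * X ω) * Real.exp (-cgf X μ l))
        + s * (Real.exp (m * X ω) * Real.exp (-cgf X μ m)) := by
    intro ω
    have := convexOn_exp.2 (mem_univ (l * X ω - cgf X μ l)) (mem_univ (m * X ω - cgf X μ m))
      ht hs hts
    simp only [smul_eq_mul] at this
    rw [← Real.exp_add, ← Real.exp_add, ← Real.exp_add]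
    refine le_trans (le_of_eq ?_) this
    ring_nf
  have h := integral_mono (μ := μ) (ilm.mul_const _)
    (((il.mul_const _).const_mul t).add ((im.mul_const _).const_mul s)) key
  simp only [Pi.add_apply] at h
  rw [integral_add ((il.mul_const _).const_mul t) ((im.mul_const _).const_mul s),
    integral_const_mul, integral_const_mul, integral_mul_const, integral_mul_const,
    integral_mul_const] at h
  change mgf X μ _ * _ ≤ t * (mgf X μ l * _) + s * (mgf X μ m * _) at h
  rw [← e1, ← e2, ← e3, ← Real.exp_add, ← Real.exp_add, ← Real.exp_add, add_neg_cancel,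
    add_neg_cancel, Real.exp_zero, mul_one, mul_one, hts, Real.exp_le_one_iff] at h
  linarith

open ProbabilityTheory in
lemma tilt_bound {Ω : Type*} [MeasurableSpace Ω] (μ : Measure Ω) [IsProbabilityMeasure μ]
    (X : Ω → ℝ) (hX : Measurable X) (h0 : ∀ ω, 0 ≤ X ω) (s u v y₁ y₂ : ℝ) (hs : s ≤ 0)
    (hu : 0 ≤ u) (hv : 0 ≤ v) (hsv : s + v ≤ 0) :
    mgf X μ s ≤ Real.exp (s * y₁) * μ.real {ω | X ω ≤ y₂}
      + Real.exp (u * y₁) * mgf X μ (s - u) + Real.exp (-v * y₂) * mgf X μ (s + v) := by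
  have i0 := int_exp μ X hX h0 s hs
  have i1 := int_exp μ X hX h0 (s - u) (by linarith)
  have i2 := int_exp μ X hX h0 _ hsv
  have hm : MeasurableSet {ω | X ω ≤ y₂} := measurableSet_le hX measurable_const
  have i3 : Integrable ({ω | X ω ≤ y₂}.indicator (fun _ => (1 : ℝ))) μ :=
    (integrable_const _).indicator hm
  have key : ∀ ω, Real.exp (s * X ω) ≤
      Real.exp (s * y₁) * {ω | X ω ≤ y₂}.indicator (fun _ => (1 : ℝ)) ω
      + Real.exp (u * y₁) * Real.exp ((s - u) * X ω)
      + Real.exp (-v * y₂) * Real.exp ((s + v) * X ω) := by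
    intro ω
    have hi : 0 ≤ {ω | X ω ≤ y₂}.indicator (fun _ => (1 : ℝ)) ω :=
      indicator_nonneg (fun _ _ => zero_le_one) _
    have p1 := mul_nonneg (Real.exp_pos (s * y₁)).le hi
    rw [← Real.exp_add, ← Real.exp_add]
    have p2 := Real.exp_pos (u * y₁ + (s - u) * X ω)
    have p3 := Real.exp_pos (-v * y₂ + (s + v) * X ω)
    by_cases h1 : X ω ≤ y₁
    · have : Real.exp (s * X ω) ≤ Real.exp (u * y₁ + (s - u) * X ω) := by
        apply Real.exp_le_exp.2; nlinarith
      linarith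
    by_cases h2 : X ω ≤ y₂
    · have : Real.exp (s * X ω) ≤ Real.exp (s * y₁) := by
        apply Real.exp_le_exp.2; nlinarith
      rw [indicator_of_mem (show ω ∈ {ω | X ω ≤ y₂} from h2)]
      linarith
    · have : Real.exp (s * X ω) ≤ Real.exp (-v * y₂ + (s + v) * X ω) := by
        apply Real.exp_le_exp.2; nlinarith
      linarith
  have h := integral_mono (μ := μ) i0
    (((i3.const_mul _).add (i1.const_mul _)).add (i2.const_mul _)) key
  simp only [Pi.add_apply] at h
  have j3 := i3.const_mul (Real.exp (s * y₁))
  have j1 := i1.const_mul (Real.exp (u * y₁))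
  have j2 := i2.const_mul (Real.exp (-v * y₂))
  have j31 : Integrable (fun ω => Real.exp (s * y₁) *
      {ω | X ω ≤ y₂}.indicator (fun _ => (1 : ℝ)) ω
      + Real.exp (u * y₁) * Real.exp ((s - u) * X ω)) μ := j3.add j1
  rw [integral_add j31 j2, integral_add j3 j1, integral_const_mul, integral_const_mul,
    integral_const_mul, integral_indicator_const _ hm, smul_eq_mul, mul_one] at h
  exact h

lemma core_real (Λ f : ℝ → ℝ) (a b : ℝ) (hc : ConvexOn ℝ (Iic 0) Λ)
    (hf : ∀ D ∈ Ioo a b, IsLUB ((fun l => l * D - Λ l) '' Iic 0) (f D))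
    (hs : ∀ D₁ ∈ Ioo a b, ∀ D₂ ∈ Ioo a b, D₁ < D₂ → f ((D₁ + D₂) / 2) < (f D₁ + f D₂) / 2)
    (x : ℝ) (hx : x ∈ Ioo a b) :
    ∃ l₀ < 0, f x = l₀ * x - Λ l₀ ∧ ∀ ε > 0,
      (∃ θ ≥ 0, l₀ + θ ≤ 0 ∧ Λ (l₀ + θ) - Λ l₀ < θ * (x + ε)) ∧
      (∃ θ ≥ 0, Λ (l₀ - θ) - Λ l₀ < -θ * (x - ε)) := by
  have hle : ∀ D ∈ Ioo a b, ∀ l ≤ 0, l * D - Λ l ≤ f D := fun D hD l hl =>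
    (hf D hD).1 ⟨l, hl, rfl⟩
  have hlub : ∀ D ∈ Ioo a b, ∀ c, (∀ l ≤ 0, l * D - Λ l ≤ c) → f D ≤ c := by
    intro D hD c h
    refine (hf D hD).2 ?_
    rintro _ ⟨l, hl, rfl⟩
    exact h l hl
  have hanti : ∀ D₁ ∈ Ioo a b, ∀ D₂ ∈ Ioo a b, D₁ ≤ D₂ → f D₂ ≤ f D₁ := by
    intro D₁ h1 D₂ h2 h
    refine hlub _ h2 _ fun l hl => ?_
    have := hle _ h1 l hl
    nlinarith
  have hsanti : ∀ D₁ ∈ Ioo a b, ∀ D₂ ∈ Ioo a b, D₁ < D₂ → f D₂ < f D₁ := by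
    intro D₁ h1 D₂ h2 h
    have hm : (D₁ + D₂) / 2 ∈ Ioo a b := ⟨by linarith [h1.1, h2.1], by linarith [h1.2, h2.2]⟩
    have := hs _ h1 _ h2 h
    have := hanti _ hm _ h2 (by linarith)
    linarith
  obtain ⟨x₁, hx₁a, hx₁⟩ := exists_between hx.1
  obtain ⟨x₂, hx₂, hx₂b⟩ := exists_between hx.2
  have m1 : x₁ ∈ Ioo a b := ⟨hx₁a, hx₁.trans hx.2⟩
  have m2 : x₂ ∈ Ioo a b := ⟨hx.1.trans hx₂, hx₂b⟩
  have s2 := hsanti _ hx _ m2 hx₂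
  have s1 := hsanti _ m1 _ hx hx₁
  set δ := (f x - f x₂) / (2 * (x₂ - x)) with hδ
  set M := (f x₁ - f x + 1) / (x - x₁) with hM
  have hδ0 : 0 < δ := by apply div_pos <;> linarith
  have hM0 : 0 < M := by apply div_pos <;> linarith
  have hδe : δ * (x₂ - x) = (f x - f x₂) / 2 := by
    rw [hδ]; field_simp [(sub_pos.2 hx₂).ne']
  have hMe : M * (x - x₁) = f x₁ - f x + 1 := by
    rw [hM]; field_simp [(sub_pos.2 hx₁).ne']
  have hcont : ContinuousOn Λ (Iio 0) := by
    have := hc.continuousOn_interior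
    rwa [interior_Iic] at this
  -- maximizer
  have hK : ∀ l ≤ 0, l < -M ∨ -δ < l → l * x - Λ l ≤ f x - min 1 ((f x - f x₂) / 2) := by
    intro l hl h
    rcases h with h | h
    · have := hle _ m1 l hl
      have := min_le_left 1 ((f x - f x₂) / 2)
      nlinarith
    · have := hle _ m2 l hl
      have := min_le_right 1 ((f x - f x₂) / 2)
      nlinarith
  have hmin : 0 < min 1 ((f x - f x₂) / 2) := by
    apply lt_min one_pos; linarith
  have hne : (Icc (-M) (-δ)).Nonempty := by
    by_contra hemp
    have hMδ : ¬ (-M ≤ -δ) := fun h => hemp (nonempty_Icc.2 h)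
    have := hlub x hx (f x - min 1 ((f x - f x₂) / 2)) (fun l hl => hK l hl (by
      by_contra hh
      push Not at hh
      exact hMδ (hh.1.trans hh.2)))
    linarith
  obtain ⟨l₀, hl₀, hmax⟩ := isCompact_Icc.exists_isMaxOn hne
    (f := fun l => l * x - Λ l) (by
      refine ContinuousOn.sub (by fun_prop) (hcont.mono ?_)
      intro l hl
      exact lt_of_le_of_lt hl.2 (by linarith))
  have hl0 : l₀ < 0 := lt_of_le_of_lt hl₀.2 (by linarith)
  have hfx : f x = l₀ * x - Λ l₀ := by
    refine le_antisymm ?_ (hle _ hx _ hl0.le)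
    have hh := hlub x hx (max (l₀ * x - Λ l₀) (f x - min 1 ((f x - f x₂) / 2))) (by
      intro l hl
      by_cases h : l < -M ∨ -δ < l
      · exact (hK l hl h).trans (le_max_right _ _)
      · push Not at h
        exact (hmax (show l ∈ Icc (-M) (-δ) from ⟨h.1, h.2⟩)).trans (le_max_left _ _))
    rcases le_max_iff.1 hh with h | h
    · exact h
    · linarith
  refine ⟨l₀, hl0, hfx, fun ε hε => ⟨?_, ?_⟩⟩
  · by_contra hcon
    push Not at hcon
    set y := min (x + ε) x₂ with hy
    have hy1 : y ≤ x + ε := min_le_left _ _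
    have hy2 : y ≤ x₂ := min_le_right _ _
    have hxy : x < y := lt_min (by linarith) hx₂
    have aff : ∀ z, x ≤ z → z ≤ y → f z ≤ l₀ * z - Λ l₀ := by
      intro z hz1 hz2
      refine hlub z ⟨by linarith [hx.1], by linarith⟩ _ fun l hl => ?_
      rcases le_total l₀ l with h | h
      · have := hcon (l - l₀) (by linarith) (by linarith)
        rw [add_sub_cancel] at this
        nlinarith
      · have := hle _ hx l hl
        nlinarith
    have hyI : y ∈ Ioo a b := ⟨by linarith [hx.1], by linarith⟩
    have hmI : (x + y) / 2 ∈ Ioo a b := ⟨by linarith [hx.1], by linarith⟩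
    have h1 := hs x hx y hyI hxy
    have h2 := hle _ hmI l₀ hl0.le
    have h3 := aff y hxy.le le_rfl
    linarith
  · by_contra hcon
    push Not at hcon
    set y := max (x - ε) x₁ with hy
    have hy1 : x - ε ≤ y := le_max_left _ _
    have hy2 : x₁ ≤ y := le_max_right _ _
    have hxy : y < x := max_lt (by linarith) hx₁
    have aff : ∀ z, y ≤ z → z ≤ x → f z ≤ l₀ * z - Λ l₀ := by
      intro z hz1 hz2
      refine hlub z ⟨by linarith, by linarith [hx.2]⟩ _ fun l hl => ?_
      rcases le_total l₀ l with h | h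
      · have := hle _ hx l hl
        nlinarith
      · have := hcon (l₀ - l) (by linarith)
        rw [sub_sub_cancel] at this
        nlinarith
    have hyI : y ∈ Ioo a b := ⟨by linarith, by linarith [hx.2]⟩
    have hmI : (y + x) / 2 ∈ Ioo a b := ⟨by linarith, by linarith [hx.2]⟩
    have h1 := hs y hyI x hx hxy
    have h2 := hle _ hmI l₀ hl0.le
    have h3 := aff y le_rfl hxy.le
    linarith

lemma ev_exp (g : ℕ → ℝ) (c q : ℝ) (hq : 0 < q) (hg : Tendsto g atTop (𝓝 c)) (hc : c < 0) :
    ∀ᶠ n : ℕ in atTop, Real.exp (n * g n) ≤ q := by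
  have h : Tendsto (fun n : ℕ => (n : ℝ) * g n) atTop atBot :=
    tendsto_natCast_atTop_atTop.atTop_mul_neg hc hg
  filter_upwards [h.eventually_le_atBot (Real.log q)] with n hn
  exact (Real.le_log_iff_exp_le hq).1 hn

open ProbabilityTheory in
lemma lower_bound {Ω : Type*} [MeasurableSpace Ω] (μ : Measure Ω) [IsProbabilityMeasure μ]
    (Z : ℕ → Ω → ℝ) (hZm : ∀ n, Measurable (Z n)) (hZ0 : ∀ n ω, 0 ≤ Z n ω)
    (Λ : ℝ → ℝ)
    (hL : ∀ l ≤ 0, Tendsto (fun n : ℕ => (n : ℝ)⁻¹ * cgf (Z n) μ (n * l)) atTop (𝓝 (Λ l)))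
    (x D l₀ η : ℝ) (hxD : x < D) (hl₀ : l₀ < 0) (hη : 0 < η)
    (hθ : ∀ ε > 0,
      (∃ θ ≥ 0, l₀ + θ ≤ 0 ∧ Λ (l₀ + θ) - Λ l₀ < θ * (x + ε)) ∧
      (∃ θ ≥ 0, Λ (l₀ - θ) - Λ l₀ < -θ * (x - ε))) :
    ∀ᶠ n : ℕ in atTop,
      Real.exp (n * (-(l₀ * x - Λ l₀) - η)) ≤ μ.real {ω | Z n ω ≤ D} := by
  obtain ⟨v, hv0, hv, hv'⟩ := (hθ (D - x) (by linarith)).1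
  set e := η / (2 * -l₀) with he
  have he0 : 0 < e := by apply div_pos <;> linarith
  have hee : l₀ * e = -(η / 2) := by
    have := hl₀.ne
    rw [he]; field_simp
  obtain ⟨u, hu0, hu'⟩ := (hθ e he0).2
  set φ : ℝ → ℕ → ℝ := fun l n => (n : ℝ)⁻¹ * cgf (Z n) μ (n * l) with hφ
  have hm : ∀ n : ℕ, 0 < n → ∀ l ≤ 0, mgf (Z n) μ (n * l) = Real.exp (n * φ l n) := by
    intro n hn l hl
    have hn' : (n : ℝ) ≠ 0 := by exact_mod_cast hn.ne'
    rw [← exp_cgf (int_exp μ _ (hZm n) (hZ0 n) _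
      (mul_nonpos_of_nonneg_of_nonpos n.cast_nonneg hl)), hφ]
    simp only
    rw [mul_inv_cancel_left₀ hn']
  have t0 := hL l₀ hl₀.le
  have tu := hL (l₀ - u) (by linarith)
  have tv := hL (l₀ + v) hv
  have E1 := ev_exp (fun n => u * (x - e) + φ (l₀ - u) n - φ l₀ n) _ (1 / 4) (by norm_num)
    ((tu.const_add _).sub t0) (by linarith)
  have E2 := ev_exp (fun n => -v * D + φ (l₀ + v) n - φ l₀ n) _ (1 / 4) (by norm_num)
    ((tv.const_add _).sub t0) (by linarith)
  have E3 := ev_exp (fun n => (-(l₀ * x - Λ l₀) - η) + l₀ * (x - e) - φ l₀ n) _ (1 / 2)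
    (by norm_num) (t0.const_sub _) (by linarith)
  filter_upwards [E1, E2, E3, eventually_gt_atTop 0] with n e1 e2 e3 hn
  have hn' : (0 : ℝ) < n := by exact_mod_cast hn
  have hb := tilt_bound μ (Z n) (hZm n) (hZ0 n) (n * l₀) (n * u) (n * v) (x - e) D
    (by nlinarith) (by positivity) (by positivity) (by nlinarith)
  rw [← mul_sub, ← mul_add, hm n hn _ hl₀.le, hm n hn _ (by linarith), hm n hn _ hv,
    ← Real.exp_add, ← Real.exp_add] at hb
  have F1 : Real.exp (n * u * (x - e) + n * φ (l₀ - u) n) ≤ 1 / 4 * Real.exp (n * φ l₀ n) := by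
    refine le_trans (le_of_eq ?_) (mul_le_mul_of_nonneg_right e1 (Real.exp_pos _).le)
    rw [← Real.exp_add]; ring_nf
  have F2 : Real.exp (-(n * v) * D + n * φ (l₀ + v) n) ≤ 1 / 4 * Real.exp (n * φ l₀ n) := by
    refine le_trans (le_of_eq ?_) (mul_le_mul_of_nonneg_right e2 (Real.exp_pos _).le)
    rw [← Real.exp_add]; ring_nf
  have F3 : Real.exp (n * l₀ * (x - e)) * Real.exp (n * (-(l₀ * x - Λ l₀) - η))
      ≤ 1 / 2 * Real.exp (n * φ l₀ n) := by
    refine le_trans (le_of_eq ?_) (mul_le_mul_of_nonneg_right e3 (Real.exp_pos _).le)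
    rw [← Real.exp_add, ← Real.exp_add]; ring_nf
  refine le_of_mul_le_mul_left ?_ (Real.exp_pos (n * l₀ * (x - e)))
  linarith

/-- one-sided Gärtner–Ellis: if
`Λ(λ) = lim_n (1/n) log E e^{nλZ_n}` exists for all `λ`, then
`limsup_n (1/n) log P(Z_n ≤ D) ≤ -Λ*(D)` for every `D`; and if `Λ*` is strictly
convex on `(a,b)`, then `lim_n (1/n) log P(Z_n ≤ D) = -Λ*(D)` for all `D ∈ (a,b]`. -/
theorem stmt16 {Ω : Type*} [MeasurableSpace Ω] (ℙ : Measure Ω) [IsProbabilityMeasure ℙ]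
    (Z : ℕ → Ω → ℝ) (hZm : ∀ n, Measurable (Z n)) (hZ0 : ∀ n ω, 0 ≤ Z n ω)
    (L : ℝ → EReal)
    (hL : ∀ l : ℝ, Tendsto (fun n : ℕ => (((n : ℝ)⁻¹ : ℝ) : EReal) *
      eLog (∫⁻ ω, ENNReal.ofReal (Real.exp ((n : ℝ) * l * Z n ω)) ∂ℙ)) atTop
      (𝓝 (L l))) :
    (∀ D : ℝ, limsup (fun n : ℕ => (((n : ℝ)⁻¹ : ℝ) : EReal) *
        eLog (ℙ {ω | Z n ω ≤ D})) atTop ≤ -(FLT L D)) ∧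
    (∀ a b : ℝ, a < b →
      (∀ D₁ ∈ Ioo a b, ∀ D₂ ∈ Ioo a b, D₁ ≠ D₂ → ∀ t : ℝ, 0 < t → t < 1 →
        FLT L (t * D₁ + (1 - t) * D₂) <
          ((t : ℝ) : EReal) * FLT L D₁ + (((1 - t : ℝ)) : EReal) * FLT L D₂) →
      ∀ D : ℝ, a < D → D ≤ b →
        Tendsto (fun n : ℕ => (((n : ℝ)⁻¹ : ℝ) : EReal) *
          eLog (ℙ {ω | Z n ω ≤ D})) atTop (𝓝 (-(FLT L D)))) := by
  have hint : ∀ (n : ℕ) (l : ℝ), l ≤ 0 →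
      Integrable (fun ω => Real.exp ((n : ℝ) * l * Z n ω)) ℙ := fun n l hl =>
    int_exp ℙ (Z n) (hZm n) (hZ0 n) _ (mul_nonpos_of_nonneg_of_nonpos n.cast_nonneg hl)
  have hφ : ∀ l : ℝ, l ≤ 0 → Tendsto (fun n : ℕ =>
      (((n : ℝ)⁻¹ * ProbabilityTheory.cgf (Z n) ℙ (n * l) : ℝ) : EReal)) atTop (𝓝 (L l)) := by
    intro l hl
    refine (hL l).congr fun n => ?_
    have hp := ProbabilityTheory.mgf_pos (hint n l hl)
    rw [← ofReal_integral_eq_lintegral_ofReal (hint n l hl)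
      (Eventually.of_forall fun ω => (Real.exp_pos _).le)]
    change _ * eLog (ENNReal.ofReal (ProbabilityTheory.mgf (Z n) ℙ (n * l))) = _
    rw [EReal.coe_mul, eLog, if_neg (by simpa using hp), if_neg ENNReal.ofReal_ne_top,
      ENNReal.toReal_ofReal hp.le]
    rfl
  have hPn : ∀ (n : ℕ) (D : ℝ), ℙ {ω | Z n ω ≤ D} ≠ 0 →
      (((n : ℝ)⁻¹ : ℝ) : EReal) * eLog (ℙ {ω | Z n ω ≤ D}) =
        (((n : ℝ)⁻¹ * Real.log (ℙ.real {ω | Z n ω ≤ D}) : ℝ) : EReal) := by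
    intro n D h
    rw [eLog, if_neg h, if_neg (measure_ne_top _ _), EReal.coe_mul]
    rfl
  have hupper : ∀ D : ℝ, limsup (fun n : ℕ => (((n : ℝ)⁻¹ : ℝ) : EReal) *
        eLog (ℙ {ω | Z n ω ≤ D})) atTop ≤ -(FLT L D) := by
    intro D
    rw [EReal.le_neg]
    refine iSup₂_le fun l hl => ?_
    have hl : l ≤ 0 := hl
    have ht : Tendsto (fun n : ℕ =>
        (((n : ℝ)⁻¹ * ProbabilityTheory.cgf (Z n) ℙ (n * l) : ℝ) : EReal) + ((-(l * D) : ℝ) : EReal))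
        atTop (𝓝 (L l + ((-(l * D) : ℝ) : EReal))) := by
      have hc := EReal.continuousAt_add (p := (L l, ((-(l * D) : ℝ) : EReal)))
        (Or.inr (EReal.coe_ne_bot _)) (Or.inr (EReal.coe_ne_top _))
      exact hc.tendsto.comp ((hφ l hl).prodMk_nhds tendsto_const_nhds)
    have hle : limsup (fun n : ℕ => (((n : ℝ)⁻¹ : ℝ) : EReal) *
        eLog (ℙ {ω | Z n ω ≤ D})) atTop ≤ L l + ((-(l * D) : ℝ) : EReal) := by
      rw [← ht.limsup_eq]
      refine limsup_le_limsup ?_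
      filter_upwards [eventually_gt_atTop 0] with n hn
      have hn' : (0 : ℝ) < n := by exact_mod_cast hn
      by_cases h : ℙ {ω | Z n ω ≤ D} = 0
      · rw [h, eLog, if_pos rfl, EReal.coe_mul_bot_of_pos (by positivity)]
        exact bot_le
      · rw [hPn n D h, ← EReal.coe_add, EReal.coe_le_coe_iff]
        have hpos : 0 < ℙ.real {ω | Z n ω ≤ D} := ENNReal.toReal_pos h (measure_ne_top _ _)
        have hb := ProbabilityTheory.measure_le_le_exp_cgf (μ := ℙ) (X := Z n) (t := n * l) D
          (mul_nonpos_of_nonneg_of_nonpos n.cast_nonneg hl) (hint n l hl)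
        have hb' := (Real.log_le_iff_le_exp hpos).2 hb
        calc (n : ℝ)⁻¹ * Real.log (ℙ.real {ω | Z n ω ≤ D})
            ≤ (n : ℝ)⁻¹ * (-(n * l) * D + ProbabilityTheory.cgf (Z n) ℙ (n * l)) := by gcongr
          _ = _ := by field_simp; ring
    have h2 := EReal.neg_le_neg_iff.2 hle
    refine le_trans (le_of_eq ?_) h2
    rw [EReal.neg_add (Or.inr (EReal.coe_ne_top _)) (Or.inr (EReal.coe_ne_bot _)), EReal.coe_neg,
      sub_eq_add_neg, sub_eq_add_neg, neg_neg, add_comm]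
  refine ⟨hupper, ?_⟩
  intro a b hab hstrict D haD hDb
  have hL0 : L 0 = 0 := by
    have := hφ 0 le_rfl
    simp only [mul_zero, ProbabilityTheory.cgf_zero, EReal.coe_zero] at this
    exact (tendsto_nhds_unique this tendsto_const_nhds)
  have hFle : ∀ (D l : ℝ), l ≤ 0 → ((l * D : ℝ) : EReal) - L l ≤ FLT L D := fun D l hl =>
    le_iSup₂ (f := fun (l : ℝ) (_ : l ∈ Iic (0 : ℝ)) => ((l * D : ℝ) : EReal) - L l) l hl
  have hF0 : ∀ D, 0 ≤ FLT L D := by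
    intro D
    have := hFle D 0 le_rfl
    simpa [hL0] using this
  have hFanti : ∀ D₁ D₂ : ℝ, D₁ ≤ D₂ → FLT L D₂ ≤ FLT L D₁ := by
    intro D₁ D₂ h
    refine iSup₂_le fun l hl => le_trans ?_ (hFle D₁ l hl)
    refine EReal.sub_le_sub ?_ le_rfl
    exact EReal.coe_le_coe_iff.2 (mul_le_mul_of_nonpos_left h hl)
  have hFtop' : ∀ x ∈ Ioo a b, FLT L x ≠ ⊤ := by
    intro x hx
    obtain ⟨r, hr0, hr1, hr2⟩ : ∃ r > 0, a < x - r ∧ x + r < b := by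
      refine ⟨min (x - a) (b - x) / 2, ?_, ?_, ?_⟩
      · have := lt_min (sub_pos.2 hx.1) (sub_pos.2 hx.2); linarith
      · have := min_le_left (x - a) (b - x); linarith [hx.1]
      · have := min_le_right (x - a) (b - x); linarith [hx.2]
    have := hstrict (x - r) ⟨hr1, by linarith⟩ (x + r) ⟨by linarith, hr2⟩ (by linarith) (1 / 2)
      (by norm_num) (by norm_num)
    rw [show (1 / 2 * (x - r) + (1 - 1 / 2) * (x + r)) = x by ring] at this
    exact this.ne_top
  have hFtop : ∀ x, a < x → FLT L x ≠ ⊤ := by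
    intro x hx
    obtain ⟨y, hy1, hy2⟩ := exists_between (lt_min hx hab)
    exact ne_top_of_le_ne_top (hFtop' y ⟨hy1, hy2.trans_le (min_le_right _ _)⟩)
      (hFanti y x (hy2.le.trans (min_le_left _ _)))
  have hFbot : ∀ x, FLT L x ≠ ⊥ := fun x => ne_bot_of_le_ne_bot (by simp) (hF0 x)
  have hLbot : ∀ l ≤ 0, L l ≠ ⊥ := by
    intro l hl h
    have := hFle D l hl
    rw [h, EReal.sub_bot (EReal.coe_ne_bot _)] at this
    exact hFtop D haD (top_le_iff.1 this)
  have hLtop : ∀ l ≤ 0, L l ≠ ⊤ := by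
    intro l hl h
    have h0 : L l ≤ 0 := by
      refine le_of_tendsto (hφ l hl) (Eventually.of_forall fun n => ?_)
      rw [← EReal.coe_zero, EReal.coe_le_coe_iff]
      refine mul_nonpos_of_nonneg_of_nonpos (by positivity) ?_
      refine Real.log_nonpos ProbabilityTheory.mgf_nonneg ?_
      have := integral_mono (hint n l hl) (integrable_const (1 : ℝ)) (fun ω =>
        Real.exp_le_one_iff.2 (mul_nonpos_of_nonpos_of_nonneg
          (mul_nonpos_of_nonneg_of_nonpos n.cast_nonneg hl) (hZ0 n ω)))
      simpa [ProbabilityTheory.mgf] using this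
    rw [h] at h0
    simp at h0
  set Λ : ℝ → ℝ := fun l => (L l).toReal with hΛ
  set f : ℝ → ℝ := fun x => (FLT L x).toReal with hf
  have hLΛ : ∀ l ≤ 0, L l = (Λ l : EReal) := fun l hl =>
    (EReal.coe_toReal (hLtop l hl) (hLbot l hl)).symm
  have hFf : ∀ x, a < x → FLT L x = (f x : EReal) := fun x hx =>
    (EReal.coe_toReal (hFtop x hx) (hFbot x)).symm
  have hφΛ : ∀ l ≤ 0, Tendsto (fun n : ℕ =>
      (n : ℝ)⁻¹ * ProbabilityTheory.cgf (Z n) ℙ (n * l)) atTop (𝓝 (Λ l)) := by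
    intro l hl
    have := hφ l hl
    rw [hLΛ l hl] at this
    exact EReal.tendsto_coe.1 this
  have hfle : ∀ x, a < x → ∀ l ≤ 0, l * x - Λ l ≤ f x := by
    intro x hx l hl
    have := hFle x l hl
    rw [hLΛ l hl, hFf x hx, ← EReal.coe_sub, EReal.coe_le_coe_iff] at this
    exact this
  have hflub : ∀ x, a < x → ∀ c : ℝ, (∀ l ≤ 0, l * x - Λ l ≤ c) → f x ≤ c := by
    intro x hx c h
    have : FLT L x ≤ (c : EReal) := by
      refine iSup₂_le fun l hl => ?_
      rw [hLΛ l hl, ← EReal.coe_sub, EReal.coe_le_coe_iff]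
      exact h l hl
    rwa [hFf x hx, EReal.coe_le_coe_iff] at this
  have hconv : ConvexOn ℝ (Iic 0) Λ := by
    refine ⟨convex_Iic 0, ?_⟩
    intro l hl m hm t s ht hs hts
    simp only [smul_eq_mul, mem_Iic] at *
    have hlm : t * l + s * m ≤ 0 := by nlinarith
    refine le_of_tendsto_of_tendsto' (hφΛ _ hlm)
      (((hφΛ l hl).const_mul t).add ((hφΛ m hm).const_mul s)) fun n => ?_
    have := (cgf_convex ℙ (Z n) (hZm n) (hZ0 n)).2
      (show (n : ℝ) * l ∈ Iic 0 from mul_nonpos_of_nonneg_of_nonpos n.cast_nonneg hl)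
      (show (n : ℝ) * m ∈ Iic 0 from mul_nonpos_of_nonneg_of_nonpos n.cast_nonneg hm) ht hs hts
    simp only [smul_eq_mul] at this
    rw [show t * ((n : ℝ) * l) + s * (n * m) = n * (t * l + s * m) by ring] at this
    have h2 := mul_le_mul_of_nonneg_left this (show (0 : ℝ) ≤ (n : ℝ)⁻¹ by positivity)
    linarith
  have hmid : ∀ D₁ ∈ Ioo a b, ∀ D₂ ∈ Ioo a b, D₁ < D₂ →
      f ((D₁ + D₂) / 2) < (f D₁ + f D₂) / 2 := by
    intro D₁ h1 D₂ h2 h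
    have := hstrict D₁ h1 D₂ h2 h.ne (1 / 2) (by norm_num) (by norm_num)
    rw [show (1 / 2 * D₁ + (1 - 1 / 2) * D₂) = (D₁ + D₂) / 2 by ring,
      hFf _ (by linarith [h1.1, h2.1]), hFf _ h1.1, hFf _ h2.1, ← EReal.coe_mul, ← EReal.coe_mul,
      ← EReal.coe_add, EReal.coe_lt_coe_iff] at this
    linarith
  have hlow : ∀ c : ℝ, c < -f D → ∀ᶠ n : ℕ in atTop,
      (c : EReal) ≤ (((n : ℝ)⁻¹ : ℝ) : EReal) * eLog (ℙ {ω | Z n ω ≤ D}) := by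
    intro c hc
    -- choose `x < D` with `f x` close to `f D`
    obtain ⟨x, hax, hxD, hx⟩ : ∃ x, a < x ∧ x < D ∧ f x < -c := by
      obtain ⟨y, hy1, hy2⟩ := exists_between haD
      have hfy : 0 ≤ f y := EReal.toReal_nonneg (hF0 y)
      have hfD : 0 ≤ f D := EReal.toReal_nonneg (hF0 D)
      set d := -c - f D with hd
      have hd0 : 0 < d := by linarith
      set t := d / (2 * (f y + d)) with ht
      have ht0 : 0 < t := by positivity
      have ht1 : t < 1 := by rw [ht, div_lt_one (by positivity)]; linarith
      have hty : t * f y < d := by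
        have : t * (f y + d) = d / 2 := by rw [ht]; field_simp
        nlinarith
      refine ⟨t * y + (1 - t) * D, by nlinarith, by nlinarith, ?_⟩
      have : f (t * y + (1 - t) * D) ≤ t * f y + (1 - t) * f D := by
        refine hflub _ (by nlinarith) _ fun l hl => ?_
        have p1 := mul_le_mul_of_nonneg_left (hfle y hy1 l hl) ht0.le
        have p2 := mul_le_mul_of_nonneg_left (hfle D haD l hl) (sub_pos.2 ht1).le
        linarith
      nlinarith
    have hxI : x ∈ Ioo a b := ⟨hax, hxD.trans_le hDb⟩
    obtain ⟨l₀, hl₀, hfx, hθ⟩ := core_real Λ f a b hconv (by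
      intro z hz
      refine ⟨?_, ?_⟩
      · rintro _ ⟨l, hl, rfl⟩
        exact hfle z hz.1 l hl
      · intro c hc
        exact hflub z hz.1 c fun l hl => hc ⟨l, hl, rfl⟩) hmid x hxI
    have hev := lower_bound ℙ Z hZm hZ0 Λ hφΛ x D l₀ (-c - f x) hxD hl₀ (by linarith) hθ
    filter_upwards [hev, eventually_gt_atTop 0] with n hn hn0
    have hn' : (0 : ℝ) < n := by exact_mod_cast hn0
    rw [← hfx, show -f x - (-c - f x) = c by ring] at hn
    have hpos : 0 < ℙ.real {ω | Z n ω ≤ D} := (Real.exp_pos _).trans_le hn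
    have hne : ℙ {ω | Z n ω ≤ D} ≠ 0 := by
      intro h
      rw [Measure.real, h] at hpos
      simp at hpos
    rw [hPn n D hne, EReal.coe_le_coe_iff]
    have := (Real.le_log_iff_exp_le hpos).2 hn
    rw [inv_mul_eq_div, le_div_iff₀ hn']
    linarith
  refine tendsto_of_le_liminf_of_limsup_le ?_ (hupper D)
  rw [hFf D haD, ← EReal.coe_neg]
  by_contra hlt
  obtain ⟨c, hc1, hc2⟩ := EReal.lt_iff_exists_real_btwn.1 (not_le.1 hlt)
  refine absurd hc1 (not_lt.2 ?_)
  exact le_liminf_of_le (by isBoundedDefault) (hlow c (EReal.coe_lt_coe_iff.1 hc2))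

end
end
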